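/- Let C₀ > 0 be given. Then there exist constants C > 0 and B₀ > 0 such that for every B ≥ B₀, every vector field A satisfying condition (★) with constant C₀ at field strength B, and every complex-valued function u of class C¹ on a neighborhood of the closure of Ω, one has ∫_Ω |(−i∇ − B·A)u|² dx ≥ ( Θ₀·B − C₁·k_max·B^{1/2} − C·B^{1/4} ) · ∫_Ω |u|² dx. -/

import Mathlib

open MeasureTheory Filter Set Topology

noncomputable section

namespace SC

/-- The plane `ℝ²`. -/
abbrev Plane := ℝ × ℝ

/-- Squared Euclidean norm on the plane. -/
def esq (v : Plane) : ℝ := v.1 ^ 2 + v.2 ^ 2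

/-- Euclidean dot product on the plane. -/
def dot2 (v w : Plane) : ℝ := v.1 * w.1 + v.2 * w.2

/-- The reference vector potential `F₀(x) = (-x₂/2, x₁/2)`, with `curl F₀ = 1`. -/
def F0 : Plane → Plane := fun x => (-x.2 / 2, x.1 / 2)

/-- `u` is of class `Cⁿ` on a neighborhood of the closure of `Ω`. -/
def CNearCl {E : Type*} [NormedAddCommGroup E] [NormedSpace ℝ E]
    (n : ℕ) (Ω : Set Plane) (u : Plane → E) : Prop :=
  ∃ U : Set Plane, IsOpen U ∧ closure Ω ⊆ U ∧ ContDiffOn ℝ n u U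

/-- The pointwise squared magnetic gradient `|(-i∇ - B·A)u|²`. -/
def magSq (B : ℝ) (A : Plane → Plane) (u : Plane → ℂ) (x : Plane) : ℝ :=
  ‖(-Complex.I) * fderiv ℝ u x ((1 : ℝ), (0 : ℝ)) - ((B * (A x).1 : ℝ) : ℂ) * u x‖ ^ 2 +
  ‖(-Complex.I) * fderiv ℝ u x ((0 : ℝ), (1 : ℝ)) - ((B * (A x).2 : ℝ) : ℂ) * u x‖ ^ 2

/-- `curl A = ∂₁A₂ - ∂₂A₁`. -/
def curl2 (A : Plane → Plane) (x : Plane) : ℝ :=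
  fderiv ℝ (fun y => (A y).2) x ((1 : ℝ), (0 : ℝ)) -
    fderiv ℝ (fun y => (A y).1) x ((0 : ℝ), (1 : ℝ))

/-- The variational ground state energy `λ₁(B·A)` of the magnetic Neumann Laplacian. -/
def lam1A (Ω : Set Plane) (B : ℝ) (A : Plane → Plane) : ℝ :=
  sInf { r : ℝ | ∃ u : Plane → ℂ, CNearCl 1 Ω u ∧ (∫ x in Ω, ‖u x‖ ^ 2) ≠ 0 ∧
    r = (∫ x in Ω, magSq B A u x) / (∫ x in Ω, ‖u x‖ ^ 2) }

/-- `λ₁(B) = λ₁(B·F₀)`. -/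
def lam1 (Ω : Set Plane) (B : ℝ) : ℝ := lam1A Ω B F0

/-- The Ginzburg–Landau energy functional. -/
def GLenergy (Ω : Set Plane) (κ H : ℝ) (ψ : Plane → ℂ) (A : Plane → Plane) : ℝ :=
  ∫ x in Ω, (magSq (κ * H) A ψ x - κ ^ 2 * ‖ψ x‖ ^ 2 + κ ^ 2 / 2 * ‖ψ x‖ ^ 4
    + κ ^ 2 * H ^ 2 * (curl2 A x - 1) ^ 2)

/-- Admissible Ginzburg–Landau configurations. -/
def GLadm (Ω : Set Plane) (ψ : Plane → ℂ) (A : Plane → Plane) : Prop :=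
  CNearCl 1 Ω ψ ∧ CNearCl 1 Ω A

/-- The normal state is a minimizer at `(κ, H)`. -/
def NormalMin (Ω : Set Plane) (κ H : ℝ) : Prop :=
  ∀ ψ A, GLadm Ω ψ A → 0 ≤ GLenergy Ω κ H ψ A

/-- The normal state is the unique minimizer at `(κ, H)`. -/
def NormalUnique (Ω : Set Plane) (κ H : ℝ) : Prop :=
  NormalMin Ω κ H ∧
  ∀ ψ A, GLadm Ω ψ A → (∫ x in Ω, ‖ψ x‖ ^ 2) ≠ 0 → 0 < GLenergy Ω κ H ψ A

/-- `(ψ, A)` is a minimizer of the Ginzburg–Landau energy at `(κ, H)`. -/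
def IsGLMin (Ω : Set Plane) (κ H : ℝ) (ψ : Plane → ℂ) (A : Plane → Plane) : Prop :=
  GLadm Ω ψ A ∧ ∀ ψ' A', GLadm Ω ψ' A' → GLenergy Ω κ H ψ A ≤ GLenergy Ω κ H ψ' A'

/-- Lower global critical field. -/
def HC3low (Ω : Set Plane) (κ : ℝ) : ℝ := sInf {H : ℝ | 0 < H ∧ NormalMin Ω κ H}

/-- Upper global critical field. -/
def HC3up (Ω : Set Plane) (κ : ℝ) : ℝ :=
  sInf {H : ℝ | 0 < H ∧ ∀ H', H < H' → NormalUnique Ω κ H'}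

/-- Lower local critical field. -/
def HlocLow (Ω : Set Plane) (κ : ℝ) : ℝ :=
  sInf {H : ℝ | 0 < H ∧ κ ^ 2 ≤ lam1 Ω (κ * H)}

/-- Upper local critical field. -/
def HlocUp (Ω : Set Plane) (κ : ℝ) : ℝ :=
  sInf {H : ℝ | 0 < H ∧ ∀ H', H < H' → κ ^ 2 ≤ lam1 Ω (κ * H')}

/-- The inward unit normal `ν(s) = (-γ₂'(s), γ₁'(s))`. -/
def nuVec (γ : ℝ → Plane) (s : ℝ) : Plane := (-(deriv γ s).2, (deriv γ s).1)

/-- The curvature `k(s) = ⟨γ''(s), ν(s)⟩`. -/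
def curvOf (γ : ℝ → Plane) (s : ℝ) : ℝ := dot2 (deriv (deriv γ) s) (nuVec γ s)

/-- The maximal curvature. -/
def kmaxOf (γ : ℝ → Plane) : ℝ := sSup (Set.range (curvOf γ))

/-- A smooth counterclockwise arclength parametrization of the boundary of `Ω`. -/
structure BoundaryParam (Ω : Set Plane) where
  γ : ℝ → Plane
  L : ℝ
  L_pos : 0 < L
  smooth : ContDiff ℝ (⊤ : ℕ∞) γ
  periodic : Function.Periodic γ L
  unit_speed : ∀ s, esq (deriv γ s) = 1
  injOn : Set.InjOn γ (Set.Ico 0 L)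
  range_eq : Set.range γ = frontier Ω
  inward : ∀ s, ∃ ε > 0, ∀ t ∈ Set.Ioo (0 : ℝ) ε, γ s + t • nuVec γ s ∈ Ω

/-- The non-degeneracy assumption: finitely many points of maximal curvature,
all of them non-degenerate maxima. -/
def NonDegen {Ω : Set Plane} (P : BoundaryParam Ω) : Prop :=
  ∃ (N : ℕ) (s : Fin N → ℝ), 0 < N ∧ (∀ j, s j ∈ Set.Ico 0 P.L) ∧
    (∀ j, curvOf P.γ (s j) = kmaxOf P.γ) ∧
    (∀ t ∈ Set.Ico 0 P.L, (∀ j, t ≠ s j) → curvOf P.γ t < kmaxOf P.γ) ∧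
    (∀ j, deriv (deriv (curvOf P.γ)) (s j) < 0)

/-- The ground state energy `μ(ζ)` of the de Gennes half-line model operator. -/
def muGen (ζ : ℝ) : ℝ :=
  sInf { r : ℝ | ∃ φ : ℝ → ℝ, ContDiff ℝ 1 φ ∧ HasCompactSupport φ ∧
    (∃ τ, 0 < τ ∧ φ τ ≠ 0) ∧
    r = (∫ τ in Set.Ioi (0 : ℝ), ((deriv φ τ) ^ 2 + (τ + ζ) ^ 2 * (φ τ) ^ 2)) /
        (∫ τ in Set.Ioi (0 : ℝ), (φ τ) ^ 2) }

/-- The de Gennes constant `Θ₀`. -/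
def Theta0 : ℝ := sInf (Set.range muGen)

/-- Standard facts about the de Gennes constant, taken as hypotheses. -/
structure DeGennes where
  ξ₀ : ℝ
  u₀ : ℝ → ℝ
  theta_lb : 1 / 2 < Theta0
  theta_ub : Theta0 < 1
  ξ₀_mem : ξ₀ ∈ Set.Ioo (-1 : ℝ) 0
  ξ₀_min : muGen ξ₀ = Theta0
  ξ₀_uniq : ∀ ζ, muGen ζ = Theta0 → ζ = ξ₀
  ξ₀_sq : ξ₀ ^ 2 = Theta0
  u₀_pos : ∀ τ, 0 ≤ τ → 0 < u₀ τ
  u₀_smooth : ContDiffOn ℝ 2 u₀ (Set.Ici 0)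
  u₀_sq_int : IntegrableOn (fun τ => (u₀ τ) ^ 2) (Set.Ioi 0)
  u₀_normalized : (∫ τ in Set.Ioi (0 : ℝ), (u₀ τ) ^ 2) = 1
  u₀_neumann : derivWithin u₀ (Set.Ici 0) 0 = 0
  u₀_ode : ∀ τ ∈ Set.Ioi (0 : ℝ),
    -(deriv (deriv u₀) τ) + (τ + ξ₀) ^ 2 * u₀ τ = Theta0 * u₀ τ

/-- The universal constant `C₁ = u₀(0)²/3`. -/
def DeGennes.C1 (D : DeGennes) : ℝ := (D.u₀ 0) ^ 2 / 3

/-- Condition (★) on a vector field `A` at field strength `B` with constant `C₀`. -/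
def StarCond (Ω : Set Plane) (C₀ B : ℝ) (A : Plane → Plane) : Prop :=
  CNearCl 2 Ω A ∧
  (∀ x ∈ closure Ω, ‖A x‖ ≤ C₀) ∧
  (∀ x ∈ closure Ω, ‖fderiv ℝ A x‖ ≤ C₀) ∧
  (∀ x ∈ closure Ω, ‖fderiv ℝ (fderiv ℝ A) x‖ ≤ C₀) ∧
  (∀ x ∈ closure Ω, |curl2 A x - 1| ≤ C₀ * B ^ (-(1 : ℝ) / 4)) ∧
  (∀ x ∈ closure Ω, ‖fderiv ℝ (curl2 A) x‖ ≤ C₀ * B ^ (-(1 : ℝ) / 4)) ∧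
  (∀ x ∈ frontier Ω, curl2 A x = 1)

/-- The open unit disc. -/
def unitDisc : Set Plane := {x : Plane | x.1 ^ 2 + x.2 ^ 2 < 1}

/-- `Δ_B`: distance from `B/2 + ξ₀√B + δ₀` to the nearest integer. -/
def DeltaB (ξ₀ δ₀ B : ℝ) : ℝ :=
  sInf (Set.range (fun m : ℤ => |(m : ℝ) - B / 2 - ξ₀ * Real.sqrt B - δ₀|))

/-- Euclidean distance to the boundary of `Ω`. -/
def distBdry (Ω : Set Plane) (x : Plane) : ℝ :=
  sInf ((fun y => Real.sqrt (esq (x - y))) '' frontier Ω)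

end SC

namespace SC

lemma nonneg_of_deriv_nonpos_of_tendsto {a : ℝ} {f f' : ℝ → ℝ} (hc : ContinuousOn f (Ici a))
    (hd : ∀ x > a, HasDerivAt f (f' x) x) (hf' : ∀ x > a, f' x ≤ 0)
    (hl : Tendsto f atTop (𝓝 0)) {x : ℝ} (hx : a ≤ x) : 0 ≤ f x := by
  have hanti : AntitoneOn f (Ici a) := by
    apply antitoneOn_of_deriv_nonpos (convex_Ici a) hc
    · intro y hy
      rw [interior_Ici] at hy
      exact (hd y hy).differentiableAt.differentiableWithinAt
    · intro y hy
      rw [interior_Ici] at hy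
      rw [(hd y hy).deriv]
      exact hf' y hy
  refine le_of_tendsto hl ?_
  filter_upwards [eventually_ge_atTop x] with y hy
  exact hanti hx (le_trans hx hy : a ≤ y) hy

lemma pos_of_deriv_neg_of_tendsto {a : ℝ} {f f' : ℝ → ℝ} (hc : ContinuousOn f (Ici a))
    (hd : ∀ x > a, HasDerivAt f (f' x) x) (hf' : ∀ x > a, f' x < 0)
    (hl : Tendsto f atTop (𝓝 0)) {x : ℝ} (hx : a ≤ x) : 0 < f x := by
  have hanti : StrictAntiOn f (Ici a) := by
    apply strictAntiOn_of_deriv_neg (convex_Ici a) hc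
    intro y hy
    rw [interior_Ici] at hy
    rw [(hd y hy).deriv]
    exact hf' y hy
  have h1 : 0 ≤ f (x + 1) :=
    nonneg_of_deriv_nonpos_of_tendsto hc hd (fun y hy => (hf' y hy).le) hl (by linarith)
  have h2 : f (x + 1) < f x := hanti hx (show a ≤ x + 1 by linarith) (by linarith)
  linarith

/-- `u` is the normalized ground state of the half-line model operator, with derivative `p`. -/
structure IsGroundState (Θ ξ : ℝ) (u p : ℝ → ℝ) : Prop where
  half_lt : 1 / 2 < Θ
  lt_one : Θ < 1
  neg : ξ < 0
  neg_one_lt : -1 < ξ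
  sq_eq : ξ ^ 2 = Θ
  cont : ContinuousOn u (Ici 0)
  cont' : ContinuousOn p (Ici 0)
  deriv_zero : p 0 = 0
  hasDeriv : ∀ τ > 0, HasDerivAt u (p τ) τ
  hasDeriv' : ∀ τ > 0, HasDerivAt p (((τ + ξ) ^ 2 - Θ) * u τ) τ
  pos : ∀ τ, 0 ≤ τ → 0 < u τ
  sq_int : IntegrableOn (fun τ => u τ ^ 2) (Ioi 0)
  normalized : (∫ τ in Ioi (0 : ℝ), u τ ^ 2) = 1

lemma DeGennes.isGroundState (D : DeGennes) :
    IsGroundState Theta0 D.ξ₀ D.u₀ (derivWithin D.u₀ (Ici 0)) := by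
  have hd : ∀ τ > 0, derivWithin D.u₀ (Ici 0) =ᶠ[𝓝 τ] deriv D.u₀ := by
    intro τ hτ
    filter_upwards [Ioi_mem_nhds hτ] with y hy
    exact derivWithin_of_mem_nhds (Ici_mem_nhds hy)
  have hcd : ContDiffOn ℝ 1 (derivWithin D.u₀ (Ici 0)) (Ici 0) :=
    D.u₀_smooth.derivWithin (uniqueDiffOn_Ici 0) (by norm_num)
  refine ⟨D.theta_lb, D.theta_ub, D.ξ₀_mem.2, D.ξ₀_mem.1, D.ξ₀_sq, D.u₀_smooth.continuousOn,
    hcd.continuousOn, D.u₀_neumann, ?_, ?_, D.u₀_pos, D.u₀_sq_int, D.u₀_normalized⟩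
  · intro τ hτ
    rw [(hd τ hτ).eq_of_nhds]
    exact ((D.u₀_smooth.contDiffAt (Ici_mem_nhds hτ)).differentiableAt (by norm_num)).hasDerivAt
  · intro τ hτ
    have h1 : HasDerivAt (derivWithin D.u₀ (Ici 0)) (deriv (derivWithin D.u₀ (Ici 0)) τ) τ :=
      ((hcd.contDiffAt (Ici_mem_nhds hτ)).differentiableAt (by norm_num)).hasDerivAt
    rw [(hd τ hτ).deriv_eq] at h1
    have h2 := D.u₀_ode τ hτ
    convert h1 using 1
    linarith

namespace IsGroundState

variable {Θ ξ : ℝ} {u p : ℝ → ℝ} (G : IsGroundState Θ ξ u p)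
include G

lemma monotone_deriv : MonotoneOn p (Ici 2) := by
  apply monotoneOn_of_deriv_nonneg (convex_Ici 2)
  · exact G.cont'.mono (Ici_subset_Ici.2 (by norm_num))
  · intro y hy
    rw [interior_Ici] at hy
    exact (G.hasDeriv' y (lt_trans (by norm_num) hy)).differentiableAt.differentiableWithinAt
  · intro y hy
    rw [interior_Ici] at hy
    have hy' : (2 : ℝ) < y := hy
    rw [(G.hasDeriv' y (by linarith)).deriv]
    have := G.pos y (by linarith)
    have h1 := G.neg_one_lt
    have h2 := G.lt_one
    apply mul_nonneg _ this.le
    nlinarith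

lemma deriv_nonpos {τ : ℝ} (hτ : 2 ≤ τ) : p τ ≤ 0 := by
  by_contra! h
  have hmono : ∀ y ≥ τ, u τ ≤ u y := by
    have : MonotoneOn u (Ici τ) := by
      apply monotoneOn_of_deriv_nonneg (convex_Ici τ)
      · exact G.cont.mono (Ici_subset_Ici.2 (by linarith))
      · intro y hy
        rw [interior_Ici] at hy
        exact (G.hasDeriv y (by have : τ < y := hy; linarith)).differentiableAt.differentiableWithinAt
      · intro y hy
        rw [interior_Ici] at hy
        have hy' : τ < y := hy
        rw [(G.hasDeriv y (by linarith)).deriv]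
        exact h.le.trans (G.monotone_deriv hτ (show (2:ℝ) ≤ y by linarith) hy'.le)
    intro y hy
    exact this self_mem_Ici hy hy
  have hpos := G.pos τ (by linarith)
  have hconst : IntegrableOn (fun _ : ℝ => u τ ^ 2) (Ioi τ) := by
    refine Integrable.mono' (G.sq_int.mono_set (Ioi_subset_Ioi (by linarith : (0:ℝ) ≤ τ)))
      aestronglyMeasurable_const ?_
    refine (ae_restrict_iff' measurableSet_Ioi).2 (Eventually.of_forall fun y hy => ?_)
    rw [Real.norm_of_nonneg (sq_nonneg _)]
    exact pow_le_pow_left₀ hpos.le (hmono y (le_of_lt hy)) 2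
  rw [integrableOn_const_iff] at hconst
  rcases hconst with h0 | h0
  · simp [hpos.ne'] at h0
  · simp at h0

lemma deriv_add_nonpos {τ : ℝ} (hτ : 4 ≤ τ) : p τ + u τ ≤ 0 := by
  by_contra! h
  have hbd : ∀ y ≥ (4 : ℝ), u y ≤ u 4 := by
    have : AntitoneOn u (Ici 4) := by
      apply antitoneOn_of_deriv_nonpos (convex_Ici 4)
      · exact G.cont.mono (Ici_subset_Ici.2 (by linarith))
      · intro y hy
        rw [interior_Ici] at hy
        exact (G.hasDeriv y (by have : 4 < y := hy; linarith)).differentiableAt.differentiableWithinAt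
      · intro y hy
        rw [interior_Ici] at hy
        have hy' : 4 < y := hy
        rw [(G.hasDeriv y (by linarith)).deriv]
        exact G.deriv_nonpos (by linarith)
    intro y hy
    exact this self_mem_Ici hy hy
  set m := p τ + u τ with hm
  have hY : ∀ y > (0:ℝ), HasDerivAt (fun y => Real.exp (-y) * (p y + u y))
      (Real.exp (-y) * (((y + ξ) ^ 2 - Θ - 1) * u y)) y := by
    intro y hy
    have h1 := ((hasDerivAt_neg y).exp).mul ((G.hasDeriv' y hy).add (G.hasDeriv y hy))
    refine h1.congr_deriv ?_
    simp only [Pi.add_apply]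
    ring
  have hmono : MonotoneOn (fun y => Real.exp (-y) * (p y + u y)) (Ici 4) := by
    apply monotoneOn_of_deriv_nonneg (convex_Ici 4)
    · intro y hy
      exact (hY y (by have : (4:ℝ) ≤ y := hy; linarith)).continuousAt.continuousWithinAt
    · intro y hy
      rw [interior_Ici] at hy
      exact (hY y (by have : 4 < y := hy; linarith)).differentiableAt.differentiableWithinAt
    · intro y hy
      rw [interior_Ici] at hy
      have hy' : 4 < y := hy
      rw [(hY y (by linarith)).deriv]
      have := G.pos y (by linarith)
      have h1 := G.neg_one_lt
      have h2 := G.lt_one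
      refine mul_nonneg (Real.exp_pos _).le (mul_nonneg ?_ this.le)
      nlinarith
  set c := Real.exp (-τ) * m with hc
  have hcpos : 0 < c := by positivity
  have hlow : ∀ y ≥ τ, c * Real.exp y ≤ u 4 := by
    intro y hy
    have h1 : c ≤ Real.exp (-y) * (p y + u y) :=
      hmono (show (4:ℝ) ≤ τ from hτ) (show (4:ℝ) ≤ y by linarith) hy
    have h2 : p y ≤ 0 := G.deriv_nonpos (by linarith)
    have h3 := hbd y (by linarith)
    have h4 : c * Real.exp y ≤ Real.exp (-y) * (p y + u y) * Real.exp y :=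
      mul_le_mul_of_nonneg_right h1 (Real.exp_pos _).le
    have h5 : Real.exp (-y) * (p y + u y) * Real.exp y = p y + u y := by
      rw [Real.exp_neg]; field_simp
    linarith
  have hlim : Tendsto (fun y => c * Real.exp y) atTop atTop :=
    Real.tendsto_exp_atTop.const_mul_atTop hcpos
  obtain ⟨y, hy1, hy2⟩ := ((hlim.eventually_gt_atTop (u 4)).and (eventually_ge_atTop τ)).exists
  linarith [hlow y hy2]

lemma exists_exp_bound : ∃ C > 0, ∀ τ ≥ (5 : ℝ), u τ ≤ C * Real.exp (-τ) ∧
    |p τ| ≤ C * Real.exp (-τ) := by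
  have hY : ∀ y > (0:ℝ), HasDerivAt (fun y => Real.exp y * u y)
      (Real.exp y * (p y + u y)) y := by
    intro y hy
    have h1 := ((hasDerivAt_id y).exp).mul (G.hasDeriv y hy)
    refine h1.congr_deriv ?_
    simp only [id]
    ring
  have hanti : AntitoneOn (fun y => Real.exp y * u y) (Ici 4) := by
    apply antitoneOn_of_deriv_nonpos (convex_Ici 4)
    · intro y hy
      exact (hY y (by have : (4:ℝ) ≤ y := hy; linarith)).continuousAt.continuousWithinAt
    · intro y hy
      rw [interior_Ici] at hy
      exact (hY y (by have : 4 < y := hy; linarith)).differentiableAt.differentiableWithinAt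
    · intro y hy
      rw [interior_Ici] at hy
      have hy' : 4 < y := hy
      rw [(hY y (by linarith)).deriv]
      exact mul_nonpos_of_nonneg_of_nonpos (Real.exp_pos _).le (G.deriv_add_nonpos hy'.le)
  set c := Real.exp 4 * u 4 with hc
  have hcpos : 0 < c := mul_pos (Real.exp_pos _) (G.pos 4 (by norm_num))
  have hu : ∀ y ≥ (4:ℝ), u y ≤ c * Real.exp (-y) := by
    intro y hy
    have h1 : Real.exp y * u y ≤ c := hanti self_mem_Ici hy hy
    rw [Real.exp_neg, ← div_eq_mul_inv, le_div_iff₀ (Real.exp_pos _)]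
    linarith
  refine ⟨c * Real.exp 1, by positivity, fun τ hτ => ⟨?_, ?_⟩⟩
  · refine (hu τ (by linarith)).trans ?_
    have : (1:ℝ) ≤ Real.exp 1 := Real.one_le_exp (by norm_num)
    have h2 := Real.exp_pos (-τ)
    nlinarith [mul_pos hcpos h2]
  · obtain ⟨z, hz, hz'⟩ := exists_hasDerivAt_eq_slope u p (show τ - 1 < τ by linarith)
      (G.cont.mono fun y hy => show (0:ℝ) ≤ y by linarith [hy.1])
      (fun y hy => G.hasDeriv y (by linarith [hy.1]))
    have h1 : p z ≤ p τ := G.monotone_deriv (show (2:ℝ) ≤ z by linarith [hz.1])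
      (show (2:ℝ) ≤ τ by linarith) hz.2.le
    have h2 : p τ ≤ 0 := G.deriv_nonpos (by linarith)
    have h3 := hu (τ - 1) (by linarith)
    have h4 := G.pos τ (by linarith)
    have h5 : p z = u τ - u (τ - 1) := by rw [hz']; ring
    rw [abs_of_nonpos h2]
    have h6 : c * Real.exp 1 * Real.exp (-τ) = c * Real.exp (-(τ - 1)) := by
      rw [mul_assoc, ← Real.exp_add]; ring_nf
    linarith

lemma tendsto_pow_mul {f : ℝ → ℝ} {C : ℝ} (hf : ∀ τ ≥ (5 : ℝ), |f τ| ≤ C * Real.exp (-τ))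
    (k : ℕ) : Tendsto (fun τ => (τ + ξ) ^ k * f τ) atTop (𝓝 0) := by
  have h1 : Tendsto (fun x : ℝ => C * (x ^ k * Real.exp (-x))) atTop (𝓝 0) := by
    simpa using (Real.tendsto_pow_mul_exp_neg_atTop_nhds_zero k).const_mul C
  refine squeeze_zero_norm' ?_ h1
  filter_upwards [eventually_ge_atTop (5:ℝ)] with τ hτ
  have h2 := G.neg
  have h3 := G.neg_one_lt
  rw [Real.norm_eq_abs, abs_mul, abs_pow]
  have h4 : |τ + ξ| ≤ τ := by rw [abs_of_nonneg] <;> linarith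
  calc |τ + ξ| ^ k * |f τ| ≤ τ ^ k * (C * Real.exp (-τ)) := by
        gcongr
        exact hf τ hτ
    _ = _ := by ring

lemma tendsto_moments (k : ℕ) :
    Tendsto (fun τ => (τ + ξ) ^ k * u τ ^ 2) atTop (𝓝 0) ∧
    Tendsto (fun τ => (τ + ξ) ^ k * (u τ * p τ)) atTop (𝓝 0) ∧
    Tendsto (fun τ => (τ + ξ) ^ k * p τ ^ 2) atTop (𝓝 0) := by
  obtain ⟨C, hC, h⟩ := G.exists_exp_bound
  have hb : ∀ τ ≥ (5:ℝ), |u τ| ≤ C * Real.exp (-τ) := fun τ hτ => by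
    rw [abs_of_pos (G.pos τ (by linarith))]; exact (h τ hτ).1
  have hp : ∀ τ ≥ (5:ℝ), |p τ| ≤ C * Real.exp (-τ) := fun τ hτ => (h τ hτ).2
  have key : ∀ f g : ℝ → ℝ, (∀ τ ≥ (5:ℝ), |f τ| ≤ C * Real.exp (-τ)) →
      (∀ τ ≥ (5:ℝ), |g τ| ≤ C * Real.exp (-τ)) →
      Tendsto (fun τ => (τ + ξ) ^ k * (f τ * g τ)) atTop (𝓝 0) := by
    intro f g hf hg
    refine G.tendsto_pow_mul (C := C * C) (fun τ hτ => ?_) k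
    rw [abs_mul]
    have h1 : Real.exp (-τ) ≤ 1 := Real.exp_le_one_iff.2 (by linarith)
    calc |f τ| * |g τ| ≤ (C * Real.exp (-τ)) * (C * 1) := by
          gcongr
          · exact hf τ hτ
          · exact (hg τ hτ).trans (by gcongr)
      _ = _ := by ring
  refine ⟨?_, key u p hb hp, ?_⟩
  · simpa only [sq] using key u u hb hb
  · simpa only [sq] using key p p hp hp

end IsGroundState

lemma hasDerivAt_max_zero_sq (x : ℝ) :
    HasDerivAt (fun x : ℝ => max 0 x ^ 2) (2 * max 0 x) x := by
  rcases lt_trichotomy x 0 with h | h | h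
  · rw [max_eq_left h.le, mul_zero]
    refine (hasDerivAt_const x (0 : ℝ)).congr_of_eventuallyEq ?_
    filter_upwards [Iio_mem_nhds h] with y hy
    rw [max_eq_left (le_of_lt hy)]
    norm_num
  · subst h
    rw [max_self, mul_zero, hasDerivAt_iff_isLittleO]
    simp only [max_self, sub_zero, smul_eq_mul, mul_zero, ne_eq, OfNat.ofNat_ne_zero,
      not_false_eq_true, zero_pow]
    refine Asymptotics.IsBigO.trans_isLittleO (g := fun x : ℝ => x ^ 2) ?_ ?_
    · refine Asymptotics.IsBigO.of_bound 1 (Eventually.of_forall fun y => ?_)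
      rw [one_mul, norm_pow, norm_pow]
      refine pow_le_pow_left₀ (norm_nonneg _) ?_ 2
      rw [Real.norm_eq_abs, Real.norm_eq_abs, abs_of_nonneg (le_max_left _ _)]
      exact max_le (abs_nonneg _) (le_abs_self _)
    · simpa using Asymptotics.isLittleO_pow_id (𝕜 := ℝ) (n := 2) (by norm_num)
  · rw [max_eq_right h.le]
    refine (hasDerivAt_pow 2 x).congr_of_eventuallyEq ?_ |>.congr_deriv (by norm_num)
    filter_upwards [Ioi_mem_nhds h] with y hy
    rw [max_eq_right (le_of_lt hy)]

/-- A `C¹` function which is the identity below `R` and constant above `R + 1`. -/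
def plateau (R τ : ℝ) : ℝ := τ - max 0 (τ - R) ^ 2 / 2 + max 0 (τ - (R + 1)) ^ 2 / 2

/-- The derivative of `plateau`. -/
def plateauDeriv (R τ : ℝ) : ℝ := 1 - max 0 (τ - R) + max 0 (τ - (R + 1))

lemma hasDerivAt_plateau (R τ : ℝ) : HasDerivAt (plateau R) (plateauDeriv R τ) τ := by
  have h1 := (hasDerivAt_max_zero_sq (τ - R)).comp τ ((hasDerivAt_id τ).sub_const R)
  have h2 := (hasDerivAt_max_zero_sq (τ - (R + 1))).comp τ ((hasDerivAt_id τ).sub_const (R + 1))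
  refine (((hasDerivAt_id τ).sub (h1.div_const 2)).add (h2.div_const 2)).congr_deriv ?_
  simp only [plateauDeriv]
  ring

lemma continuous_plateauDeriv (R : ℝ) : Continuous (plateauDeriv R) := by
  unfold plateauDeriv
  fun_prop

lemma plateau_of_le {R τ : ℝ} (h : τ ≤ R) : plateau R τ = τ := by
  simp [plateau, max_eq_left (by linarith : τ - R ≤ 0),
    max_eq_left (by linarith : τ - (R + 1) ≤ 0)]

lemma plateauDeriv_of_le {R τ : ℝ} (h : τ ≤ R) : plateauDeriv R τ = 1 := by
  simp [plateauDeriv, max_eq_left (by linarith : τ - R ≤ 0),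
    max_eq_left (by linarith : τ - (R + 1) ≤ 0)]

lemma plateau_of_ge {R τ : ℝ} (h : R + 1 ≤ τ) : plateau R τ = R + 1 / 2 := by
  rw [plateau, max_eq_right (by linarith : 0 ≤ τ - R),
    max_eq_right (by linarith : 0 ≤ τ - (R + 1))]
  ring

lemma plateauDeriv_of_ge {R τ : ℝ} (h : R + 1 ≤ τ) : plateauDeriv R τ = 0 := by
  rw [plateauDeriv, max_eq_right (by linarith : 0 ≤ τ - R),
    max_eq_right (by linarith : 0 ≤ τ - (R + 1))]
  ring

lemma plateauDeriv_mem (R τ : ℝ) : plateauDeriv R τ ∈ Icc (0 : ℝ) 1 := by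
  unfold plateauDeriv
  rcases max_cases 0 (τ - R) with h | h <;> rcases max_cases 0 (τ - (R + 1)) with h' | h' <;>
    constructor <;> linarith [h.1, h.2, h'.1, h'.2]

lemma le_plateau {R τ : ℝ} (h : R ≤ τ) : R ≤ plateau R τ := by
  rw [plateau, max_eq_right (by linarith : 0 ≤ τ - R)]
  rcases max_cases 0 (τ - (R + 1)) with h' | h'
  · rw [h'.1]
    nlinarith [h'.2]
  · rw [h'.1]
    nlinarith [h'.2]

lemma plateau_nonneg {R τ : ℝ} (hR : 0 ≤ R) (h : 0 ≤ τ) : 0 ≤ plateau R τ := by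
  rcases le_total τ R with h' | h'
  · rwa [plateau_of_le h']
  · exact hR.trans (le_plateau h')

lemma quadratic_concave {μ D x H w : ℝ} (hμ0 : 0 ≤ μ) (hμ1 : μ ≤ 1) (hD : 0 < D) :
    μ * (-H ^ 2 - (2 * x * H - w) ^ 2 / D) + (1 - μ) * (-w ^ 2 / D)
      ≤ -(μ * H) ^ 2 - (2 * x * (μ * H) - w) ^ 2 / D := by
  have h : -(μ * H) ^ 2 - (2 * x * (μ * H) - w) ^ 2 / D
      - (μ * (-H ^ 2 - (2 * x * H - w) ^ 2 / D) + (1 - μ) * (-w ^ 2 / D))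
      = μ * (1 - μ) * (H ^ 2 + (2 * x * H) ^ 2 / D) := by
    field_simp
    ring
  have : 0 ≤ μ * (1 - μ) * (H ^ 2 + (2 * x * H) ^ 2 / D) := by
    have := sub_nonneg.2 hμ1
    positivity
  linarith

/-- The potential produced by a normal field `h` (with derivative `h'`), a weight `b`
(with derivative `b'`), scaled curvature `k` and magnetic field `β`. -/
def profileEnergy (k β h h' b b' : ℝ) : ℝ :=
  h' - k * h + b * β - h ^ 2 - (2 * b * h - b') ^ 2 / (4 * (1 - b ^ 2))

/-- Minus the logarithmic derivative of the half-line ground state. -/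
def logSlope (u p : ℝ → ℝ) (τ : ℝ) : ℝ := -p τ / u τ

/-- The derivative of `logSlope`, in closed form. -/
def slopeDeriv (Θ ξ : ℝ) (u p : ℝ → ℝ) (τ : ℝ) : ℝ := logSlope u p τ ^ 2 + Θ - (τ + ξ) ^ 2

/-- The derivative of `slopeDeriv`, in closed form. -/
def slopeDeriv₂ (Θ ξ : ℝ) (u p : ℝ → ℝ) (τ : ℝ) : ℝ :=
  2 * (logSlope u p τ * slopeDeriv Θ ξ u p τ - (τ + ξ))

/-- The leading-order normal field. -/
def field₀ (Θ ξ : ℝ) (u p : ℝ → ℝ) (τ : ℝ) : ℝ :=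
  logSlope u p τ - slopeDeriv Θ ξ u p τ * (τ + ξ)

/-- The curvature correction to the normal field. -/
def field₁ (Θ ξ : ℝ) (u p : ℝ → ℝ) (τ : ℝ) : ℝ :=
  -1 / 3 + ((τ + ξ) * logSlope u p τ - (τ + ξ) ^ 2 * slopeDeriv Θ ξ u p τ
    + Θ * slopeDeriv Θ ξ u p τ) / 3 + u 0 ^ 2 / 3 * (1 - ∫ s in (0 : ℝ)..τ, u s ^ 2) / u τ ^ 2

namespace IsGroundState

variable {Θ ξ : ℝ} {u p : ℝ → ℝ} (G : IsGroundState Θ ξ u p)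
include G

local notation "g" => logSlope u p
local notation "b" => slopeDeriv Θ ξ u p
local notation "v" => slopeDeriv₂ Θ ξ u p
local notation "h₀" => field₀ Θ ξ u p
local notation "h₁" => field₁ Θ ξ u p

lemma hasDerivAt_logSlope {τ : ℝ} (hτ : 0 < τ) : HasDerivAt g (b τ) τ := by
  have h := (G.hasDeriv' τ hτ).neg.div (G.hasDeriv τ hτ) (G.pos τ hτ.le).ne'
  refine h.congr_deriv ?_
  have := (G.pos τ hτ.le).ne'
  simp only [slopeDeriv, logSlope, Pi.neg_apply]
  field_simp
  ring

lemma hasDerivAt_slopeDeriv {τ : ℝ} (hτ : 0 < τ) : HasDerivAt b (v τ) τ := by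
  have h := (((G.hasDerivAt_logSlope hτ).pow 2).add_const Θ).sub
    (((hasDerivAt_id τ).add_const ξ).pow 2)
  refine h.congr_deriv ?_
  simp only [slopeDeriv₂, id]
  ring

lemma hasDerivAt_slopeDeriv₂ {τ : ℝ} (hτ : 0 < τ) :
    HasDerivAt v (2 * g τ * v τ - 2 * (1 - b τ ^ 2)) τ := by
  have h := (((G.hasDerivAt_logSlope hτ).mul (G.hasDerivAt_slopeDeriv hτ)).sub
    ((hasDerivAt_id τ).add_const ξ)).const_mul 2
  refine h.congr_deriv ?_
  ring

lemma hasDerivAt_sq {τ : ℝ} (hτ : 0 < τ) :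
    HasDerivAt (fun τ => u τ ^ 2) (-2 * g τ * u τ ^ 2) τ := by
  have h := (G.hasDeriv τ hτ).pow 2
  refine h.congr_deriv ?_
  have := (G.pos τ hτ.le).ne'
  simp only [logSlope]
  field_simp
  simp
  ring

lemma hasDerivAt_field₀ {τ : ℝ} (hτ : 0 < τ) : HasDerivAt h₀ (-v τ * (τ + ξ)) τ := by
  have h := (G.hasDerivAt_logSlope hτ).sub
    ((G.hasDerivAt_slopeDeriv hτ).mul ((hasDerivAt_id τ).add_const ξ))
  refine h.congr_deriv ?_
  simp only [id]
  ring

lemma continuousOn_logSlope : ContinuousOn g (Ici 0) :=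
  G.cont'.neg.div G.cont fun τ hτ => (G.pos τ hτ).ne'

lemma continuousOn_slopeDeriv : ContinuousOn b (Ici 0) :=
  ((G.continuousOn_logSlope.pow 2).add continuousOn_const).sub
    ((continuousOn_id.add continuousOn_const).pow 2)

lemma continuousOn_slopeDeriv₂ : ContinuousOn v (Ici 0) :=
  continuousOn_const.mul ((G.continuousOn_logSlope.mul G.continuousOn_slopeDeriv).sub
    (continuousOn_id.add continuousOn_const))

lemma continuousOn_field₀ : ContinuousOn h₀ (Ici 0) :=
  G.continuousOn_logSlope.sub
    (G.continuousOn_slopeDeriv.mul (continuousOn_id.add continuousOn_const))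

lemma continuousOn_sq : ContinuousOn (fun τ => u τ ^ 2) (Ici 0) := G.cont.pow 2

lemma hasDerivAt_primitive {τ : ℝ} (hτ : 0 < τ) :
    HasDerivAt (fun τ => ∫ s in (0 : ℝ)..τ, u s ^ 2) (u τ ^ 2) τ := by
  have hc : ContinuousOn (fun s => u s ^ 2) (Ioi 0) := G.continuousOn_sq.mono Ioi_subset_Ici_self
  refine intervalIntegral.integral_hasDerivAt_right ?_ ?_ ?_
  · refine (G.continuousOn_sq.mono ?_).intervalIntegrable
    rw [uIcc_of_le hτ.le]
    exact Icc_subset_Ici_self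
  · exact hc.stronglyMeasurableAtFilter isOpen_Ioi τ hτ
  · exact hc.continuousAt (Ioi_mem_nhds hτ)

lemma continuousOn_primitive :
    ContinuousOn (fun τ => ∫ s in (0 : ℝ)..τ, u s ^ 2) (Ici 0) := by
  have hi : ∀ x y : ℝ, 0 ≤ x → 0 ≤ y → IntervalIntegrable (fun s => u s ^ 2) volume x y := by
    intro x y hx hy
    refine (G.continuousOn_sq.mono fun z hz => ?_).intervalIntegrable
    exact (le_min hx hy).trans hz.1
  intro τ hτ
  have hτ' : (0 : ℝ) ≤ τ := hτ
  have h1 : ContinuousOn (fun τ => ∫ s in (0 : ℝ)..τ, u s ^ 2) (uIcc 0 (τ + 1)) := by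
    apply intervalIntegral.continuousOn_primitive_interval
    exact (hi 0 (τ + 1) le_rfl (by linarith)).1.congr_set_ae (by
      rw [uIcc_of_le (by linarith)]; exact Ioc_ae_eq_Icc.symm)
  rw [uIcc_of_le (by linarith)] at h1
  refine (h1 τ ⟨hτ', by linarith⟩).mono_of_mem_nhdsWithin ?_
  rw [← Ici_inter_Iic, inter_comm]
  exact inter_mem (mem_nhdsWithin_of_mem_nhds (Iic_mem_nhds (by linarith))) self_mem_nhdsWithin

lemma continuousOn_field₁ : ContinuousOn h₁ (Ici 0) := by
  have hT : ContinuousOn (fun τ : ℝ => τ + ξ) (Ici 0) := by fun_prop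
  refine (continuousOn_const.add (((hT.mul G.continuousOn_logSlope).sub
    ((hT.pow 2).mul G.continuousOn_slopeDeriv)).add
    (continuousOn_const.mul G.continuousOn_slopeDeriv) |>.div_const 3)).add
    ((continuousOn_const.mul (continuousOn_const.sub G.continuousOn_primitive)).div
      G.continuousOn_sq fun τ hτ => (pow_pos (G.pos τ hτ) 2).ne')

lemma hasDerivAt_field₁ {τ : ℝ} (hτ : 0 < τ) :
    HasDerivAt h₁ (2 * g τ * h₁ τ + h₀ τ - u 0 ^ 2 / 3) τ := by
  have hT : HasDerivAt (fun τ : ℝ => τ + ξ) 1 τ := (hasDerivAt_id τ).add_const ξ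
  have hu := (pow_pos (G.pos τ hτ.le) 2).ne'
  have hk := (((hT.mul (G.hasDerivAt_logSlope hτ)).sub
    ((hT.pow 2).mul (G.hasDerivAt_slopeDeriv hτ))).add
    ((G.hasDerivAt_slopeDeriv hτ).const_mul Θ)).div_const 3 |>.const_add (-1 / 3)
  have hI := (((G.hasDerivAt_primitive hτ).const_sub 1).const_mul (u 0 ^ 2 / 3)).div
    (G.hasDerivAt_sq hτ) hu
  refine (hk.add hI).congr_deriv ?_
  simp only [field₁, field₀, slopeDeriv₂, Pi.pow_apply]
  generalize (∫ s in (0 : ℝ)..τ, u s ^ 2) = I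
  have h3 : b τ = g τ ^ 2 + Θ - (τ + ξ) ^ 2 := rfl
  generalize g τ = y at *
  have hu' := (G.pos τ hτ.le).ne'
  generalize u τ = w at *
  rw [h3]
  field_simp
  ring

lemma logSlope_zero : g 0 = 0 := by simp [logSlope, G.deriv_zero]

lemma slopeDeriv_zero : b 0 = 0 := by simp [slopeDeriv, G.logSlope_zero, G.sq_eq]

lemma field₀_zero : h₀ 0 = 0 := by simp [field₀, G.logSlope_zero, G.slopeDeriv_zero]

lemma field₁_zero : h₁ 0 = 0 := by
  have := (G.pos 0 le_rfl).ne'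
  simp [field₁, G.logSlope_zero, G.slopeDeriv_zero]
  field_simp
  norm_num

lemma mul_sq_logSlope {τ : ℝ} (hτ : 0 ≤ τ) : g τ * u τ ^ 2 = -(u τ * p τ) := by
  have := (G.pos τ hτ).ne'
  simp only [logSlope]
  field_simp

lemma mul_sq_slopeDeriv {τ : ℝ} (hτ : 0 ≤ τ) :
    b τ * u τ ^ 2 = p τ ^ 2 + Θ * u τ ^ 2 - (τ + ξ) ^ 2 * u τ ^ 2 := by
  have := (G.pos τ hτ).ne'
  simp only [slopeDeriv, logSlope]
  field_simp

lemma tendsto_slopeDeriv (k : ℕ) :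
    Tendsto (fun τ => (τ + ξ) ^ k * (b τ * u τ ^ 2)) atTop (𝓝 0) := by
  have h := ((G.tendsto_moments k).2.2.add ((G.tendsto_moments k).1.const_mul Θ)).sub
    (G.tendsto_moments (k + 2)).1
  simp only [mul_zero, add_zero, sub_zero] at h
  refine h.congr' ?_
  filter_upwards [eventually_ge_atTop 0] with τ hτ
  rw [G.mul_sq_slopeDeriv hτ]
  ring

lemma tendsto_logSlope (k : ℕ) :
    Tendsto (fun τ => (τ + ξ) ^ k * (g τ * u τ ^ 2)) atTop (𝓝 0) := by
  have h := (G.tendsto_moments k).2.1.neg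
  simp only [neg_zero] at h
  refine h.congr' ?_
  filter_upwards [eventually_ge_atTop 0] with τ hτ
  rw [G.mul_sq_logSlope hτ]
  ring

lemma hasDerivAt_slopeDeriv_mul {τ : ℝ} (hτ : 0 < τ) :
    HasDerivAt (fun τ => b τ * u τ ^ 2) (-2 * (τ + ξ) * u τ ^ 2) τ := by
  refine ((G.hasDerivAt_slopeDeriv hτ).mul (G.hasDerivAt_sq hτ)).congr_deriv ?_
  simp only [slopeDeriv₂]
  ring

lemma slopeDeriv_nonneg {τ : ℝ} (hτ : 0 ≤ τ) : 0 ≤ b τ := by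
  have hc : ContinuousOn (fun τ => b τ * u τ ^ 2) (Ici 0) :=
    G.continuousOn_slopeDeriv.mul G.continuousOn_sq
  have hpos := pow_pos (G.pos τ hτ) 2
  suffices h : 0 ≤ b τ * u τ ^ 2 from nonneg_of_mul_nonneg_left h hpos
  rcases le_total (-ξ) τ with h1 | h1
  · have hneg := G.neg
    refine nonneg_of_deriv_nonpos_of_tendsto (a := -ξ) (f := fun τ => b τ * u τ ^ 2)
      (hc.mono (Ici_subset_Ici.2 (by linarith)))
      (fun x hx => G.hasDerivAt_slopeDeriv_mul (by linarith)) (fun x hx => ?_)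
      (by simpa using G.tendsto_slopeDeriv 0) h1
    have : 0 ≤ x + ξ := by linarith
    nlinarith [mul_nonneg this (sq_nonneg (u x))]
  · have hm : MonotoneOn (fun τ => b τ * u τ ^ 2) (Icc 0 (-ξ)) := by
      apply monotoneOn_of_deriv_nonneg (convex_Icc _ _) (hc.mono Icc_subset_Ici_self)
      · intro y hy
        rw [interior_Icc] at hy
        exact (G.hasDerivAt_slopeDeriv_mul hy.1).differentiableAt.differentiableWithinAt
      · intro y hy
        rw [interior_Icc] at hy
        rw [(G.hasDerivAt_slopeDeriv_mul hy.1).deriv]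
        have : 0 ≤ -(y + ξ) := by linarith [hy.2]
        nlinarith [mul_nonneg this (sq_nonneg (u y))]
    have := hm ⟨le_rfl, by linarith [G.neg]⟩ ⟨hτ, h1⟩ hτ
    simpa [G.slopeDeriv_zero] using this

lemma logSlope_nonneg {τ : ℝ} (hτ : 0 ≤ τ) : 0 ≤ g τ := by
  have hm : MonotoneOn g (Ici 0) := by
    apply monotoneOn_of_deriv_nonneg (convex_Ici _) G.continuousOn_logSlope
    · intro y hy
      rw [interior_Ici] at hy
      exact (G.hasDerivAt_logSlope hy).differentiableAt.differentiableWithinAt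
    · intro y hy
      rw [interior_Ici] at hy
      rw [(G.hasDerivAt_logSlope hy).deriv]
      exact G.slopeDeriv_nonneg (le_of_lt hy)
  simpa [G.logSlope_zero] using hm (show (0:ℝ) ∈ Ici 0 from self_mem_Ici) (show τ ∈ Ici 0 from hτ) hτ

lemma add_lt_logSlope {τ : ℝ} (hτ : 0 ≤ τ) : τ + ξ < g τ := by
  have hpos := pow_pos (G.pos τ hτ) 2
  suffices h : 0 < (g τ - (τ + ξ)) * u τ ^ 2 by
    have := (mul_pos_iff_of_pos_right hpos).1 h
    linarith
  refine pos_of_deriv_neg_of_tendsto (a := 0) (f := fun τ => (g τ - (τ + ξ)) * u τ ^ 2)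
    (f' := fun τ => -(u τ ^ 2 * ((g τ - (τ + ξ)) ^ 2 + (1 - Θ)))) ?_ (fun x hx => ?_)
    (fun x hx => ?_) ?_ hτ
  · exact (G.continuousOn_logSlope.sub (by fun_prop)).mul G.continuousOn_sq
  · refine (((G.hasDerivAt_logSlope hx).sub ((hasDerivAt_id x).add_const ξ)).mul
      (G.hasDerivAt_sq hx)).congr_deriv ?_
    simp only [slopeDeriv, Pi.sub_apply, id]
    ring
  · have h1 := pow_pos (G.pos x (le_of_lt hx)) 2
    have h2 : 0 < (g x - (x + ξ)) ^ 2 + (1 - Θ) := by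
      have := G.lt_one
      nlinarith [sq_nonneg (g x - (x + ξ))]
    have := mul_pos h1 h2
    linarith
  · have h := (G.tendsto_logSlope 0).sub (G.tendsto_moments 1).1
    simp only [sub_zero] at h
    refine h.congr fun τ => ?_
    ring

lemma slopeDeriv_lt_one {τ : ℝ} (hτ : 0 ≤ τ) : b τ < 1 := by
  have hpos := pow_pos (G.pos τ hτ) 2
  suffices h : 0 < u τ ^ 2 - b τ * u τ ^ 2 by
    have : 0 < (1 - b τ) * u τ ^ 2 := by linarith
    have := (mul_pos_iff_of_pos_right hpos).1 this
    linarith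
  refine pos_of_deriv_neg_of_tendsto (a := 0) (f := fun τ => u τ ^ 2 - b τ * u τ ^ 2)
    (f' := fun τ => -(2 * (g τ - (τ + ξ)) * u τ ^ 2)) ?_ (fun x hx => ?_)
    (fun x hx => ?_) ?_ hτ
  · exact G.continuousOn_sq.sub (G.continuousOn_slopeDeriv.mul G.continuousOn_sq)
  · refine ((G.hasDerivAt_sq hx).sub (G.hasDerivAt_slopeDeriv_mul hx)).congr_deriv ?_
    ring
  · have h1 := pow_pos (G.pos x (le_of_lt hx)) 2
    have h2 := G.add_lt_logSlope (le_of_lt hx)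
    have := mul_pos (by linarith : 0 < g x - (x + ξ)) h1
    linarith
  · simpa using (G.tendsto_moments 0).1.sub (G.tendsto_slopeDeriv 0)

lemma one_sub_sq_pos {τ : ℝ} (hτ : 0 ≤ τ) : 0 < 1 - b τ ^ 2 := by
  have h1 := G.slopeDeriv_lt_one hτ
  have h2 := G.slopeDeriv_nonneg hτ
  nlinarith

lemma tendsto_slopeDeriv₂ (k : ℕ) :
    Tendsto (fun τ => (τ + ξ) ^ k * (v τ * u τ ^ 2)) atTop (𝓝 0) := by
  have h1 : Tendsto (fun τ => (τ + ξ) ^ k * (g τ * b τ * u τ ^ 2)) atTop (𝓝 0) := by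
    have hl := (G.tendsto_logSlope k).abs
    rw [abs_zero] at hl
    refine squeeze_zero_norm' ?_ hl
    filter_upwards [eventually_ge_atTop 0] with τ hτ
    have h2 := G.slopeDeriv_lt_one hτ
    have h3 := G.slopeDeriv_nonneg hτ
    rw [Real.norm_eq_abs, show (τ + ξ) ^ k * (g τ * b τ * u τ ^ 2)
      = ((τ + ξ) ^ k * (g τ * u τ ^ 2)) * b τ by ring, abs_mul _ (b τ), abs_of_nonneg h3]
    exact mul_le_of_le_one_right (abs_nonneg _) h2.le
  have h := (h1.sub (G.tendsto_moments (k + 1)).1).const_mul 2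
  simp only [sub_zero, mul_zero] at h
  refine h.congr fun τ => ?_
  simp only [slopeDeriv₂]
  ring

lemma tendsto_one_sub_sq : Tendsto (fun τ => (1 - b τ ^ 2) * u τ ^ 2) atTop (𝓝 0) := by
  refine squeeze_zero' ?_ ?_ (by simpa using (G.tendsto_moments 0).1)
  · filter_upwards [eventually_ge_atTop 0] with τ hτ
    exact mul_nonneg (G.one_sub_sq_pos hτ).le (sq_nonneg _)
  · filter_upwards with τ
    nlinarith [mul_nonneg (sq_nonneg (b τ)) (sq_nonneg (u τ))]

lemma slopeDeriv₂_pos {τ : ℝ} (hτ : 0 ≤ τ) : 0 < v τ := by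
  have hpos := pow_pos (G.pos τ hτ) 2
  suffices h : 0 < v τ * u τ ^ 2 from (mul_pos_iff_of_pos_right hpos).1 h
  refine pos_of_deriv_neg_of_tendsto (a := 0) (f := fun τ => v τ * u τ ^ 2)
    (f' := fun τ => -(2 * (1 - b τ ^ 2) * u τ ^ 2)) ?_ (fun x hx => ?_)
    (fun x hx => ?_) ?_ hτ
  · exact G.continuousOn_slopeDeriv₂.mul G.continuousOn_sq
  · refine ((G.hasDerivAt_slopeDeriv₂ hx).mul (G.hasDerivAt_sq hx)).congr_deriv ?_
    ring
  · have h1 := pow_pos (G.pos x (le_of_lt hx)) 2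
    have := mul_pos (G.one_sub_sq_pos (le_of_lt hx)) h1
    linarith
  · simpa using G.tendsto_slopeDeriv₂ 0

lemma mul_slopeDeriv₂_le {τ : ℝ} (hτ : -ξ ≤ τ) : (τ + ξ) * v τ ≤ 1 - b τ ^ 2 := by
  have hneg := G.neg
  have hpos := pow_pos (G.pos τ (by linarith)) 2
  suffices h : 0 ≤ (1 - b τ ^ 2) * u τ ^ 2 - (τ + ξ) * (v τ * u τ ^ 2) by
    have : 0 ≤ ((1 - b τ ^ 2) - (τ + ξ) * v τ) * u τ ^ 2 := by linarith
    have := nonneg_of_mul_nonneg_left this hpos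
    linarith
  refine nonneg_of_deriv_nonpos_of_tendsto (a := -ξ)
    (f := fun τ => (1 - b τ ^ 2) * u τ ^ 2 - (τ + ξ) * (v τ * u τ ^ 2))
    (f' := fun τ => -((2 * b τ + 1) * v τ * u τ ^ 2
      + 2 * (g τ - (τ + ξ)) * (1 - b τ ^ 2) * u τ ^ 2)) ?_ (fun x hx => ?_)
    (fun x hx => ?_) ?_ hτ
  · exact (((continuousOn_const.sub (G.continuousOn_slopeDeriv.pow 2)).mul
      G.continuousOn_sq).sub ((by fun_prop : ContinuousOn (fun τ : ℝ => τ + ξ) (Ici 0)).mul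
      (G.continuousOn_slopeDeriv₂.mul G.continuousOn_sq))).mono (Ici_subset_Ici.2 (by linarith))
  · have hx' : 0 < x := by linarith
    refine (((((G.hasDerivAt_slopeDeriv hx').pow 2).const_sub 1).mul (G.hasDerivAt_sq hx')).sub
      (((hasDerivAt_id x).add_const ξ).mul
        ((G.hasDerivAt_slopeDeriv₂ hx').mul (G.hasDerivAt_sq hx')))).congr_deriv ?_
    simp only [id, Pi.pow_apply, Pi.mul_apply]
    push_cast
    ring
  · have hx' : 0 ≤ x := by linarith
    have h1 := pow_pos (G.pos x hx') 2
    have h2 := G.add_lt_logSlope hx'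
    have h3 := G.slopeDeriv₂_pos hx'
    have h4 := G.slopeDeriv_nonneg hx'
    have h5 := mul_pos (mul_pos (by linarith : 0 < 2 * b x + 1) h3) h1
    have h6 := mul_pos (mul_pos (by linarith : 0 < 2 * (g x - (x + ξ))) (G.one_sub_sq_pos hx')) h1
    linarith
  · simpa using G.tendsto_one_sub_sq.sub (G.tendsto_slopeDeriv₂ 1)

lemma lt_slopeDeriv {τ : ℝ} (hτ : -ξ ≤ τ) : Θ < b τ := by
  have := G.add_lt_logSlope (τ := τ) (by linarith [G.neg])
  simp only [slopeDeriv]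
  nlinarith

lemma tendsto_field₀ : Tendsto (fun τ => h₀ τ * u τ ^ 2) atTop (𝓝 0) := by
  have h := (G.tendsto_logSlope 0).sub (G.tendsto_slopeDeriv 1)
  simp only [sub_zero] at h
  refine h.congr fun τ => ?_
  simp only [field₀]
  ring

lemma hasDerivAt_field₀_mul {τ : ℝ} (hτ : 0 < τ) :
    HasDerivAt (fun τ => h₀ τ * u τ ^ 2) (-(2 * (b τ - Θ) * u τ ^ 2)) τ := by
  refine ((G.hasDerivAt_field₀ hτ).mul (G.hasDerivAt_sq hτ)).congr_deriv ?_
  simp only [field₀, slopeDeriv₂, slopeDeriv]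
  ring

lemma field₀_nonneg {τ : ℝ} (hτ : 0 ≤ τ) : 0 ≤ h₀ τ := by
  rcases le_total (-ξ) τ with h1 | h1
  · have hpos := pow_pos (G.pos τ hτ) 2
    have hneg := G.neg
    suffices h : 0 ≤ h₀ τ * u τ ^ 2 from nonneg_of_mul_nonneg_left h hpos
    refine nonneg_of_deriv_nonpos_of_tendsto (a := -ξ) (f := fun τ => h₀ τ * u τ ^ 2)
      ((G.continuousOn_field₀.mul G.continuousOn_sq).mono (Ici_subset_Ici.2 (by linarith)))
      (fun x hx => G.hasDerivAt_field₀_mul (by linarith)) (fun x hx => ?_) G.tendsto_field₀ h1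
    have := G.lt_slopeDeriv (le_of_lt hx)
    nlinarith [mul_nonneg (by linarith : 0 ≤ b x - Θ) (sq_nonneg (u x))]
  · have h2 := G.logSlope_nonneg hτ
    have h3 := G.slopeDeriv_nonneg hτ
    simp only [field₀]
    nlinarith [mul_nonneg h3 (by linarith : 0 ≤ -(τ + ξ))]

lemma exists_field₀_le : ∃ M > 0, ∀ τ, 0 ≤ τ → h₀ τ ≤ M := by
  obtain ⟨M, hM⟩ := (isCompact_Icc : IsCompact (Icc (0 : ℝ) (1 - ξ))).bddAbove_image
    (G.continuousOn_field₀.mono Icc_subset_Ici_self)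
  refine ⟨max M 1, by positivity, fun τ hτ => ?_⟩
  rcases le_total τ (1 - ξ) with h | h
  · exact (hM ⟨τ, ⟨hτ, h⟩, rfl⟩).trans (le_max_left _ _)
  · refine le_trans ?_ (le_max_right _ _)
    have hneg := G.neg
    have hpos := pow_pos (G.pos τ hτ) 2
    suffices h : 0 ≤ u τ ^ 2 - h₀ τ * u τ ^ 2 by
      have : 0 ≤ (1 - h₀ τ) * u τ ^ 2 := by linarith
      have := nonneg_of_mul_nonneg_left this hpos
      linarith
    refine nonneg_of_deriv_nonpos_of_tendsto (a := 1 - ξ)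
      (f := fun τ => u τ ^ 2 - h₀ τ * u τ ^ 2)
      ((G.continuousOn_sq.sub (G.continuousOn_field₀.mul G.continuousOn_sq)).mono
        (Ici_subset_Ici.2 (by linarith)))
      (fun x hx => (G.hasDerivAt_sq (by linarith)).sub (G.hasDerivAt_field₀_mul (by linarith)))
      (fun x hx => ?_) (by simpa using (G.tendsto_moments 0).1.sub G.tendsto_field₀) h
    have hx' : 1 - ξ < x := hx
    have h1 := G.add_lt_logSlope (τ := x) (by linarith)
    have h2 := G.slopeDeriv_lt_one (τ := x) (by linarith)
    have h3 := G.half_lt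
    nlinarith [mul_nonneg (by linarith : 0 ≤ g x - (b x - Θ)) (sq_nonneg (u x))]

lemma tendsto_field₁ : Tendsto (fun τ => h₁ τ * u τ ^ 2) atTop (𝓝 0) := by
  have hI : Tendsto (fun τ => 1 - ∫ s in (0 : ℝ)..τ, u s ^ 2) atTop (𝓝 0) := by
    have h := (intervalIntegral_tendsto_integral_Ioi 0 G.sq_int tendsto_id).const_sub 1
    rw [G.normalized, sub_self] at h
    exact h
  have h := (((G.tendsto_moments 0).1.const_mul (-1 / 3)).add
    ((((G.tendsto_logSlope 1).sub (G.tendsto_slopeDeriv 2)).add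
      ((G.tendsto_slopeDeriv 0).const_mul Θ)).div_const 3)).add (hI.const_mul (u 0 ^ 2 / 3))
  simp only [mul_zero, sub_zero, add_zero, zero_div] at h
  refine h.congr' ?_
  filter_upwards [eventually_ge_atTop 0] with τ hτ
  have hu := (G.pos τ hτ).ne'
  simp only [field₁]
  field_simp

lemma exists_abs_field₁_le : ∃ M > 0, ∀ τ, 0 ≤ τ → |h₁ τ| ≤ M := by
  obtain ⟨M, hM⟩ := (isCompact_Icc : IsCompact (Icc (0 : ℝ) (1 - ξ))).exists_bound_of_continuousOn
    (G.continuousOn_field₁.mono Icc_subset_Ici_self)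
  obtain ⟨N, hN, hN'⟩ := G.exists_field₀_le
  set c := u 0 ^ 2 / 3 with hc
  have hc0 : 0 ≤ c := by positivity
  refine ⟨max M (N + c), lt_max_of_lt_right (by linarith), fun τ hτ => ?_⟩
  rcases le_total τ (1 - ξ) with h | h
  · exact (hM τ ⟨hτ, h⟩).trans (le_max_left _ _)
  · refine le_trans ?_ (le_max_right _ _)
    have hneg := G.neg
    have hpos := pow_pos (G.pos τ hτ) 2
    have hd : ∀ x > 1 - ξ, HasDerivAt (fun τ => h₁ τ * u τ ^ 2) ((h₀ x - c) * u x ^ 2) x := by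
      intro x hx
      have hx' : 0 < x := by linarith
      refine ((G.hasDerivAt_field₁ hx').mul (G.hasDerivAt_sq hx')).congr_deriv ?_
      ring
    have hcont := (G.continuousOn_field₁.mul G.continuousOn_sq).mono
      (Ici_subset_Ici.2 (by linarith : (0:ℝ) ≤ 1 - ξ))
    have hcont' := G.continuousOn_sq.mono (Ici_subset_Ici.2 (by linarith : (0:ℝ) ≤ 1 - ξ))
    have hl : Tendsto (fun τ => (N + c) * u τ ^ 2) atTop (𝓝 0) := by
      simpa using (G.tendsto_moments 0).1.const_mul (N + c)
    have hbd : ∀ x > 1 - ξ, |h₀ x - c| ≤ (N + c) * (2 * g x) := by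
      intro x hx
      have h1 := G.add_lt_logSlope (τ := x) (by linarith)
      have h2 := G.field₀_nonneg (τ := x) (by linarith)
      have h3 := hN' x (by linarith)
      have h4 : N + c ≤ (N + c) * (2 * g x) := le_mul_of_one_le_right (by linarith) (by linarith)
      rw [abs_le]
      constructor <;> linarith
    have hup : 0 ≤ (N + c) * u τ ^ 2 - h₁ τ * u τ ^ 2 := by
      refine nonneg_of_deriv_nonpos_of_tendsto (a := 1 - ξ)
        (f := fun τ => (N + c) * u τ ^ 2 - h₁ τ * u τ ^ 2)
        ((continuousOn_const.mul hcont').sub hcont)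
        (fun x hx => ((G.hasDerivAt_sq (by linarith)).const_mul _).sub (hd x hx))
        (fun x hx => ?_) (by simpa using hl.sub G.tendsto_field₁) h
      have := neg_abs_le (h₀ x - c)
      nlinarith [hbd x hx, sq_nonneg (u x), mul_nonneg
        (by linarith [hbd x hx] : 0 ≤ (N + c) * (2 * g x) + (h₀ x - c)) (sq_nonneg (u x))]
    have hlow : 0 ≤ (N + c) * u τ ^ 2 + h₁ τ * u τ ^ 2 := by
      refine nonneg_of_deriv_nonpos_of_tendsto (a := 1 - ξ)
        (f := fun τ => (N + c) * u τ ^ 2 + h₁ τ * u τ ^ 2)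
        ((continuousOn_const.mul hcont').add hcont)
        (fun x hx => ((G.hasDerivAt_sq (by linarith)).const_mul _).add (hd x hx))
        (fun x hx => ?_) (by simpa using hl.add G.tendsto_field₁) h
      have := le_abs_self (h₀ x - c)
      nlinarith [hbd x hx, sq_nonneg (u x), mul_nonneg
        (by linarith [hbd x hx] : 0 ≤ (N + c) * (2 * g x) - (h₀ x - c)) (sq_nonneg (u x))]
    have h1 : 0 ≤ (N + c) - h₁ τ :=
      nonneg_of_mul_nonneg_left (by linarith : 0 ≤ ((N + c) - h₁ τ) * u τ ^ 2) hpos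
    have h2 : 0 ≤ (N + c) + h₁ τ :=
      nonneg_of_mul_nonneg_left (by linarith : 0 ≤ ((N + c) + h₁ τ) * u τ ^ 2) hpos
    rw [abs_le]
    constructor <;> linarith

lemma monotoneOn_slopeDeriv : MonotoneOn b (Ici 0) := by
  apply monotoneOn_of_deriv_nonneg (convex_Ici _) G.continuousOn_slopeDeriv
  · intro y hy
    rw [interior_Ici] at hy
    exact (G.hasDerivAt_slopeDeriv hy).differentiableAt.differentiableWithinAt
  · intro y hy
    rw [interior_Ici] at hy
    rw [(G.hasDerivAt_slopeDeriv hy).deriv]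
    exact (G.slopeDeriv₂_pos (le_of_lt hy)).le

lemma exists_le_one_sub_sq : ∃ c > 0, ∀ τ, 0 ≤ τ → c ≤ (1 + τ) ^ 2 * (1 - b τ ^ 2) := by
  have hneg := G.neg
  have hneg1 := G.neg_one_lt
  set τ₁ := 1 - ξ with hτ₁
  have hτ₁0 : 0 ≤ τ₁ := by linarith
  refine ⟨1 - b τ₁, by linarith [G.slopeDeriv_lt_one hτ₁0], fun τ hτ => ?_⟩
  have hb0 := G.slopeDeriv_nonneg hτ
  have hb1 := G.slopeDeriv_lt_one hτ
  have h0 : 1 - b τ ≤ 1 - b τ ^ 2 := by nlinarith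
  rcases le_total τ τ₁ with h | h
  · have h1 : b τ ≤ b τ₁ := G.monotoneOn_slopeDeriv hτ hτ₁0 h
    have h2 : 1 ≤ (1 + τ) ^ 2 := by nlinarith
    nlinarith
  · have hm : MonotoneOn (fun τ => (τ + ξ) ^ 2 * (1 - b τ)) (Ici τ₁) := by
      have hd : ∀ x ≥ τ₁, HasDerivAt (fun τ => (τ + ξ) ^ 2 * (1 - b τ))
          (2 * (x + ξ) * (1 - b x) - (x + ξ) ^ 2 * v x) x := by
        intro x hx
        refine ((((hasDerivAt_id x).add_const ξ).pow 2).mul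
          ((G.hasDerivAt_slopeDeriv (by linarith)).const_sub 1)).congr_deriv ?_
        simp only [id, Pi.pow_apply]
        push_cast
        ring
      apply monotoneOn_of_deriv_nonneg (convex_Ici _)
      · exact fun x hx => (hd x hx).continuousAt.continuousWithinAt
      · intro y hy
        rw [interior_Ici] at hy
        exact (hd y (le_of_lt hy)).differentiableAt.differentiableWithinAt
      · intro y hy
        rw [interior_Ici] at hy
        have hy' : τ₁ < y := hy
        rw [(hd y hy'.le).deriv]
        have h1 := G.mul_slopeDeriv₂_le (τ := y) (by linarith)
        have h2 := G.slopeDeriv_lt_one (τ := y) (by linarith)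
        have h3 := G.slopeDeriv_nonneg (τ := y) (by linarith)
        have h4 : 0 ≤ 2 * (1 - b y) - (y + ξ) * v y := by nlinarith
        have := mul_nonneg (by linarith : 0 ≤ y + ξ) h4
        nlinarith
    have h1 : (τ₁ + ξ) ^ 2 * (1 - b τ₁) ≤ (τ + ξ) ^ 2 * (1 - b τ) := hm self_mem_Ici h h
    have h2 : (τ₁ + ξ) ^ 2 = 1 := by rw [hτ₁]; ring
    rw [h2, one_mul] at h1
    have h3 : (τ + ξ) ^ 2 ≤ (1 + τ) ^ 2 := by apply pow_le_pow_left₀ <;> linarith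
    calc 1 - b τ₁ ≤ (τ + ξ) ^ 2 * (1 - b τ) := h1
      _ ≤ (1 + τ) ^ 2 * (1 - b τ ^ 2) := by
        apply mul_le_mul h3 h0 (by linarith) (by positivity)

lemma exists_interior_gap : ∃ c > 0, ∃ R > 0, ∀ τ ≥ R,
    Θ + c ≤ b τ - v τ ^ 2 / (4 * (1 - b τ ^ 2)) := by
  have hneg := G.neg
  have hneg1 := G.neg_one_lt
  set τ₁ := 1 - ξ with hτ₁
  have hgap := G.lt_slopeDeriv (τ := τ₁) (by linarith)
  have hlt := G.slopeDeriv_lt_one (τ := τ₁) (by linarith)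
  set c := (b τ₁ - Θ) / 2 with hc
  have hcpos : 0 < c := by linarith
  have hc1 : c < 1 := by linarith [G.half_lt]
  have hinv : 1 < c⁻¹ := (one_lt_inv₀ hcpos).2 hc1
  refine ⟨c, hcpos, c⁻¹ - ξ, by linarith, fun τ hτ => ?_⟩
  have h1 : b τ₁ ≤ b τ := G.monotoneOn_slopeDeriv (show (0:ℝ) ≤ τ₁ by linarith)
    (show (0:ℝ) ≤ τ by linarith) (by linarith)
  have h2 := G.mul_slopeDeriv₂_le (τ := τ) (by linarith)
  have h3 := G.one_sub_sq_pos (τ := τ) (by linarith)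
  have h4 := G.slopeDeriv₂_pos (τ := τ) (by linarith)
  have hT : c⁻¹ ≤ τ + ξ := by linarith
  have h5 : v τ ≤ c * (1 - b τ ^ 2) := by
    have : c⁻¹ * v τ ≤ 1 - b τ ^ 2 := (mul_le_mul_of_nonneg_right hT h4.le).trans h2
    rwa [inv_mul_le_iff₀ hcpos] at this
  have h6 : v τ ^ 2 / (4 * (1 - b τ ^ 2)) ≤ c := by
    rw [div_le_iff₀ (by linarith)]
    have h7 : v τ ^ 2 ≤ (c * (1 - b τ ^ 2)) ^ 2 := pow_le_pow_left₀ h4.le h5 2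
    have h8 : 1 - b τ ^ 2 ≤ 1 := by nlinarith [sq_nonneg (b τ)]
    nlinarith [mul_nonneg hcpos.le h3.le, mul_le_mul h8 hc1.le hcpos.le zero_le_one,
      mul_nonneg (mul_nonneg hcpos.le h3.le) (by nlinarith : 0 ≤ 1 - c * (1 - b τ ^ 2))]
  linarith

lemma exists_interior_lower_bound : ∃ M > 0, ∀ τ, 0 ≤ τ →
    -M ≤ b τ - v τ ^ 2 / (4 * (1 - b τ ^ 2)) := by
  obtain ⟨c, hc, R, hR, h⟩ := G.exists_interior_gap
  have hcont : ContinuousOn (fun τ => b τ - v τ ^ 2 / (4 * (1 - b τ ^ 2))) (Icc 0 R) := by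
    refine ContinuousOn.mono (s := Ici 0) ?_ Icc_subset_Ici_self
    refine G.continuousOn_slopeDeriv.sub ((G.continuousOn_slopeDeriv₂.pow 2).div
      (continuousOn_const.mul (continuousOn_const.sub (G.continuousOn_slopeDeriv.pow 2))) ?_)
    intro x hx
    have := G.one_sub_sq_pos hx
    positivity
  obtain ⟨M, hM⟩ := isCompact_Icc.exists_bound_of_continuousOn hcont
  refine ⟨max M 1, by positivity, fun τ hτ => ?_⟩
  rcases le_total τ R with h1 | h1
  · have := neg_le_of_abs_le (hM τ ⟨hτ, h1⟩)
    linarith [le_max_left M 1]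
  · have := h τ h1
    linarith [le_max_right M 1, G.half_lt]

lemma energy_identity {τ : ℝ} (hτ : 0 ≤ τ) (δ : ℝ) :
    -v τ * (τ + ξ) + δ * (2 * g τ * h₁ τ + h₀ τ - u 0 ^ 2 / 3) - δ * h₀ τ + b τ
      - (h₀ τ + δ * h₁ τ) ^ 2
      - (2 * b τ * (h₀ τ + δ * h₁ τ) - v τ) ^ 2 / (4 * (1 - b τ ^ 2))
    = Θ - δ * (u 0 ^ 2 / 3) - δ ^ 2 * h₁ τ ^ 2 / (1 - b τ ^ 2) := by
  have h1 := (G.one_sub_sq_pos hτ).ne'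
  have h2 : 2 * b τ * (h₀ τ + δ * h₁ τ) - v τ
      = 2 * (τ + ξ) * (1 - b τ ^ 2) + 2 * b τ * δ * h₁ τ := by
    simp only [field₀, slopeDeriv₂]
    ring
  have h3 : (2 * b τ * (h₀ τ + δ * h₁ τ) - v τ) ^ 2 / (4 * (1 - b τ ^ 2))
      = (τ + ξ) ^ 2 * (1 - b τ ^ 2) + 2 * (τ + ξ) * b τ * δ * h₁ τ
        + (δ ^ 2 * h₁ τ ^ 2 / (1 - b τ ^ 2) - δ ^ 2 * h₁ τ ^ 2) := by
    rw [h2]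
    field_simp
    ring
  rw [h3]
  have h4 : g τ ^ 2 = b τ - Θ + (τ + ξ) ^ 2 := by simp only [slopeDeriv]; ring
  simp only [field₀, slopeDeriv₂]
  linear_combination -h4

lemma le_profileEnergy {τ : ℝ} (hτ : 0 ≤ τ) {μ : ℝ} (hμ0 : 0 ≤ μ) (hμ1 : μ ≤ 1)
    (δ m k β : ℝ) :
    Θ - δ * (u 0 ^ 2 / 3)
      + (1 - μ) * (b τ - v τ ^ 2 / (4 * (1 - b τ ^ 2)) - (Θ - δ * (u 0 ^ 2 / 3)))
      + m * (h₀ τ + δ * h₁ τ) + μ * (δ * h₀ τ - k * (h₀ τ + δ * h₁ τ))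
      + b τ * (β - 1) - δ ^ 2 * h₁ τ ^ 2 / (1 - b τ ^ 2)
    ≤ profileEnergy k β (μ * (h₀ τ + δ * h₁ τ))
        (μ * (-v τ * (τ + ξ) + δ * (2 * g τ * h₁ τ + h₀ τ - u 0 ^ 2 / 3))
          + m * (h₀ τ + δ * h₁ τ)) (b τ) (v τ) := by
  have h1 := G.one_sub_sq_pos hτ
  have h2 := G.energy_identity hτ δ
  have h3 := quadratic_concave (x := b τ) (w := v τ) (H := h₀ τ + δ * h₁ τ) hμ0 hμ1
    (by linarith : 0 < 4 * (1 - b τ ^ 2))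
  have h4 : 0 ≤ δ ^ 2 * h₁ τ ^ 2 / (1 - b τ ^ 2) := by positivity
  have h5 := mul_nonneg (sub_nonneg.2 hμ1) h4
  have h6 : -v τ ^ 2 / (4 * (1 - b τ ^ 2)) = -(v τ ^ 2 / (4 * (1 - b τ ^ 2))) := neg_div _ _
  rw [h6] at h3
  unfold profileEnergy
  have h7 := congrArg (fun x => μ * x) h2
  generalize (2 * b τ * (μ * (h₀ τ + δ * h₁ τ)) - v τ) ^ 2 / (4 * (1 - b τ ^ 2)) = A at *
  generalize (2 * b τ * (h₀ τ + δ * h₁ τ) - v τ) ^ 2 / (4 * (1 - b τ ^ 2)) = A' at *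
  generalize v τ ^ 2 / (4 * (1 - b τ ^ 2)) = A'' at *
  generalize δ ^ 2 * h₁ τ ^ 2 / (1 - b τ ^ 2) = A''' at *
  linarith

set_option maxHeartbeats 1000000 in
/-- The truncated fields give the model energy up to `O(r³)`, where the length scale is `r²`. -/
lemma exists_profile_energy (K : ℝ) (hK : 1 ≤ K) (t : ℝ) (ht : 0 < t) :
    ∃ C > 0, ∃ r₀ > 0, ∃ a > 0, ∃ M > 0, ∀ r, 0 < r → r < r₀ →
      (∀ τ, t / r ^ 2 ≤ τ → 1 < M * r ^ 3 * (a + τ) ^ 2) ∧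
      ∀ τ, 0 ≤ τ → ∀ q k κ β e : ℝ, |k| ≤ K →
      e = M * r ^ 3 * (a + τ) ^ 2 →
      (τ ≤ t / r ^ 2 → κ ≤ k + K * r ^ 2 * τ ∧ |κ| ≤ K ∧ |β - 1| ≤ K * r ^ 3 * τ) →
      |β - 1| ≤ K * r → q ∈ Icc (0 : ℝ) 1 → (τ ≤ t / r ^ 2 → q = 1) →
      Θ - r ^ 2 * k * (u 0 ^ 2 / 3) - C * r ^ 3 ≤
        profileEnergy (r ^ 2 * κ) β (max 0 (1 - e) ^ 2 * (h₀ τ + r ^ 2 * k * h₁ τ))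
          (max 0 (1 - e) ^ 2 * (-v τ * (τ + ξ)
            + r ^ 2 * k * (2 * g τ * h₁ τ + h₀ τ - u 0 ^ 2 / 3))
            + -2 * max 0 (1 - e) * (2 * M * r ^ 3 * (a + τ)) * (h₀ τ + r ^ 2 * k * h₁ τ))
          (b (plateau (t / r ^ 2) τ)) (v (plateau (t / r ^ 2) τ) * q) := by
  obtain ⟨M₀, hM₀, hh₀⟩ := G.exists_field₀_le
  obtain ⟨M₁, hM₁, hh₁⟩ := G.exists_abs_field₁_le
  obtain ⟨c₁, hc₁, hb₁⟩ := G.exists_le_one_sub_sq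
  obtain ⟨c₂, hc₂, R₀, hR₀, hgap⟩ := G.exists_interior_gap
  obtain ⟨M₂, hM₂, hlow⟩ := G.exists_interior_lower_bound
  have hΘ := G.lt_one
  have hΘ' := G.half_lt
  set C1 := u 0 ^ 2 / 3 with hC1
  have hC10 : 0 ≤ C1 := by positivity
  set S := M₀ + K * M₁ with hS
  have hS0 : 0 < S := by positivity
  set Ca := K * M₀ + K ^ 2 * M₁ + K + K ^ 2 * M₁ ^ 2 / c₁ with hCa
  have hCa0 : 0 < Ca := by positivity
  set a := 1 + 16 * S / c₂ with ha
  have ha1 : 1 ≤ a := by rw [ha]; linarith [show 0 < 16 * S / c₂ by positivity]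
  have ha0 : 0 < a := by linarith
  have haS : 4 * S ≤ a * (c₂ / 4) := by
    rw [ha]
    have : 16 * S / c₂ * (c₂ / 4) = 4 * S := by field_simp; norm_num
    linarith
  set M := 4 * Ca / c₂ with hM
  have hM0 : 0 < M := by positivity
  have hMc : M * (c₂ / 4) = Ca := by rw [hM]; field_simp
  set C := M * (a + R₀) ^ 2 * (2 * (M₂ + 1 + K * C1) + 4 * S) + Ca * (1 + R₀) ^ 2 with hC
  have hCpos : 0 < C := by positivity
  -- smallness of `r`
  have hev : ∀ᶠ r in 𝓝[>] (0 : ℝ), r < 1 ∧ r < M * t ^ 2 ∧ M * r ^ 3 * (a + R₀) ^ 2 < 1 ∧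
      r ^ 2 * (K * C1) ≤ c₂ / 2 ∧ K * r ≤ c₂ / 2 ∧ R₀ * r ^ 2 ≤ t := by
    have e1 : ∀ᶠ r in 𝓝 (0 : ℝ), r < 1 := Iio_mem_nhds one_pos
    have e2 : ∀ᶠ r in 𝓝 (0 : ℝ), r < M * t ^ 2 := Iio_mem_nhds (by positivity)
    have e3 : ∀ᶠ r in 𝓝 (0 : ℝ), M * r ^ 3 * (a + R₀) ^ 2 < 1 :=
      (by fun_prop : Continuous fun r : ℝ => M * r ^ 3 * (a + R₀) ^ 2).continuousAt.eventually_lt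
        continuousAt_const (by norm_num)
    have e4 : ∀ᶠ r in 𝓝 (0 : ℝ), r ^ 2 * (K * C1) < c₂ / 2 :=
      (by fun_prop : Continuous fun r : ℝ => r ^ 2 * (K * C1)).continuousAt.eventually_lt
        continuousAt_const (by simpa using hc₂)
    have e5 : ∀ᶠ r in 𝓝 (0 : ℝ), K * r < c₂ / 2 :=
      (by fun_prop : Continuous fun r : ℝ => K * r).continuousAt.eventually_lt
        continuousAt_const (by simpa using hc₂)
    have e6 : ∀ᶠ r in 𝓝 (0 : ℝ), R₀ * r ^ 2 < t :=
      (by fun_prop : Continuous fun r : ℝ => R₀ * r ^ 2).continuousAt.eventually_lt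
        continuousAt_const (by simpa using ht)
    refine Filter.Eventually.filter_mono nhdsWithin_le_nhds ?_
    filter_upwards [e1, e2, e3, e4, e5, e6] with r h1 h2 h3 h4 h5 h6
    exact ⟨h1, h2, h3, h4.le, h5.le, h6.le⟩
  obtain ⟨r₀, hr₀, hball⟩ := (nhdsGT_basis (0 : ℝ)).eventually_iff.1 hev
  refine ⟨C, hCpos, r₀, hr₀, a, by linarith, M, hM0, fun r hr hrr => ?_⟩
  obtain ⟨hr1, hr2, hr3, hr4, hr5, hr6⟩ := hball ⟨hr, hrr⟩
  have hr20 : 0 < r ^ 2 := by positivity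
  have hr30 : 0 < r ^ 3 := by positivity
  have hRt : R₀ ≤ t / r ^ 2 := by rwa [le_div_iff₀ hr20]
  have htr : 0 ≤ t / r ^ 2 := by positivity
  have hfar : ∀ τ, t / r ^ 2 ≤ τ → 1 < M * r ^ 3 * (a + τ) ^ 2 := by
    intro τ hτ
    have h1 : (t / r ^ 2) ^ 2 ≤ (a + τ) ^ 2 := pow_le_pow_left₀ htr (by linarith) 2
    have h2 : M * r ^ 3 * (t / r ^ 2) ^ 2 = M * t ^ 2 / r := by field_simp
    have h3 : 1 < M * t ^ 2 / r := by rwa [lt_div_iff₀ hr, one_mul]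
    calc (1:ℝ) < M * r ^ 3 * (t / r ^ 2) ^ 2 := by rw [h2]; exact h3
      _ ≤ M * r ^ 3 * (a + τ) ^ 2 := by gcongr
  refine ⟨hfar, fun τ hτ q k κ β e hk he hnear hβ hq hq1 => ?_⟩
  have hkδ : |r ^ 2 * k * C1| ≤ r ^ 2 * (K * C1) := by
    rw [mul_assoc, abs_mul, abs_of_pos hr20, abs_mul, abs_of_nonneg hC10]
    gcongr
  have hδC := abs_le.1 hkδ
  have he0 : 0 < e := by rw [he]; positivity
  rcases le_total 1 e with he1 | he1
  · -- far region: only the constant weight contributes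
    rw [max_eq_left (by linarith : 1 - e ≤ 0)]
    have hτR : R₀ ≤ τ := by
      by_contra! hlt
      have : M * r ^ 3 * (a + τ) ^ 2 ≤ M * r ^ 3 * (a + R₀) ^ 2 := by gcongr
      linarith
    have hρ : R₀ ≤ plateau (t / r ^ 2) τ := by
      rcases le_total τ (t / r ^ 2) with h | h
      · rwa [plateau_of_le h]
      · exact hRt.trans (le_plateau h)
    have hρ0 : 0 ≤ plateau (t / r ^ 2) τ := hR₀.le.trans hρ
    generalize plateau (t / r ^ 2) τ = ρ at *
    have h1 := hgap ρ hρ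
    have h2 := G.one_sub_sq_pos hρ0
    have h3 : (v ρ * q) ^ 2 / (4 * (1 - b ρ ^ 2)) ≤ v ρ ^ 2 / (4 * (1 - b ρ ^ 2)) := by
      rw [mul_pow]
      have : q ^ 2 ≤ 1 := pow_le_one₀ hq.1 hq.2
      gcongr
      exact mul_le_of_le_one_right (sq_nonneg _) this
    have h4 : |b ρ * (β - 1)| ≤ K * r := by
      rw [abs_mul, abs_of_nonneg (G.slopeDeriv_nonneg hρ0)]
      calc b ρ * |β - 1| ≤ 1 * |β - 1| := by
            gcongr
            exact (G.slopeDeriv_lt_one hρ0).le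
        _ ≤ K * r := by linarith
    have h5 := neg_le_of_abs_le h4
    have h6 : profileEnergy (r ^ 2 * κ) β (0 ^ 2 * (h₀ τ + r ^ 2 * k * h₁ τ))
          (0 ^ 2 * (-v τ * (τ + ξ)
            + r ^ 2 * k * (2 * g τ * h₁ τ + h₀ τ - C1))
            + -2 * 0 * (2 * M * r ^ 3 * (a + τ)) * (h₀ τ + r ^ 2 * k * h₁ τ))
          (b ρ) (v ρ * q) = b ρ + b ρ * (β - 1) - (v ρ * q) ^ 2 / (4 * (1 - b ρ ^ 2)) := by
      simp only [profileEnergy]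
      ring
    rw [h6]
    have : 0 < C * r ^ 3 := mul_pos hCpos hr30
    linarith only [this, hδC.1, h1, h3, h5, hr4, hr5]
  · -- boundary layer
    have hτt : τ ≤ t / r ^ 2 := by
      by_contra! h
      have := hfar τ h.le
      linarith
    obtain ⟨hκ1, hκ2, hβ'⟩ := hnear hτt
    rw [hq1 hτt, mul_one, plateau_of_le hτt, max_eq_right (by linarith : 0 ≤ 1 - e)]
    have hr21 : r ^ 2 ≤ 1 := pow_le_one₀ hr.le hr1.le
    have hr43 : r ^ 4 ≤ r ^ 3 := pow_le_pow_of_le_one hr.le hr1.le (by norm_num)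
    set μ := (1 - e) ^ 2 with hμ
    have hμ0 : 0 ≤ μ := sq_nonneg _
    have hμ1 : μ ≤ 1 := pow_le_one₀ (by linarith) (by linarith)
    set δ := r ^ 2 * k with hδ
    set m := -2 * (1 - e) * (2 * M * r ^ 3 * (a + τ)) with hm
    have hδK : |δ| ≤ r ^ 2 * K := by rw [hδ, abs_mul, abs_of_pos hr20]; gcongr
    have hH0 := G.field₀_nonneg hτ
    have hH0' := hh₀ τ hτ
    have hH1 := hh₁ τ hτ
    have hb0 := G.slopeDeriv_nonneg hτ
    have hb1 := G.slopeDeriv_lt_one hτ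
    have hbsq := G.one_sub_sq_pos hτ
    have hT1 : (1:ℝ) ≤ (1 + τ) ^ 2 := one_le_pow₀ (by linarith)
    have hTτ : τ ≤ (1 + τ) ^ 2 := by nlinarith only [hτ, sq_nonneg τ]
    refine le_trans ?_ (G.le_profileEnergy hτ hμ0 hμ1 δ m (r ^ 2 * κ) β)
    rw [← hC1]
    -- the transition of the cutoff
    have herr1 : -(4 * S * (e / a)) ≤ m * (h₀ τ + δ * h₁ τ) := by
      have h1 : |h₀ τ + δ * h₁ τ| ≤ S := by
        calc |h₀ τ + δ * h₁ τ| ≤ |h₀ τ| + |δ| * |h₁ τ| := by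
              rw [← abs_mul]; exact abs_add_le _ _
          _ ≤ M₀ + (r ^ 2 * K) * M₁ := by
              rw [abs_of_nonneg hH0]; gcongr
          _ ≤ M₀ + (1 * K) * M₁ := by gcongr
          _ = S := by rw [hS]; ring
      have h2 : |m| ≤ 4 * (e / a) := by
        have h3 : |m| = 4 * (1 - e) * (M * r ^ 3 * (a + τ)) := by
          rw [hm, show -2 * (1 - e) * (2 * M * r ^ 3 * (a + τ))
            = -(4 * (1 - e) * (M * r ^ 3 * (a + τ))) by ring, abs_neg, abs_of_nonneg]
          have := sub_nonneg.2 he1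
          positivity
        have h4 : M * r ^ 3 * (a + τ) ≤ e / a := by
          rw [le_div_iff₀ ha0, he]
          have : M * r ^ 3 * (a + τ) * a ≤ M * r ^ 3 * (a + τ) * (a + τ) := by
            gcongr
            linarith only [hτ]
          linarith only [this]
        calc |m| = 4 * (1 - e) * (M * r ^ 3 * (a + τ)) := h3
          _ ≤ 4 * 1 * (e / a) := by
            gcongr
            linarith only [he0]
          _ = 4 * (e / a) := by ring
      have h6 : |m * (h₀ τ + δ * h₁ τ)| ≤ 4 * (e / a) * S := by
        rw [abs_mul]; gcongr
      linarith only [neg_le_of_abs_le h6]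
    -- curvature
    have herr2 : -((K * M₀ + K ^ 2 * M₁) * (r ^ 3 * (1 + τ) ^ 2))
        ≤ μ * (δ * h₀ τ - r ^ 2 * κ * (h₀ τ + δ * h₁ τ)) := by
      have h1 : -(r ^ 4 * K * τ * M₀) ≤ r ^ 2 * (k - κ) * h₀ τ := by
        have h2 : 0 ≤ r ^ 2 * (k - κ + K * r ^ 2 * τ) * h₀ τ :=
          mul_nonneg (mul_nonneg hr20.le (by linarith only [hκ1])) hH0
        have h3 : r ^ 4 * K * τ * h₀ τ ≤ r ^ 4 * K * τ * M₀ := by gcongr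
        linarith only [h2, h3]
      have h4 : |r ^ 2 * κ * (δ * h₁ τ)| ≤ r ^ 4 * (K ^ 2 * M₁) := by
        calc |r ^ 2 * κ * (δ * h₁ τ)| = r ^ 2 * |κ| * (|δ| * |h₁ τ|) := by
              rw [abs_mul, abs_mul, abs_mul, abs_of_pos hr20]
          _ ≤ r ^ 2 * K * ((r ^ 2 * K) * M₁) := by gcongr
          _ = _ := by ring
      have h5 : -(r ^ 3 * ((1 + τ) ^ 2) * (K * M₀ + K ^ 2 * M₁))
          ≤ r ^ 2 * (k - κ) * h₀ τ - r ^ 2 * κ * (δ * h₁ τ) := by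
        have h6 : r ^ 4 * K * τ * M₀ ≤ r ^ 3 * K * (1 + τ) ^ 2 * M₀ := by gcongr
        have h7 : r ^ 4 * (K ^ 2 * M₁) ≤ r ^ 3 * (1 + τ) ^ 2 * (K ^ 2 * M₁) := by
          have : r ^ 4 ≤ r ^ 3 * (1 + τ) ^ 2 := hr43.trans (le_mul_of_one_le_right hr30.le hT1)
          gcongr
        linarith only [le_abs_self (r ^ 2 * κ * (δ * h₁ τ)), h1, h4, h6, h7]
      have h8 : δ * h₀ τ - r ^ 2 * κ * (h₀ τ + δ * h₁ τ)
          = r ^ 2 * (k - κ) * h₀ τ - r ^ 2 * κ * (δ * h₁ τ) := by rw [hδ]; ring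
      rw [h8]
      have h9 : 0 ≤ r ^ 3 * ((1 + τ) ^ 2) * (K * M₀ + K ^ 2 * M₁) := by positivity
      calc _ = -(r ^ 3 * ((1 + τ) ^ 2) * (K * M₀ + K ^ 2 * M₁)) := by ring
        _ ≤ μ * -(r ^ 3 * ((1 + τ) ^ 2) * (K * M₀ + K ^ 2 * M₁)) := by
          linarith only [mul_le_mul_of_nonneg_right hμ1 h9]
        _ ≤ _ := mul_le_mul_of_nonneg_left h5 hμ0
    -- magnetic field
    have herr3 : -(K * (r ^ 3 * (1 + τ) ^ 2)) ≤ b τ * (β - 1) := by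
      have h1 : |b τ * (β - 1)| ≤ K * (r ^ 3 * (1 + τ) ^ 2) := by
        rw [abs_mul, abs_of_nonneg hb0]
        calc b τ * |β - 1| ≤ 1 * (K * r ^ 3 * τ) := by gcongr
          _ ≤ 1 * (K * r ^ 3 * (1 + τ) ^ 2) := by gcongr
          _ = _ := by ring
      exact neg_le_of_abs_le h1
    -- second order term
    have herr4 : δ ^ 2 * h₁ τ ^ 2 / (1 - b τ ^ 2)
        ≤ K ^ 2 * M₁ ^ 2 / c₁ * (r ^ 3 * (1 + τ) ^ 2) := by
      have h1 := hb₁ τ hτ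
      have h2 : δ ^ 2 ≤ r ^ 3 * K ^ 2 := by
        calc δ ^ 2 = |δ| ^ 2 := (sq_abs _).symm
          _ ≤ (r ^ 2 * K) ^ 2 := by gcongr
          _ = r ^ 4 * K ^ 2 := by ring
          _ ≤ r ^ 3 * K ^ 2 := by gcongr
      have h3 : h₁ τ ^ 2 ≤ M₁ ^ 2 := by
        rw [← sq_abs]; gcongr
      rw [div_le_iff₀ hbsq]
      calc δ ^ 2 * h₁ τ ^ 2 ≤ (r ^ 3 * K ^ 2) * M₁ ^ 2 := by gcongr
        _ = K ^ 2 * M₁ ^ 2 / c₁ * r ^ 3 * c₁ := by field_simp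
        _ ≤ K ^ 2 * M₁ ^ 2 / c₁ * r ^ 3 * ((1 + τ) ^ 2 * (1 - b τ ^ 2)) := by gcongr
        _ = _ := by ring
    have hsum : Ca * (r ^ 3 * (1 + τ) ^ 2) = (K * M₀ + K ^ 2 * M₁) * (r ^ 3 * (1 + τ) ^ 2)
        + K * (r ^ 3 * (1 + τ) ^ 2) + K ^ 2 * M₁ ^ 2 / c₁ * (r ^ 3 * (1 + τ) ^ 2) := by
      rw [hCa]; ring
    have hφ : 1 - μ = 2 * e - e ^ 2 := by rw [hμ]; ring
    rcases le_total R₀ τ with hτR | hτR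
    · have h1 := hgap τ hτR
      have h2 : e * (c₂ / 2) ≤ (1 - μ)
          * (b τ - v τ ^ 2 / (4 * (1 - b τ ^ 2)) - (Θ - δ * C1)) := by
        refine mul_le_mul ?_ (by linarith only [h1, hδC.1, hr4]) (by linarith only [hc₂]) ?_
        · nlinarith only [hφ, he1, he0]
        · linarith only [hμ1]
      have h3 : 4 * S * (e / a) ≤ e * (c₂ / 4) := by
        rw [mul_div_assoc', div_le_iff₀ ha0]
        linarith only [mul_le_mul_of_nonneg_left haS he0.le]
      have h4 : Ca * (r ^ 3 * (1 + τ) ^ 2) ≤ e * (c₂ / 4) := by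
        rw [he, ← hMc]
        have : (1 + τ) ^ 2 ≤ (a + τ) ^ 2 := by gcongr
        calc M * (c₂ / 4) * (r ^ 3 * (1 + τ) ^ 2) ≤ M * (c₂ / 4) * (r ^ 3 * (a + τ) ^ 2) := by
              gcongr
          _ = _ := by ring
      have : 0 < C * r ^ 3 := mul_pos hCpos hr30
      linarith only [this, h2, h3, h4, hsum, herr1, herr2, herr3, herr4]
    · have h1 := hlow τ hτ
      have he2 : e ≤ M * r ^ 3 * (a + R₀) ^ 2 := by rw [he]; gcongr
      have h2 : -(2 * e * (M₂ + 1 + K * C1)) ≤ (1 - μ)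
          * (b τ - v τ ^ 2 / (4 * (1 - b τ ^ 2)) - (Θ - δ * C1)) := by
        have h3 : -(M₂ + 1 + K * C1)
            ≤ b τ - v τ ^ 2 / (4 * (1 - b τ ^ 2)) - (Θ - δ * C1) := by
          have : r ^ 2 * (K * C1) ≤ 1 * (K * C1) := by gcongr
          linarith only [hδC.1, this, h1, hΘ]
        have h4 : 0 < M₂ + 1 + K * C1 := by positivity
        have h5 : 0 ≤ 1 - μ := by linarith only [hμ1]
        have h6 : 1 - μ ≤ 2 * e := by linarith only [hφ, sq_nonneg e]
        linarith only [mul_le_mul_of_nonneg_right h6 h4.le, mul_le_mul_of_nonneg_left h3 h5]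
      have h3 : 2 * e * (M₂ + 1 + K * C1)
          ≤ 2 * (M * r ^ 3 * (a + R₀) ^ 2) * (M₂ + 1 + K * C1) := by gcongr
      have h4 : 4 * S * (e / a) ≤ 4 * S * (M * r ^ 3 * (a + R₀) ^ 2) := by
        gcongr
        exact (div_le_self he0.le ha1).trans he2
      have h5 : Ca * (r ^ 3 * (1 + τ) ^ 2) ≤ Ca * (r ^ 3 * (1 + R₀) ^ 2) := by gcongr
      have h6 : C * r ^ 3 = 2 * (M * r ^ 3 * (a + R₀) ^ 2) * (M₂ + 1 + K * C1)
          + 4 * S * (M * r ^ 3 * (a + R₀) ^ 2) + Ca * (r ^ 3 * (1 + R₀) ^ 2) := by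
        rw [hC]; ring
      linarith only [h2, h3, h4, h5, h6, hsum, herr1, herr2, herr3, herr4]

end IsGroundState

lemma profileEnergy_rescale {r : ℝ} (hr : r ≠ 0) (κ β h h' b b' : ℝ) :
    profileEnergy κ (β / r ^ 4) (h / r ^ 2) (h' / r ^ 4) b (b' / r ^ 2)
      = profileEnergy (r ^ 2 * κ) β h h' b b' / r ^ 4 := by
  have h1 : (2 * b * (h / r ^ 2) - b' / r ^ 2) ^ 2 / (4 * (1 - b ^ 2))
      = (2 * b * h - b') ^ 2 / (4 * (1 - b ^ 2)) / r ^ 4 := by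
    rw [show 2 * b * (h / r ^ 2) - b' / r ^ 2 = (2 * b * h - b') / r ^ 2 by ring, div_pow,
      div_right_comm]
    ring
  simp only [profileEnergy]
  rw [h1]
  generalize (2 * b * h - b') ^ 2 / (4 * (1 - b ^ 2)) = A
  field_simp

/-- A pair of functions `h`, `b` of the distance to the boundary, with derivatives `h'`, `b'`,
vanishing at `0`, for which `h` is supported in `[0, t]` and `b` is constant beyond `2t`. -/
structure IsProfile (t : ℝ) (h h' b b' : ℝ → ℝ) : Prop where
  cont_h : ContinuousOn h (Ici 0)
  cont_h' : ContinuousOn h' (Ici 0)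
  cont_b : ContinuousOn b (Ici 0)
  cont_b' : ContinuousOn b' (Ici 0)
  deriv_h : ∀ s > 0, HasDerivAt h (h' s) s
  deriv_b : ∀ s > 0, HasDerivAt b (b' s) s
  h_zero : h 0 = 0
  b_zero : b 0 = 0
  sq_lt : ∀ s, 0 ≤ s → b s ^ 2 < 1
  h_far : ∀ s, t ≤ s → h s = 0 ∧ h' s = 0
  b_far : ∀ s, 2 * t ≤ s → b s = b (2 * t) ∧ b' s = 0

namespace IsGroundState

variable {Θ ξ : ℝ} {u p : ℝ → ℝ} (G : IsGroundState Θ ξ u p)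
include G

lemma exists_profile (K : ℝ) (hK : 1 ≤ K) (t : ℝ) (ht : 0 < t) :
    ∃ C > 0, ∃ r₀ > 0, ∀ r, 0 < r → r < r₀ → ∀ k, |k| ≤ K →
      ∃ h h' b b' : ℝ → ℝ, IsProfile t h h' b b' ∧
      ∀ s, 0 ≤ s → ∀ κ β : ℝ,
      (s ≤ t → κ ≤ k + K * s ∧ |κ| ≤ K ∧ |β - 1| ≤ K * r * s) → |β - 1| ≤ K * r →
      (Θ - r ^ 2 * k * (u 0 ^ 2 / 3) - C * r ^ 3) / r ^ 4 ≤
        profileEnergy κ (β / r ^ 4) (h s) (h' s) (b s) (b' s) := by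
  obtain ⟨C, hC, r₀, hr₀, a, ha, M, hM, key⟩ := G.exists_profile_energy K hK t ht
  refine ⟨C, hC, min r₀ (min 1 t), by positivity, fun r hr hrr k hk => ?_⟩
  have hr1 : r < 1 := hrr.trans_le ((min_le_right _ _).trans (min_le_left _ _))
  have hrt : r < t := hrr.trans_le ((min_le_right _ _).trans (min_le_right _ _))
  obtain ⟨hfar, hen⟩ := key r hr (hrr.trans_le (min_le_left _ _))
  have hr2 : 0 < r ^ 2 := by positivity
  have hr4 : 0 < r ^ 4 := by positivity
  have hr2t : r ^ 2 ≤ t := by nlinarith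
  set R := t / r ^ 2 with hR
  have hR0 : 0 ≤ R := by positivity
  set e : ℝ → ℝ := fun τ => M * r ^ 3 * (a + τ) ^ 2 with he
  have hde : ∀ τ, HasDerivAt e (2 * M * r ^ 3 * (a + τ)) τ := by
    intro τ
    refine ((((hasDerivAt_id τ).const_add a).pow 2).const_mul (M * r ^ 3)).congr_deriv ?_
    simp only [id]
    push_cast
    ring
  have hce : Continuous e := by fun_prop
  set H : ℝ → ℝ := fun τ => max 0 (1 - e τ) ^ 2 *
    (field₀ Θ ξ u p τ + r ^ 2 * k * field₁ Θ ξ u p τ) with hH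
  set H' : ℝ → ℝ := fun τ => max 0 (1 - e τ) ^ 2 * (-slopeDeriv₂ Θ ξ u p τ * (τ + ξ)
      + r ^ 2 * k * (2 * logSlope u p τ * field₁ Θ ξ u p τ + field₀ Θ ξ u p τ - u 0 ^ 2 / 3))
    + -2 * max 0 (1 - e τ) * (2 * M * r ^ 3 * (a + τ)) *
      (field₀ Θ ξ u p τ + r ^ 2 * k * field₁ Θ ξ u p τ) with hH'
  set b : ℝ → ℝ := fun τ => slopeDeriv Θ ξ u p (plateau R τ) with hb
  set b' : ℝ → ℝ := fun τ => slopeDeriv₂ Θ ξ u p (plateau R τ) * plateauDeriv R τ with hb'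
  have hdH : ∀ τ > 0, HasDerivAt H (H' τ) τ := by
    intro τ hτ
    have h1 := (hasDerivAt_max_zero_sq (1 - e τ)).comp τ ((hde τ).const_sub 1)
    refine (h1.mul ((G.hasDerivAt_field₀ hτ).add
      ((G.hasDerivAt_field₁ hτ).const_mul (r ^ 2 * k)))).congr_deriv ?_
    simp only [hH', Function.comp, Pi.add_apply]
    ring
  have hcp : Continuous (plateau R) :=
    continuous_iff_continuousAt.2 fun τ => (hasDerivAt_plateau R τ).continuousAt
  have hmp : MapsTo (plateau R) (Ici 0) (Ici 0) := fun τ hτ => plateau_nonneg hR0 hτ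
  have hdb : ∀ τ > 0, HasDerivAt b (b' τ) τ := by
    intro τ hτ
    have hpos : 0 < plateau R τ := by
      rcases le_total τ R with h | h
      · rwa [plateau_of_le h]
      · exact (by positivity : 0 < R).trans_le (le_plateau h)
    exact (G.hasDerivAt_slopeDeriv hpos).comp τ (hasDerivAt_plateau R τ)
  have hcb : ContinuousOn b (Ici 0) := G.continuousOn_slopeDeriv.comp hcp.continuousOn hmp
  have hcb' : ContinuousOn b' (Ici 0) :=
    (G.continuousOn_slopeDeriv₂.comp hcp.continuousOn hmp).mul
      (continuous_plateauDeriv R).continuousOn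
  have hcF : ContinuousOn (fun τ => field₀ Θ ξ u p τ + r ^ 2 * k * field₁ Θ ξ u p τ) (Ici 0) :=
    G.continuousOn_field₀.add (continuousOn_const.mul G.continuousOn_field₁)
  have hcm : Continuous fun τ => max 0 (1 - e τ) := by fun_prop
  have hcH : ContinuousOn H (Ici 0) := (hcm.pow 2).continuousOn.mul hcF
  have hcH' : ContinuousOn H' (Ici 0) := by
    refine ((hcm.pow 2).continuousOn.mul ((G.continuousOn_slopeDeriv₂.neg.mul
      (by fun_prop)).add (continuousOn_const.mul ((((continuousOn_const.mul
        G.continuousOn_logSlope).mul G.continuousOn_field₁).add G.continuousOn_field₀).sub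
        continuousOn_const)))).add (ContinuousOn.mul ?_ hcF)
    exact ((continuous_const.mul hcm).mul (by fun_prop)).continuousOn
  have hms : MapsTo (fun s : ℝ => s / r ^ 2) (Ici 0) (Ici 0) := fun s hs => div_nonneg hs hr2.le
  have hcs : ContinuousOn (fun s : ℝ => s / r ^ 2) (Ici 0) := by fun_prop
  have hds : ∀ s : ℝ, HasDerivAt (fun s : ℝ => s / r ^ 2) (1 / r ^ 2) s :=
    fun s => (hasDerivAt_id s).div_const _
  have hle : ∀ s, t ≤ s → R ≤ s / r ^ 2 := fun s hs => by rw [hR]; gcongr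
  have hle' : ∀ s, 2 * t ≤ s → R + 1 ≤ s / r ^ 2 := fun s hs => by
    rw [hR, div_add_one hr2.ne']
    gcongr
    linarith
  have hm0 : ∀ τ, R ≤ τ → max 0 (1 - e τ) = 0 := fun τ hτ =>
    max_eq_left (by have := hfar τ hτ; simp only [he]; linarith)
  refine ⟨fun s => H (s / r ^ 2) / r ^ 2, fun s => H' (s / r ^ 2) / r ^ 4,
    fun s => b (s / r ^ 2), fun s => b' (s / r ^ 2) / r ^ 2,
    ⟨(hcH.comp hcs hms).div_const _, (hcH'.comp hcs hms).div_const _, hcb.comp hcs hms,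
      (hcb'.comp hcs hms).div_const _, fun s hs => ?_, fun s hs => ?_, ?_, ?_, fun s hs => ?_,
      fun s hs => ?_, fun s hs => ?_⟩, ?_⟩
  · refine (((hdH _ (by positivity)).comp s (hds s)).div_const (r ^ 2)).congr_deriv ?_
    ring
  · refine ((hdb _ (by positivity)).comp s (hds s)).congr_deriv ?_
    ring
  · simp [hH, G.field₀_zero, G.field₁_zero]
  · simp [hb, plateau_of_le hR0, G.slopeDeriv_zero]
  · have := G.one_sub_sq_pos (plateau_nonneg hR0 (hms hs))
    simp only [hb]
    linarith
  · simp [hH, hH', hm0 _ (hle s hs)]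
  · simp only [hb, hb', plateau_of_ge (hle' s hs), plateau_of_ge (hle' _ le_rfl),
      plateauDeriv_of_ge (hle' s hs)]
    simp
  · intro s hs κ β hnear hβ
    rw [profileEnergy_rescale hr.ne']
    gcongr
    refine hen (s / r ^ 2) (hms hs) (plateauDeriv R (s / r ^ 2)) k κ β _ hk rfl (fun hsR => ?_) hβ
      (plateauDeriv_mem _ _) (fun h => plateauDeriv_of_le h)
    have hst : s ≤ t := by
      rwa [hR, div_le_div_iff_of_pos_right hr2] at hsR
    obtain ⟨h1, h2, h3⟩ := hnear hst
    have e1 : K * r ^ 2 * (s / r ^ 2) = K * s := by field_simp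
    have e2 : K * r ^ 3 * (s / r ^ 2) = K * r * s := by field_simp
    rw [e1, e2]
    exact ⟨h1, h2, h3⟩

end IsGroundState

/-- The first partial derivative. -/
def pd1 (f : Plane → ℝ) (p : Plane) : ℝ := fderiv ℝ f p (1, 0)

/-- The second partial derivative. -/
def pd2 (f : Plane → ℝ) (p : Plane) : ℝ := fderiv ℝ f p (0, 1)

lemma pd1_add {f g : Plane → ℝ} {p : Plane} (hf : DifferentiableAt ℝ f p)
    (hg : DifferentiableAt ℝ g p) : pd1 (fun q => f q + g q) p = pd1 f p + pd1 g p := by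
  simp [pd1, fderiv_fun_add hf hg]

lemma pd2_add {f g : Plane → ℝ} {p : Plane} (hf : DifferentiableAt ℝ f p)
    (hg : DifferentiableAt ℝ g p) : pd2 (fun q => f q + g q) p = pd2 f p + pd2 g p := by
  simp [pd2, fderiv_fun_add hf hg]

lemma pd1_mul {f g : Plane → ℝ} {p : Plane} (hf : DifferentiableAt ℝ f p)
    (hg : DifferentiableAt ℝ g p) :
    pd1 (fun q => f q * g q) p = pd1 f p * g p + f p * pd1 g p := by
  simp [pd1, fderiv_fun_mul hf hg]; ring

lemma pd2_mul {f g : Plane → ℝ} {p : Plane} (hf : DifferentiableAt ℝ f p)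
    (hg : DifferentiableAt ℝ g p) :
    pd2 (fun q => f q * g q) p = pd2 f p * g p + f p * pd2 g p := by
  simp [pd2, fderiv_fun_mul hf hg]; ring

lemma integral_fderiv_apply_eq_zero {f : Plane → ℝ} (hf : ContDiff ℝ 1 f)
    (hc : HasCompactSupport f) (v : Plane) : ∫ p, fderiv ℝ f p v = 0 := by
  have hc' : HasCompactSupport (fun p => fderiv ℝ f p v) := hc.fderiv_apply (𝕜 := ℝ) v
  have hcont : Continuous (fun p => fderiv ℝ f p v) :=
    (hf.continuous_fderiv one_ne_zero).clm_apply continuous_const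
  have := integral_mul_fderiv_eq_neg_fderiv_mul_of_integrable (μ := (volume : Measure Plane))
    (f := fun _ => (1 : ℝ)) (g := f) (v := v) (by simp)
    (by simpa using hcont.integrable_of_hasCompactSupport hc')
    (by simpa using hf.continuous.integrable_of_hasCompactSupport hc)
    (by simp) (fun x _ => hf.differentiable one_ne_zero x)
  simpa using this

lemma hasDerivAt_integral_mul_translate {φ y : Plane → ℝ} (hφ : Continuous φ)
    (hφc : HasCompactSupport φ) (hy : ContDiff ℝ 1 y) (hyc : HasCompactSupport y) (e : Plane) :
    HasDerivAt (fun t : ℝ => ∫ p, φ p * y (p + t • e)) (∫ p, φ p * fderiv ℝ y p e) 0 := by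
  have hcont : Continuous (fun p => fderiv ℝ y p e) :=
    (hy.continuous_fderiv one_ne_zero).clm_apply continuous_const
  obtain ⟨M, hM⟩ := (hyc.fderiv_apply (𝕜 := ℝ) e).exists_bound_of_continuous hcont
  have hF : ∀ t : ℝ, Integrable (fun p => φ p * y (p + t • e)) := fun t =>
    (hφ.mul (hy.continuous.comp (continuous_id.add continuous_const))).integrable_of_hasCompactSupport
      (hφc.mul_right)
  have := (hasDerivAt_integral_of_dominated_loc_of_deriv_le (μ := (volume : Measure Plane))
    (F := fun (t : ℝ) p => φ p * y (p + t • e)) (F' := fun t p => φ p * fderiv ℝ y (p + t • e) e)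
    (x₀ := 0) (s := univ) (bound := fun p => ‖φ p‖ * M) univ_mem
    (Eventually.of_forall fun t => (hF t).aestronglyMeasurable) (hF 0)
    (by simpa using (show Continuous fun p => φ p * fderiv ℝ y p e from
      hφ.mul hcont).aestronglyMeasurable (μ := volume))
    (Eventually.of_forall fun p t _ => by
      rw [norm_mul]; exact mul_le_mul_of_nonneg_left (hM _) (norm_nonneg _))
    ((hφ.norm.integrable_of_hasCompactSupport hφc.norm).mul_const M)
    (Eventually.of_forall fun p t _ => by
      have h1 : HasDerivAt (fun t : ℝ => p + t • e) e t := by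
        simpa using ((hasDerivAt_id t).smul_const e).const_add p
      have h2 := (hy.differentiable one_ne_zero (p + t • e)).hasFDerivAt
      exact (h2.comp_hasDerivAt t h1).const_mul (φ p))).2
  simpa using this

lemma integral_jacobian_eq_zero {f y : Plane → ℝ} (hf : ContDiff ℝ 1 f)
    (hfc : HasCompactSupport f) (hy : ContDiff ℝ 1 y) (hyc : HasCompactSupport y) (v e : Plane) :
    ∫ p, (fderiv ℝ f p v * fderiv ℝ y p e - fderiv ℝ f p e * fderiv ℝ y p v) = 0 := by
  have cf : ∀ w, Continuous (fun p => fderiv ℝ f p w) := fun w =>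
    (hf.continuous_fderiv one_ne_zero).clm_apply continuous_const
  have cy : ∀ w, Continuous (fun p => fderiv ℝ y p w) := fun w =>
    (hy.continuous_fderiv one_ne_zero).clm_apply continuous_const
  have sf : ∀ w, HasCompactSupport (fun p => fderiv ℝ f p w) := fun w => hfc.fderiv_apply (𝕜 := ℝ) w
  have sy : ∀ w, HasCompactSupport (fun p => fderiv ℝ y p w) := fun w => hyc.fderiv_apply (𝕜 := ℝ) w
  have hd1 := hasDerivAt_integral_mul_translate (cf v) (sf v) hy hyc e
  have hd2 := hasDerivAt_integral_mul_translate (cy v) (sy v) hf hfc (-e)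
  have heq : (fun t : ℝ => ∫ p, fderiv ℝ f p v * y (p + t • e))
      = fun t : ℝ => -∫ p, fderiv ℝ y p v * f (p + t • (-e)) := by
    funext t
    have hyt : ContDiff ℝ 1 (fun p => y (p + t • e)) := hy.comp (contDiff_id.add contDiff_const)
    have hder : ∀ p, fderiv ℝ (fun p => y (p + t • e)) p = fderiv ℝ y (p + t • e) := fun p => by
      rw [fderiv_comp_add_right]
    have ibp := integral_mul_fderiv_eq_neg_fderiv_mul_of_integrable (μ := (volume : Measure Plane))
      (f := f) (g := fun p => y (p + t • e)) (v := v)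
      (((cf v).mul hyt.continuous).integrable_of_hasCompactSupport (sf v).mul_right)
      ((hf.continuous.mul ((hyt.continuous_fderiv one_ne_zero).clm_apply
        continuous_const)).integrable_of_hasCompactSupport hfc.mul_right)
      ((hf.continuous.mul hyt.continuous).integrable_of_hasCompactSupport hfc.mul_right)
      (fun x _ => hf.differentiable one_ne_zero x) (fun x _ => hyt.differentiable one_ne_zero x)
    have tr := integral_add_right_eq_self (μ := (volume : Measure Plane))
      (fun p => fderiv ℝ y p v * f (p + t • (-e))) (t • e)
    rw [← tr]
    simp only [hder] at ibp
    rw [eq_comm, neg_eq_iff_eq_neg, ← ibp]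
    refine integral_congr_ae (Eventually.of_forall fun p => ?_)
    simp [mul_comm]
  rw [heq] at hd1
  have h := hd1.unique hd2.neg
  have i1 : Integrable (fun p => fderiv ℝ f p v * fderiv ℝ y p e) :=
    ((cf v).mul (cy e)).integrable_of_hasCompactSupport (sf v).mul_right
  have i2 : Integrable (fun p => fderiv ℝ f p e * fderiv ℝ y p v) :=
    ((cf e).mul (cy v)).integrable_of_hasCompactSupport (sf e).mul_right
  rw [integral_sub i1 i2, h]
  simp [mul_comm, integral_neg]

/-- A pointwise divergence expression, of total integral zero, built from a magnetic gradient: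
`x + iy` is the wave function, `(a₁, a₂)` the potential, `w` a scalar weight and `(X₁, X₂)` a
vector field. -/
def magDiv (a₁ a₂ x y w X₁ X₂ : Plane → ℝ) (p : Plane) : ℝ :=
  2 * w p * ((pd1 x p + a₁ p * y p) * (pd2 y p - a₂ p * x p)
      - (pd1 y p - a₁ p * x p) * (pd2 x p + a₂ p * y p))
  + (pd1 w p * (x p * (pd2 y p - a₂ p * x p) - y p * (pd2 x p + a₂ p * y p))
      - pd2 w p * (x p * (pd1 y p - a₁ p * x p) - y p * (pd1 x p + a₁ p * y p)))
  - w p * (pd1 a₂ p - pd2 a₁ p) * (x p ^ 2 + y p ^ 2)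
  + 2 * (X₁ p * (x p * (pd1 x p + a₁ p * y p) + y p * (pd1 y p - a₁ p * x p))
      + X₂ p * (x p * (pd2 x p + a₂ p * y p) + y p * (pd2 y p - a₂ p * x p)))
  + (pd1 X₁ p + pd2 X₂ p) * (x p ^ 2 + y p ^ 2)

lemma integral_magDiv_of_contDiff {a₁ a₂ x y w X₁ X₂ : Plane → ℝ}
    (ha₁ : ContDiff ℝ 1 a₁) (ha₂ : ContDiff ℝ 1 a₂) (hx : ContDiff ℝ 1 x) (hy : ContDiff ℝ 1 y)
    (hw : ContDiff ℝ 1 w) (hX₁ : ContDiff ℝ 1 X₁) (hX₂ : ContDiff ℝ 1 X₂)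
    (hxc : HasCompactSupport x) (hyc : HasCompactSupport y) (hwc : HasCompactSupport w)
    (hX₁c : HasCompactSupport X₁) (hX₂c : HasCompactSupport X₂) :
    ∫ p, magDiv a₁ a₂ x y w X₁ X₂ p = 0 := by
  have h1 : ContDiff ℝ 1 (fun p => X₁ p * (x p * x p + y p * y p) +
    (-1) * (w p * a₂ p * (x p * x p + y p * y p))) := by fun_prop
  have h2 : ContDiff ℝ 1 (fun p => X₂ p * (x p * x p + y p * y p) +
    w p * a₁ p * (x p * x p + y p * y p)) := by fun_prop
  have s1 : HasCompactSupport (fun p => X₁ p * (x p * x p + y p * y p) +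
      (-1) * (w p * a₂ p * (x p * x p + y p * y p))) :=
    hX₁c.mul_right.add (HasCompactSupport.mul_left (hwc.mul_right.mul_right))
  have s2 : HasCompactSupport (fun p => X₂ p * (x p * x p + y p * y p) +
      w p * a₁ p * (x p * x p + y p * y p)) := hX₂c.mul_right.add (hwc.mul_right.mul_right)
  have d1 := integral_fderiv_apply_eq_zero h1 s1 (1, 0)
  have d2 := integral_fderiv_apply_eq_zero h2 s2 (0, 1)
  have j1 := integral_jacobian_eq_zero (hw.mul hx) hwc.mul_right hy hyc (1, 0) (0, 1)
  have j2 := integral_jacobian_eq_zero hx hxc (hw.mul hy) hwc.mul_right (1, 0) (0, 1)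
  have cd : ∀ {f : Plane → ℝ} (v : Plane), ContDiff ℝ 1 f → Continuous (fun p => fderiv ℝ f p v) :=
    fun v hf => (hf.continuous_fderiv one_ne_zero).clm_apply continuous_const
  have sd : ∀ {f : Plane → ℝ} (v : Plane), HasCompactSupport f →
      HasCompactSupport (fun p => fderiv ℝ f p v) := fun v hf => hf.fderiv_apply (𝕜 := ℝ) v
  have id1 := (cd (1, 0) h1).integrable_of_hasCompactSupport (μ := volume) (sd _ s1)
  have id2 := (cd (0, 1) h2).integrable_of_hasCompactSupport (μ := volume) (sd _ s2)
  have ij : ∀ {f g : Plane → ℝ}, ContDiff ℝ 1 f → ContDiff ℝ 1 g → HasCompactSupport f →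
      Integrable (fun p => fderiv ℝ f p (1, 0) * fderiv ℝ g p (0, 1)
        - fderiv ℝ f p (0, 1) * fderiv ℝ g p (1, 0)) := fun hf hg sf =>
    (((cd _ hf).mul (cd _ hg)).integrable_of_hasCompactSupport (sd _ sf).mul_right).sub
      (((cd _ hf).mul (cd _ hg)).integrable_of_hasCompactSupport (sd _ sf).mul_right)
  have ij1 := ij (hw.mul hx) hy hwc.mul_right
  have ij2 := ij hx (hw.mul hy) hxc
  have key : ∫ p, magDiv a₁ a₂ x y w X₁ X₂ p
      = ∫ p, ((fderiv ℝ (fun p => X₁ p * (x p * x p + y p * y p) +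
          (-1) * (w p * a₂ p * (x p * x p + y p * y p))) p (1, 0)
        + fderiv ℝ (fun p => X₂ p * (x p * x p + y p * y p) +
          w p * a₁ p * (x p * x p + y p * y p)) p (0, 1))
        + (fderiv ℝ (w * x) p (1, 0) * fderiv ℝ y p (0, 1)
          - fderiv ℝ (w * x) p (0, 1) * fderiv ℝ y p (1, 0)))
        + (fderiv ℝ x p (1, 0) * fderiv ℝ (w * y) p (0, 1)
          - fderiv ℝ x p (0, 1) * fderiv ℝ (w * y) p (1, 0)) := by
    refine integral_congr_ae (Eventually.of_forall fun p => ?_)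
    have da₁ := ha₁.differentiable one_ne_zero p
    have da₂ := ha₂.differentiable one_ne_zero p
    have dx := hx.differentiable one_ne_zero p
    have dy := hy.differentiable one_ne_zero p
    have dw := hw.differentiable one_ne_zero p
    have dX₁ := hX₁.differentiable one_ne_zero p
    have dX₂ := hX₂.differentiable one_ne_zero p
    have e1 : pd1 (fun p => X₁ p * (x p * x p + y p * y p) +
          (-1) * (w p * a₂ p * (x p * x p + y p * y p))) p
        = pd1 X₁ p * (x p ^ 2 + y p ^ 2) + 2 * X₁ p * (x p * pd1 x p + y p * pd1 y p)
          - ((pd1 w p * a₂ p + w p * pd1 a₂ p) * (x p ^ 2 + y p ^ 2)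
            + 2 * w p * a₂ p * (x p * pd1 x p + y p * pd1 y p)) := by
      rw [pd1_add (by fun_prop) (by fun_prop), pd1_mul (by fun_prop) (by fun_prop),
        pd1_mul (by fun_prop) (by fun_prop), pd1_mul (by fun_prop) (by fun_prop),
        pd1_mul (by fun_prop) (by fun_prop), pd1_add (by fun_prop) (by fun_prop),
        pd1_mul (by fun_prop) (by fun_prop), pd1_mul (by fun_prop) (by fun_prop)]
      simp only [pd1, fderiv_fun_const, Pi.zero_apply, zero_apply]
      ring
    have e2 : pd2 (fun p => X₂ p * (x p * x p + y p * y p) +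
          w p * a₁ p * (x p * x p + y p * y p)) p
        = pd2 X₂ p * (x p ^ 2 + y p ^ 2) + 2 * X₂ p * (x p * pd2 x p + y p * pd2 y p)
          + ((pd2 w p * a₁ p + w p * pd2 a₁ p) * (x p ^ 2 + y p ^ 2)
            + 2 * w p * a₁ p * (x p * pd2 x p + y p * pd2 y p)) := by
      rw [pd2_add (by fun_prop) (by fun_prop), pd2_mul (by fun_prop) (by fun_prop),
        pd2_mul (by fun_prop) (by fun_prop), pd2_mul (by fun_prop) (by fun_prop),
        pd2_add (by fun_prop) (by fun_prop),
        pd2_mul (by fun_prop) (by fun_prop), pd2_mul (by fun_prop) (by fun_prop)]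
      ring
    have e3 : pd1 (w * x) p = _ := pd1_mul dw dx
    have e4 : pd2 (w * x) p = _ := pd2_mul dw dx
    have e5 : pd1 (w * y) p = _ := pd1_mul dw dy
    have e6 : pd2 (w * y) p = _ := pd2_mul dw dy
    change magDiv a₁ a₂ x y w X₁ X₂ p = ((pd1 _ p + pd2 _ p)
      + (pd1 (w * x) p * pd2 y p - pd2 (w * x) p * pd1 y p))
      + (pd1 x p * pd2 (w * y) p - pd2 x p * pd1 (w * y) p)
    rw [e1, e2, e3, e4, e5, e6, magDiv]
    ring
  rw [key]
  have I12 := id1.add id2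
  have I123 := I12.add ij1
  refine (integral_add I123 ij2).trans ?_
  refine (congrArg₂ (· + ·) ((integral_add I12 ij1).trans
    (congrArg₂ (· + ·) ((integral_add id1 id2).trans (congrArg₂ (· + ·) d1 d2)) j1)) j2).trans ?_
  norm_num

lemma contDiff_mul_of_tsupport_subset {Ω : Set Plane} (hΩ : IsOpen Ω) {χ f : Plane → ℝ}
    (hχ : ContDiff ℝ 1 χ) (hs : tsupport χ ⊆ Ω) (hf : ContDiffOn ℝ 1 f Ω) :
    ContDiff ℝ 1 (fun p => χ p * f p) := by
  rw [contDiff_iff_contDiffAt]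
  intro p
  by_cases hp : p ∈ Ω
  · exact hχ.contDiffAt.mul (hf.contDiffAt (hΩ.mem_nhds hp))
  · have h0 : χ =ᶠ[𝓝 p] 0 := notMem_tsupport_iff_eventuallyEq.1 fun h => hp (hs h)
    exact (contDiffAt_const (c := (0 : ℝ))).congr_of_eventuallyEq
      (h0.mono fun q hq => by simp [hq])

lemma exists_contDiff_cutoff {Ω K : Set Plane} (hΩ : IsOpen Ω) (hK : IsCompact K) (hKΩ : K ⊆ Ω) :
    ∃ χ : Plane → ℝ, ContDiff ℝ 1 χ ∧ HasCompactSupport χ ∧ tsupport χ ⊆ Ω ∧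
      ∀ p ∈ K, χ =ᶠ[𝓝 p] 1 := by
  obtain ⟨K', hK', h1, h2⟩ := exists_compact_between hK hΩ hKΩ
  obtain ⟨f, f0, f1, -⟩ := exists_contMDiffMap_zero_one_nhds_of_isClosed (n := 1)
    (modelWithCornersSelf ℝ Plane) (s := (interior K')ᶜ) (t := K) isOpen_interior.isClosed_compl
    hK.isClosed (disjoint_left.2 fun p hp hp' => hp (h1 hp'))
  have hsub : tsupport (f : Plane → ℝ) ⊆ K' := closure_minimal (fun p hp => by
    by_contra hp'
    have := f0.self_of_nhdsSet p (fun h => hp' (interior_subset h))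
    exact hp this) hK'.isClosed
  refine ⟨f, f.contMDiff.contDiff, HasCompactSupport.of_support_subset_isCompact hK'
    (subset_closure.trans hsub), hsub.trans h2, fun p hp => ?_⟩
  exact (eventually_nhdsSet_iff_forall.1 f1 p hp)

lemma pd1_congr {f g : Plane → ℝ} {p : Plane} (h : f =ᶠ[𝓝 p] g) : pd1 f p = pd1 g p := by
  simp [pd1, h.fderiv_eq]

lemma pd2_congr {f g : Plane → ℝ} {p : Plane} (h : f =ᶠ[𝓝 p] g) : pd2 f p = pd2 g p := by
  simp [pd2, h.fderiv_eq]

lemma pd1_of_notMem_tsupport {f : Plane → ℝ} {p : Plane} (h : p ∉ tsupport f) : pd1 f p = 0 := by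
  rw [pd1_congr (notMem_tsupport_iff_eventuallyEq.1 h)]
  simp [pd1]

lemma pd2_of_notMem_tsupport {f : Plane → ℝ} {p : Plane} (h : p ∉ tsupport f) : pd2 f p = 0 := by
  rw [pd2_congr (notMem_tsupport_iff_eventuallyEq.1 h)]
  simp [pd2]

lemma integral_magDiv_of_tsupport_subset {Ω : Set Plane} (hΩ : IsOpen Ω)
    {a₁ a₂ x y w X₁ X₂ : Plane → ℝ}
    (ha₁ : ContDiffOn ℝ 1 a₁ Ω) (ha₂ : ContDiffOn ℝ 1 a₂ Ω) (hx : ContDiffOn ℝ 1 x Ω)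
    (hy : ContDiffOn ℝ 1 y Ω) (hw : ContDiff ℝ 1 w) (hX₁ : ContDiff ℝ 1 X₁)
    (hX₂ : ContDiff ℝ 1 X₂) (hwc : HasCompactSupport w) (hX₁c : HasCompactSupport X₁)
    (hX₂c : HasCompactSupport X₂) (hwΩ : tsupport w ⊆ Ω) (hX₁Ω : tsupport X₁ ⊆ Ω)
    (hX₂Ω : tsupport X₂ ⊆ Ω) :
    ∫ p, magDiv a₁ a₂ x y w X₁ X₂ p = 0 := by
  obtain ⟨χ, hχ, hχc, hχΩ, hχ1⟩ := exists_contDiff_cutoff hΩ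
    ((hwc.isCompact.union hX₁c.isCompact).union hX₂c.isCompact)
    (union_subset (union_subset hwΩ hX₁Ω) hX₂Ω)
  have e := integral_magDiv_of_contDiff (contDiff_mul_of_tsupport_subset hΩ hχ hχΩ ha₁)
    (contDiff_mul_of_tsupport_subset hΩ hχ hχΩ ha₂) (contDiff_mul_of_tsupport_subset hΩ hχ hχΩ hx)
    (contDiff_mul_of_tsupport_subset hΩ hχ hχΩ hy) hw hX₁ hX₂ hχc.mul_right hχc.mul_right
    hwc hX₁c hX₂c
  rw [← e]
  refine integral_congr_ae (Eventually.of_forall fun p => ?_)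
  by_cases hp : p ∈ (tsupport w ∪ tsupport X₁) ∪ tsupport X₂
  · have h1 := hχ1 p hp
    have h2 : ∀ f : Plane → ℝ, (fun q => χ q * f q) =ᶠ[𝓝 p] f := fun f =>
      h1.mono fun q hq => by simp [hq]
    have h3 : χ p = 1 := h1.eq_of_nhds
    simp only [magDiv, pd1_congr (h2 _), pd2_congr (h2 _), h3, one_mul]
  · simp only [mem_union, not_or] at hp
    have h0 : ∀ f : Plane → ℝ, p ∉ tsupport f → f p = 0 := fun f h => image_eq_zero_of_notMem_tsupport h
    simp only [magDiv, h0 w hp.1.1, h0 X₁ hp.1.2, h0 X₂ hp.2, pd1_of_notMem_tsupport hp.1.1,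
      pd2_of_notMem_tsupport hp.1.1, pd1_of_notMem_tsupport hp.1.2, pd2_of_notMem_tsupport hp.2]
    ring

lemma continuousOn_pd1 {Ω : Set Plane} (hΩ : IsOpen Ω) {f : Plane → ℝ}
    (hf : ContDiffOn ℝ 1 f Ω) : ContinuousOn (pd1 f) Ω :=
  (hf.continuousOn_fderiv_of_isOpen hΩ le_rfl).clm_apply continuousOn_const

lemma continuousOn_pd2 {Ω : Set Plane} (hΩ : IsOpen Ω) {f : Plane → ℝ}
    (hf : ContDiffOn ℝ 1 f Ω) : ContinuousOn (pd2 f) Ω :=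
  (hf.continuousOn_fderiv_of_isOpen hΩ le_rfl).clm_apply continuousOn_const

lemma continuousOn_magDiv {Ω : Set Plane} (hΩ : IsOpen Ω)
    {a₁ a₂ x y w X₁ X₂ : Plane → ℝ}
    (ha₁ : ContDiffOn ℝ 1 a₁ Ω) (ha₂ : ContDiffOn ℝ 1 a₂ Ω) (hx : ContDiffOn ℝ 1 x Ω)
    (hy : ContDiffOn ℝ 1 y Ω) (hw : ContDiffOn ℝ 1 w Ω) (hX₁ : ContDiffOn ℝ 1 X₁ Ω)
    (hX₂ : ContDiffOn ℝ 1 X₂ Ω) : ContinuousOn (magDiv a₁ a₂ x y w X₁ X₂) Ω := by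
  have := continuousOn_pd1 hΩ hx
  have := continuousOn_pd2 hΩ hx
  have := continuousOn_pd1 hΩ hy
  have := continuousOn_pd2 hΩ hy
  have := continuousOn_pd1 hΩ hw
  have := continuousOn_pd2 hΩ hw
  have := continuousOn_pd1 hΩ hX₁
  have := continuousOn_pd2 hΩ hX₂
  have := continuousOn_pd1 hΩ ha₂
  have := continuousOn_pd2 hΩ ha₁
  have := ha₁.continuousOn
  have := ha₂.continuousOn
  have := hx.continuousOn
  have := hy.continuousOn
  have := hw.continuousOn
  have := hX₁.continuousOn
  have := hX₂.continuousOn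
  unfold magDiv
  fun_prop

/-- `f` and its first partial derivatives are bounded by `M` on `Ω`. -/
def BddC1 (Ω : Set Plane) (M : ℝ) (f : Plane → ℝ) : Prop :=
  ∀ p ∈ Ω, |f p| ≤ M ∧ |pd1 f p| ≤ M ∧ |pd2 f p| ≤ M

lemma exists_bound_magDiv (M : ℝ) : ∃ N : ℝ, ∀ (Ω : Set Plane) (a₁ a₂ x y w X₁ X₂ : Plane → ℝ),
    BddC1 Ω M a₁ → BddC1 Ω M a₂ → BddC1 Ω M x → BddC1 Ω M y → BddC1 Ω M w → BddC1 Ω M X₁ →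
    BddC1 Ω M X₂ → ∀ p ∈ Ω, ‖magDiv a₁ a₂ x y w X₁ X₂ p‖ ≤ N := by
  let F : (Fin 17 → ℝ) → ℝ := fun v =>
    2 * v 4 * ((v 7 + v 0 * v 3) * (v 10 - v 1 * v 2) - (v 9 - v 0 * v 2) * (v 8 + v 1 * v 3))
    + (v 11 * (v 2 * (v 10 - v 1 * v 2) - v 3 * (v 8 + v 1 * v 3))
      - v 12 * (v 2 * (v 9 - v 0 * v 2) - v 3 * (v 7 + v 0 * v 3)))
    - v 4 * (v 13 - v 14) * (v 2 ^ 2 + v 3 ^ 2)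
    + 2 * (v 5 * (v 2 * (v 7 + v 0 * v 3) + v 3 * (v 9 - v 0 * v 2))
      + v 6 * (v 2 * (v 8 + v 1 * v 3) + v 3 * (v 10 - v 1 * v 2)))
    + (v 15 + v 16) * (v 2 ^ 2 + v 3 ^ 2)
  have hF : Continuous F := by fun_prop
  obtain ⟨N, hN⟩ := (isCompact_univ_pi fun _ : Fin 17 => isCompact_Icc (a := -M) (b := M)
    ).exists_bound_of_continuousOn hF.continuousOn
  refine ⟨N, fun Ω a₁ a₂ x y w X₁ X₂ ha₁ ha₂ hx hy hw hX₁ hX₂ p hp => ?_⟩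
  have := hN ![a₁ p, a₂ p, x p, y p, w p, X₁ p, X₂ p, pd1 x p, pd2 x p, pd1 y p, pd2 y p,
    pd1 w p, pd2 w p, pd1 a₂ p, pd2 a₁ p, pd1 X₁ p, pd2 X₂ p] (fun i _ => by
      refine mem_Icc.2 (abs_le.1 ?_)
      fin_cases i
      exacts [(ha₁ p hp).1, (ha₂ p hp).1, (hx p hp).1, (hy p hp).1, (hw p hp).1, (hX₁ p hp).1,
        (hX₂ p hp).1, (hx p hp).2.1, (hx p hp).2.2, (hy p hp).2.1, (hy p hp).2.2, (hw p hp).2.1,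
        (hw p hp).2.2, (ha₂ p hp).2.1, (ha₁ p hp).2.2, (hX₁ p hp).2.1, (hX₂ p hp).2.2])
  exact this

lemma integral_magDiv_eq_zero {Ω : Set Plane} (hΩ : IsOpen Ω) (hfin : volume Ω ≠ ⊤)
    {a₁ a₂ x y w X₁ X₂ : Plane → ℝ}
    (ha₁ : ContDiffOn ℝ 1 a₁ Ω) (ha₂ : ContDiffOn ℝ 1 a₂ Ω) (hx : ContDiffOn ℝ 1 x Ω)
    (hy : ContDiffOn ℝ 1 y Ω) (hw : ContDiffOn ℝ 1 w Ω) (hX₁ : ContDiffOn ℝ 1 X₁ Ω)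
    (hX₂ : ContDiffOn ℝ 1 X₂ Ω) {M : ℝ} (ba₁ : BddC1 Ω M a₁) (ba₂ : BddC1 Ω M a₂)
    (bx : BddC1 Ω M x) (bY : BddC1 Ω M y) (ψ : ℕ → Plane → ℝ) (hψ : ∀ n, ContDiff ℝ 1 (ψ n))
    (hψc : ∀ n, HasCompactSupport (ψ n)) (hψΩ : ∀ n, tsupport (ψ n) ⊆ Ω)
    (hψ1 : ∀ p ∈ Ω, ∀ᶠ n in atTop, ψ n =ᶠ[𝓝 p] 1)
    (bw : ∀ n, BddC1 Ω M (fun p => ψ n p * w p)) (bX₁ : ∀ n, BddC1 Ω M (fun p => ψ n p * X₁ p))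
    (bX₂ : ∀ n, BddC1 Ω M (fun p => ψ n p * X₂ p)) :
    IntegrableOn (magDiv a₁ a₂ x y w X₁ X₂) Ω ∧ ∫ p in Ω, magDiv a₁ a₂ x y w X₁ X₂ p = 0 := by
  obtain ⟨N, hN⟩ := exists_bound_magDiv M
  let F : ℕ → Plane → ℝ := fun n => magDiv a₁ a₂ x y (fun p => ψ n p * w p)
    (fun p => ψ n p * X₁ p) (fun p => ψ n p * X₂ p)
  have cw : ∀ n {f : Plane → ℝ}, ContDiffOn ℝ 1 f Ω → ContDiff ℝ 1 (fun p => ψ n p * f p) :=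
    fun n f hf => contDiff_mul_of_tsupport_subset hΩ (hψ n) (hψΩ n) hf
  have hF0 : ∀ n, ∫ p in Ω, F n p = 0 := by
    intro n
    have hsub : ∀ f : Plane → ℝ, tsupport (fun p => ψ n p * f p) ⊆ Ω := fun f =>
      (tsupport_mul_subset_left (f := ψ n) (g := f)).trans (hψΩ n)
    rw [setIntegral_eq_integral_of_forall_compl_eq_zero]
    · exact integral_magDiv_of_tsupport_subset hΩ ha₁ ha₂ hx hy (cw n hw) (cw n hX₁) (cw n hX₂)
        (hψc n).mul_right (hψc n).mul_right (hψc n).mul_right (hsub _) (hsub _) (hsub _)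
    · intro p hp
      have h0 : ψ n p = 0 := image_eq_zero_of_notMem_tsupport fun h => hp (hψΩ n h)
      have hn : ∀ f : Plane → ℝ, p ∉ tsupport (fun p => ψ n p * f p) := fun f h => hp (hsub f h)
      simp only [F, magDiv, h0, pd1_of_notMem_tsupport (hn _), pd2_of_notMem_tsupport (hn _)]
      ring
  have hFm : ∀ n, AEStronglyMeasurable (F n) (volume.restrict Ω) := fun n =>
    (continuousOn_magDiv hΩ ha₁ ha₂ hx hy (cw n hw).contDiffOn (cw n hX₁).contDiffOn
      (cw n hX₂).contDiffOn).aestronglyMeasurable hΩ.measurableSet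
  have hFb : ∀ n, ∀ p ∈ Ω, ‖F n p‖ ≤ N := fun n p hp =>
    hN Ω _ _ _ _ _ _ _ ba₁ ba₂ bx bY (bw n) (bX₁ n) (bX₂ n) p hp
  have hev : ∀ p ∈ Ω, ∀ᶠ n in atTop, F n p = magDiv a₁ a₂ x y w X₁ X₂ p := by
    intro p hp
    filter_upwards [hψ1 p hp] with n hn
    have h2 : ∀ f : Plane → ℝ, (fun q => ψ n q * f q) =ᶠ[𝓝 p] f := fun f =>
      hn.mono fun q hq => by simp [hq]
    have h3 : ψ n p = 1 := hn.eq_of_nhds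
    simp only [F, magDiv, pd1_congr (h2 _), pd2_congr (h2 _), h3, one_mul]
  have hlim : ∀ p ∈ Ω, Tendsto (fun n => F n p) atTop (𝓝 (magDiv a₁ a₂ x y w X₁ X₂ p)) :=
    fun p hp => tendsto_const_nhds.congr' ((hev p hp).mono fun n hn => hn.symm)
  have hbint : IntegrableOn (fun _ : Plane => N) Ω := integrableOn_const hfin
  constructor
  · refine Integrable.mono' hbint ((continuousOn_magDiv hΩ ha₁ ha₂ hx hy hw hX₁ hX₂
      ).aestronglyMeasurable hΩ.measurableSet) ?_
    refine (ae_restrict_iff' hΩ.measurableSet).2 (Eventually.of_forall fun p hp => ?_)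
    obtain ⟨n, hn⟩ := (hev p hp).exists
    exact hn ▸ hFb n p hp
  · have := tendsto_integral_of_dominated_convergence (fun _ => N) hFm hbint
      (fun n => (ae_restrict_iff' hΩ.measurableSet).2 (Eventually.of_forall (hFb n)))
      ((ae_restrict_iff' hΩ.measurableSet).2 (Eventually.of_forall hlim))
    simp only [hF0] at this
    exact tendsto_nhds_unique this tendsto_const_nhds |>.trans rfl

lemma BddC1.mono {Ω : Set Plane} {M N : ℝ} {f : Plane → ℝ} (h : BddC1 Ω M f) (hMN : M ≤ N) :
    BddC1 Ω N f := fun p hp =>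
  ⟨(h p hp).1.trans hMN, (h p hp).2.1.trans hMN, (h p hp).2.2.trans hMN⟩

lemma BddC1.cutoff_mul {Ω : Set Plane} {M : ℝ} {ψ f : Plane → ℝ} (hM : 0 ≤ M) (h : BddC1 Ω M f)
    (hψ : Differentiable ℝ ψ) (hf : ∀ p ∈ Ω, DifferentiableAt ℝ f p) (hψ1 : ∀ p ∈ Ω, |ψ p| ≤ 1)
    (h1 : ∀ p ∈ Ω, |pd1 ψ p * f p| ≤ M) (h2 : ∀ p ∈ Ω, |pd2 ψ p * f p| ≤ M) :
    BddC1 Ω (2 * M) (fun p => ψ p * f p) := by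
  intro p hp
  have hb : ∀ z, |z| ≤ M → |ψ p * z| ≤ M := fun z hz => by
    rw [abs_mul]
    exact (mul_le_of_le_one_left (abs_nonneg _) (hψ1 p hp)).trans hz
  obtain ⟨b0, b1, b2⟩ := h p hp
  rw [pd1_mul (hψ p) (hf p hp), pd2_mul (hψ p) (hf p hp)]
  refine ⟨(hb _ b0).trans (by linarith), ?_, ?_⟩
  · exact (abs_add_le _ _).trans (by linarith [h1 p hp, hb _ b1])
  · exact (abs_add_le _ _).trans (by linarith [h2 p hp, hb _ b2])

/-- The pointwise completion of squares behind the lower bound. -/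
lemma pointwise_square (P₁ P₂ Q₁ Q₂ x y n₁ n₂ b b' h : ℝ) (hb : b ^ 2 < 1)
    (hn : n₁ ^ 2 + n₂ ^ 2 = 1) :
    2 * b * (P₁ * Q₂ - Q₁ * P₂)
      + b' * (n₁ * (x * Q₂ - y * P₂) - n₂ * (x * Q₁ - y * P₁))
      - 2 * h * (n₁ * (x * P₁ + y * Q₁) + n₂ * (x * P₂ + y * Q₂))
      - (h ^ 2 + (2 * b * h - b') ^ 2 / (4 * (1 - b ^ 2))) * (x ^ 2 + y ^ 2)
    ≤ (P₁ ^ 2 + Q₁ ^ 2) + (P₂ ^ 2 + Q₂ ^ 2) := by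
  have h1 : 0 < 1 - b ^ 2 := by linarith
  obtain ⟨c, hc⟩ : ∃ c, b' = 2 * b * h - 2 * (1 - b ^ 2) * c :=
    ⟨(2 * b * h - b') / (2 * (1 - b ^ 2)), by field_simp; ring⟩
  have h2 : (2 * b * h - b') ^ 2 / (4 * (1 - b ^ 2)) = (1 - b ^ 2) * c ^ 2 := by
    rw [hc]; field_simp; ring
  have s1 := sq_nonneg (n₁ * P₁ + n₂ * P₂ + h * x - b * (n₁ * Q₂ - n₂ * Q₁))
  have s2 := sq_nonneg (n₁ * Q₁ + n₂ * Q₂ + h * y + b * (n₁ * P₂ - n₂ * P₁))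
  have s3 := mul_nonneg h1.le (add_nonneg (sq_nonneg (n₁ * Q₂ - n₂ * Q₁ + c * x))
    (sq_nonneg (n₁ * P₂ - n₂ * P₁ - c * y)))
  rw [h2, hc, ← sub_nonneg]
  refine (add_nonneg (add_nonneg s1 s2) s3).trans_eq ?_
  linear_combination ((P₁ ^ 2 + Q₁ ^ 2) + (P₂ ^ 2 + Q₂ ^ 2) - 2 * b * (P₁ * Q₂ - Q₁ * P₂)) * hn

/-- A collar of the boundary of `Ω`: an open subset `W` of `Ω` carrying a function `d`, comparable
to the distance to the boundary, whose gradient is the unit field `(n₁, n₂)` and whose Laplacian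
is `-κ`, such that `d` can only become small near the boundary. -/
structure Collar (Ω : Set Plane) (k : ℝ) where
  W : Set Plane
  t₀ : ℝ
  K : ℝ
  d : Plane → ℝ
  n₁ : Plane → ℝ
  n₂ : Plane → ℝ
  κ : Plane → ℝ
  isOpen : IsOpen W
  subset : W ⊆ Ω
  t₀_pos : 0 < t₀
  d_mem : ∀ p ∈ W, d p ∈ Ioo 0 t₀
  d_smooth : ContDiffOn ℝ 1 d W
  n₁_smooth : ContDiffOn ℝ 1 n₁ W
  n₂_smooth : ContDiffOn ℝ 1 n₂ W
  pd1_d : ∀ p ∈ W, pd1 d p = n₁ p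
  pd2_d : ∀ p ∈ W, pd2 d p = n₂ p
  n_sq : ∀ p ∈ W, n₁ p ^ 2 + n₂ p ^ 2 = 1
  n₁_bdd : BddC1 W K n₁
  n₂_bdd : BddC1 W K n₂
  div_n : ∀ p ∈ W, pd1 n₁ p + pd2 n₂ p = -κ p
  κ_le : ∀ p ∈ W, κ p ≤ k + K * d p
  κ_abs : ∀ p ∈ W, |κ p| ≤ K
  isCompact_far : ∀ η ∈ Ioo 0 t₀, IsCompact {p ∈ Ω | p ∉ W ∨ η ≤ d p}
  isOpen_far : ∀ η ∈ Ioo 0 t₀, IsOpen {p ∈ Ω | p ∉ W ∨ η < d p}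
  near : ∀ p ∈ W, ∃ q ∈ frontier Ω, segment ℝ q p ⊆ closure Ω ∧ ‖p - q‖ ≤ d p

lemma contDiffOn_one_of_hasDerivAt {f f' : ℝ → ℝ} (h : ∀ s > 0, HasDerivAt f (f' s) s)
    (hf' : ContinuousOn f' (Ici 0)) : ContDiffOn ℝ 1 f (Ioi 0) := by
  have : ContDiffOn ℝ (0 + 1) f (Ioi 0) := by
    rw [contDiffOn_succ_iff_deriv_of_isOpen isOpen_Ioi]
    refine ⟨fun s hs => (h s hs).differentiableAt.differentiableWithinAt, by simp, ?_⟩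
    rw [contDiffOn_zero]
    exact (hf'.mono Ioi_subset_Ici_self).congr fun s hs => (h s hs).deriv
  simpa using this

lemma exists_bound_of_deriv_far {f f' : ℝ → ℝ} {T : ℝ} (hT : 0 ≤ T) (hf : ContinuousOn f (Ici 0))
    (hf' : ContinuousOn f' (Ici 0)) (h : ∀ s > 0, HasDerivAt f (f' s) s) (h0 : f 0 = 0)
    (far : ∀ s, T ≤ s → f s = f T ∧ f' s = 0) :
    ∃ M, 0 ≤ M ∧ ∀ s, 0 ≤ s → |f' s| ≤ M ∧ |f s| ≤ M ∧ |f s| ≤ M * s := by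
  obtain ⟨N, hN⟩ := (isCompact_Icc (a := 0) (b := T)).exists_bound_of_continuousOn
    (hf'.mono Icc_subset_Ici_self)
  have hN0 : 0 ≤ N := (norm_nonneg _).trans (hN 0 ⟨le_rfl, hT⟩)
  have hb : ∀ s, 0 ≤ s → |f' s| ≤ N := fun s hs => by
    rcases le_total s T with h1 | h1
    · exact hN s ⟨hs, h1⟩
    · simp [(far s h1).2, hN0]
  have hlin : ∀ s, 0 ≤ s → |f s| ≤ N * s := fun s hs => by
    rcases hs.eq_or_lt with rfl | hs
    · simp [h0]
    obtain ⟨c, hc, e⟩ := exists_hasDerivAt_eq_slope f f' hs (hf.mono Icc_subset_Ici_self)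
      fun x hx => h x hx.1
    rw [h0, sub_zero, sub_zero, eq_div_iff hs.ne'] at e
    rw [← e, abs_mul, abs_of_pos hs]
    exact mul_le_mul_of_nonneg_right (hb c hc.1.le) hs.le
  refine ⟨N * max 1 T, by positivity, fun s hs => ⟨?_, ?_, ?_⟩⟩
  · exact (hb s hs).trans (le_mul_of_one_le_right hN0 (le_max_left _ _))
  · rcases le_total s T with h1 | h1
    · exact (hlin s hs).trans (mul_le_mul_of_nonneg_left (h1.trans (le_max_right _ _)) hN0)
    · rw [(far s h1).1]
      exact (hlin T hT).trans (mul_le_mul_of_nonneg_left (le_max_right _ _) hN0)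
  · refine (hlin s hs).trans (mul_le_mul_of_nonneg_right ?_ hs)
    exact le_mul_of_one_le_right hN0 (le_max_left _ _)

namespace Collar

variable {Ω : Set Plane} {k : ℝ} (W : Collar Ω k)

/-- The function of the distance to the boundary extended by a constant `c` outside the collar. -/
def radial (f : ℝ → ℝ) (c : ℝ) (p : Plane) : ℝ :=
  open Classical in if p ∈ W.W then f (W.d p) else c

variable {W} in
lemma radial_of_mem {f : ℝ → ℝ} {c : ℝ} {p : Plane} (hp : p ∈ W.W) :
    W.radial f c p = f (W.d p) := by simp [radial, hp]

variable {W} in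
lemma radial_of_notMem {f : ℝ → ℝ} {c : ℝ} {p : Plane} (hp : p ∉ W.W) :
    W.radial f c p = c := by simp [radial, hp]

lemma radial_eventuallyEq_of_mem {f : ℝ → ℝ} {c : ℝ} {p : Plane} (hp : p ∈ W.W) :
    W.radial f c =ᶠ[𝓝 p] fun q => f (W.d q) :=
  eventually_of_mem (W.isOpen.mem_nhds hp) fun _ hq => radial_of_mem hq

lemma radial_eventuallyEq_of_far {f : ℝ → ℝ} {c η : ℝ} {p : Plane} (hη : η ∈ Ioo 0 W.t₀)
    (hf : ∀ s, η ≤ s → f s = c) (hp : p ∈ Ω) (hp' : p ∉ W.W ∨ η < W.d p) :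
    W.radial f c =ᶠ[𝓝 p] fun _ => c := by
  refine eventually_of_mem ((W.isOpen_far η hη).mem_nhds ⟨hp, hp'⟩) fun q hq => ?_
  by_cases h : q ∈ W.W
  · rw [radial_of_mem h]
    exact hf _ (hq.2.resolve_left fun h' => h' h).le
  · exact radial_of_notMem h

lemma contDiffAt_d {p : Plane} (hp : p ∈ W.W) : ContDiffAt ℝ 1 W.d p :=
  W.d_smooth.contDiffAt (W.isOpen.mem_nhds hp)

lemma contDiffAt_comp_d {f : ℝ → ℝ} (hf : ContDiffOn ℝ 1 f (Ioi 0)) {p : Plane} (hp : p ∈ W.W) :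
    ContDiffAt ℝ 1 (fun q => f (W.d q)) p :=
  (hf.contDiffAt (isOpen_Ioi.mem_nhds (W.d_mem p hp).1)).comp p (W.contDiffAt_d hp)

lemma contDiffOn_radial {f : ℝ → ℝ} {c η : ℝ} (hη : η ∈ Ioo 0 W.t₀)
    (hf : ContDiffOn ℝ 1 f (Ioi 0)) (hfar : ∀ s, η ≤ s → f s = c) :
    ContDiffOn ℝ 1 (W.radial f c) Ω := by
  intro p hp
  by_cases h : p ∈ W.W
  · exact ((W.contDiffAt_comp_d hf h).congr_of_eventuallyEq
      (W.radial_eventuallyEq_of_mem h)).contDiffWithinAt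
  · exact (contDiffAt_const.congr_of_eventuallyEq
      (W.radial_eventuallyEq_of_far hη hfar hp (Or.inl h))).contDiffWithinAt

lemma pd_radial_of_mem {f : ℝ → ℝ} {f' c : ℝ} {p : Plane} (hp : p ∈ W.W)
    (hf : HasDerivAt f f' (W.d p)) :
    pd1 (W.radial f c) p = f' * W.n₁ p ∧ pd2 (W.radial f c) p = f' * W.n₂ p := by
  rw [pd1_congr (W.radial_eventuallyEq_of_mem hp), pd2_congr (W.radial_eventuallyEq_of_mem hp),
    ← W.pd1_d p hp, ← W.pd2_d p hp]
  have h := hf.comp_hasFDerivAt p ((W.contDiffAt_d hp).differentiableAt one_ne_zero).hasFDerivAt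
  have h' : fderiv ℝ (fun q => f (W.d q)) p = _ := h.fderiv
  constructor <;> simp [pd1, pd2, h']

lemma pd_radial_of_far {f : ℝ → ℝ} {c η : ℝ} {p : Plane} (hη : η ∈ Ioo 0 W.t₀)
    (hf : ∀ s, η ≤ s → f s = c) (hp : p ∈ Ω) (hp' : p ∉ W.W ∨ η < W.d p) :
    pd1 (W.radial f c) p = 0 ∧ pd2 (W.radial f c) p = 0 := by
  rw [pd1_congr (W.radial_eventuallyEq_of_far hη hf hp hp'),
    pd2_congr (W.radial_eventuallyEq_of_far hη hf hp hp')]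
  simp [pd1, pd2]

lemma n_abs {p : Plane} (hp : p ∈ W.W) : |W.n₁ p| ≤ 1 ∧ |W.n₂ p| ≤ 1 := by
  have := W.n_sq p hp
  constructor <;> rw [← sq_le_one_iff_abs_le_one] <;> nlinarith [sq_nonneg (W.n₁ p), sq_nonneg (W.n₂ p)]

lemma bddC1_radial {f f' : ℝ → ℝ} {c η M : ℝ} (hη : η ∈ Ioo 0 W.t₀) (hM : 0 ≤ M)
    (hf : ∀ s > 0, HasDerivAt f (f' s) s) (hfar : ∀ s, η ≤ s → f s = c)
    (hb : ∀ s, 0 ≤ s → |f' s| ≤ M ∧ |f s| ≤ M) : BddC1 Ω M (W.radial f c) := by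
  intro p hp
  by_cases h : p ∈ W.W
  · have hd := (W.d_mem p h).1
    obtain ⟨e1, e2⟩ := W.pd_radial_of_mem (c := c) h (hf _ hd)
    obtain ⟨b1, b2⟩ := hb _ hd.le
    obtain ⟨k1, k2⟩ := W.n_abs h
    rw [e1, e2, radial_of_mem h, abs_mul, abs_mul]
    exact ⟨b2, (mul_le_of_le_one_right (abs_nonneg _) k1).trans b1,
      (mul_le_of_le_one_right (abs_nonneg _) k2).trans b1⟩
  · obtain ⟨e1, e2⟩ := W.pd_radial_of_far hη hfar hp (Or.inl h)
    rw [e1, e2, radial_of_notMem h, ← hfar η le_rfl]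
    simpa [hM] using (hb η hη.1.le).2

/-- A function of the distance times a component of the normal, extended by zero. -/
lemma contDiffOn_radial_mul {f : ℝ → ℝ} {η : ℝ} (hη : η ∈ Ioo 0 W.t₀)
    (hf : ContDiffOn ℝ 1 f (Ioi 0)) (hfar : ∀ s, η ≤ s → f s = 0) {n : Plane → ℝ}
    (hn : ContDiffOn ℝ 1 n W.W) :
    ContDiffOn ℝ 1 (fun p => W.radial f 0 p * n p) Ω := by
  intro p hp
  by_cases h : p ∈ W.W
  · exact ((W.contDiffOn_radial hη hf hfar).contDiffAt
      (mem_of_superset (W.isOpen.mem_nhds h) W.subset) |>.mul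
      (hn.contDiffAt (W.isOpen.mem_nhds h))).contDiffWithinAt
  · refine ((contDiffAt_const (c := (0 : ℝ))).congr_of_eventuallyEq
      ((W.radial_eventuallyEq_of_far hη hfar hp (Or.inl h)).mono fun q hq => ?_)).contDiffWithinAt
    simp [hq]

end Collar

lemma exists_bound_deriv_smoothTransition :
    ∃ S, 0 ≤ S ∧ ∀ x, |deriv Real.smoothTransition x| ≤ S := by
  have hc : Continuous (deriv Real.smoothTransition) :=
    (Real.smoothTransition.contDiff (n := 1)).continuous_deriv le_rfl
  obtain ⟨S, hS⟩ := (isCompact_Icc (a := (0 : ℝ)) (b := 1)).exists_bound_of_continuousOn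
    hc.continuousOn
  have hS0 : 0 ≤ S := (norm_nonneg _).trans (hS 0 ⟨le_rfl, zero_le_one⟩)
  refine ⟨S, hS0, fun x => ?_⟩
  rcases lt_or_ge x 0 with h | h
  · have : Real.smoothTransition =ᶠ[𝓝 x] fun _ => 0 := (eventually_lt_nhds h).mono fun y hy =>
      Real.smoothTransition.zero_of_nonpos hy.le
    simpa [this.deriv_eq] using hS0
  rcases lt_or_ge 1 x with h' | h'
  · have : Real.smoothTransition =ᶠ[𝓝 x] fun _ => 1 := (eventually_gt_nhds h').mono fun y hy =>
      Real.smoothTransition.one_of_one_le (le_of_lt hy)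
    simpa [this.deriv_eq] using hS0
  · exact hS x ⟨h, h'⟩

namespace Collar

variable {Ω : Set Plane} {k : ℝ} (W : Collar Ω k)

/-- A cutoff equal to one at distance at least `2η` from the boundary and supported at
distance at least `η`. -/
def cutoff (η : ℝ) (p : Plane) : ℝ :=
  open Classical in
  if p ∈ Ω then W.radial (fun s => Real.smoothTransition (s / η - 1)) 1 p else 0

variable {η : ℝ}

lemma hasDerivAt_edge (η s : ℝ) : HasDerivAt (fun s => Real.smoothTransition (s / η - 1))
    (deriv Real.smoothTransition (s / η - 1) * (1 / η)) s := by
  have h1 : HasDerivAt (fun s : ℝ => s / η - 1) (1 / η) s :=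
    ((hasDerivAt_id s).div_const η).sub_const 1
  exact HasDerivAt.comp s ((Real.smoothTransition.contDiff (n := 1)).differentiable one_ne_zero
    (s / η - 1)).hasDerivAt h1

lemma edge_far (hη : 0 < η) (s : ℝ) (hs : 2 * η ≤ s) : Real.smoothTransition (s / η - 1) = 1 := by
  apply Real.smoothTransition.one_of_one_le
  have : 2 ≤ s / η := by rwa [le_div_iff₀ hη]
  linarith

lemma cutoff_eventuallyEq (hΩ : IsOpen Ω) {p : Plane} (hp : p ∈ Ω) :
    W.cutoff η =ᶠ[𝓝 p] W.radial (fun s => Real.smoothTransition (s / η - 1)) 1 :=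
  eventually_of_mem (hΩ.mem_nhds hp) fun q hq => by simp [cutoff, hq]

lemma cutoff_eq_zero (hη : 0 < η) {p : Plane} (hp : p ∉ {p ∈ Ω | p ∉ W.W ∨ η ≤ W.d p}) :
    W.cutoff η p = 0 := by
  by_cases h : p ∈ Ω
  · have h' : p ∈ W.W ∧ W.d p < η := by
      simp only [mem_ofPred_eq, not_and, not_or, not_not, not_le] at hp
      exact hp h
    simp only [cutoff, h, if_true, radial_of_mem h'.1]
    apply Real.smoothTransition.zero_of_nonpos
    have : W.d p / η ≤ 1 := by rw [div_le_one hη]; exact h'.2.le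
    linarith
  · simp [cutoff, h]

lemma contDiff_cutoff (hΩ : IsOpen Ω) (hη : 0 < η) (hη' : 2 * η < W.t₀) :
    ContDiff ℝ 1 (W.cutoff η) := by
  rw [contDiff_iff_contDiffAt]
  intro p
  by_cases hp : p ∈ Ω
  · refine ContDiffAt.congr_of_eventuallyEq ?_ (W.cutoff_eventuallyEq hΩ hp)
    refine (W.contDiffOn_radial ⟨by positivity, hη'⟩ ?_ (edge_far hη)).contDiffAt (hΩ.mem_nhds hp)
    exact ((Real.smoothTransition.contDiff (n := 1)).comp
      ((contDiff_id.div_const η).sub contDiff_const)).contDiffOn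
  · have hK := W.isCompact_far η ⟨hη, by linarith⟩
    refine (contDiffAt_const (c := (0 : ℝ))).congr_of_eventuallyEq
      (eventually_of_mem (hK.isClosed.isOpen_compl.mem_nhds fun h => hp h.1) fun q hq => ?_)
    exact W.cutoff_eq_zero hη hq

lemma tsupport_cutoff_subset (hη : 0 < η) (hη' : 2 * η < W.t₀) :
    tsupport (W.cutoff η) ⊆ {p ∈ Ω | p ∉ W.W ∨ η ≤ W.d p} :=
  closure_minimal (fun p hp => by_contra fun h => hp (W.cutoff_eq_zero hη h))
    (W.isCompact_far η ⟨hη, by linarith⟩).isClosed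

lemma hasCompactSupport_cutoff (hη : 0 < η) (hη' : 2 * η < W.t₀) :
    HasCompactSupport (W.cutoff η) :=
  (W.isCompact_far η ⟨hη, by linarith⟩).of_isClosed_subset (isClosed_tsupport _)
    (W.tsupport_cutoff_subset hη hη')

lemma cutoff_eventuallyEq_one (hΩ : IsOpen Ω) (hη : 0 < η) (hη' : 2 * η < W.t₀) {p : Plane}
    (hp : p ∈ Ω) (hp' : p ∉ W.W ∨ 2 * η < W.d p) : W.cutoff η =ᶠ[𝓝 p] 1 :=
  (W.cutoff_eventuallyEq hΩ hp).trans
    (W.radial_eventuallyEq_of_far ⟨by positivity, hη'⟩ (edge_far hη) hp hp')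

lemma abs_cutoff_le_one (p : Plane) : |W.cutoff η p| ≤ 1 := by
  rw [abs_le]
  unfold cutoff radial
  have h0 := fun x => Real.smoothTransition.nonneg x
  have h1 := fun x => Real.smoothTransition.le_one x
  split_ifs
  · exact ⟨by linarith [h0 (W.d p / η - 1)], h1 _⟩
  all_goals norm_num

lemma abs_pd_cutoff_mul_le (hΩ : IsOpen Ω) (hη : 0 < η) (hη' : 2 * η < W.t₀) {S M z : ℝ}
    (hS : ∀ x, |deriv Real.smoothTransition x| ≤ S) (hM : 0 ≤ M) {p : Plane} (hp : p ∈ Ω)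
    (hz : p ∈ W.W → |z| ≤ M * W.d p) :
    |pd1 (W.cutoff η) p * z| ≤ 2 * S * M ∧ |pd2 (W.cutoff η) p * z| ≤ 2 * S * M := by
  have hS0 : 0 ≤ S := (abs_nonneg _).trans (hS 0)
  rw [pd1_congr (W.cutoff_eventuallyEq hΩ hp), pd2_congr (W.cutoff_eventuallyEq hΩ hp)]
  by_cases h : p ∉ W.W ∨ 2 * η < W.d p
  · obtain ⟨e1, e2⟩ := W.pd_radial_of_far ⟨by positivity, hη'⟩ (edge_far hη) hp h
    rw [e1, e2]
    simp only [zero_mul, abs_zero]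
    exact ⟨by positivity, by positivity⟩
  · simp only [not_or, not_not, not_lt] at h
    obtain ⟨e1, e2⟩ := W.pd_radial_of_mem (c := 1) h.1 (hasDerivAt_edge η (W.d p))
    obtain ⟨k1, k2⟩ := W.n_abs h.1
    have key : ∀ n : ℝ, |n| ≤ 1 →
        |deriv Real.smoothTransition (W.d p / η - 1) * (1 / η) * n * z| ≤ 2 * S * M := by
      intro n hn
      rw [abs_mul, abs_mul, abs_mul, abs_of_pos (show 0 < 1 / η by positivity)]
      calc _ ≤ S * (1 / η) * 1 * (M * (2 * η)) := by
            have := hS (W.d p / η - 1)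
            have hz' : |z| ≤ M * (2 * η) :=
              (hz h.1).trans (mul_le_mul_of_nonneg_left h.2 hM)
            gcongr
        _ = 2 * S * M := by field_simp
    rw [e1, e2]
    exact ⟨key _ k1, key _ k2⟩

/-- Integration by parts with weights vanishing on the boundary. -/
lemma integral_magDiv_eq_zero (hΩ : IsOpen Ω) (hfin : volume Ω ≠ ⊤)
    {a₁ a₂ x y w X₁ X₂ : Plane → ℝ}
    (ha₁ : ContDiffOn ℝ 1 a₁ Ω) (ha₂ : ContDiffOn ℝ 1 a₂ Ω) (hx : ContDiffOn ℝ 1 x Ω)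
    (hy : ContDiffOn ℝ 1 y Ω) (hw : ContDiffOn ℝ 1 w Ω) (hX₁ : ContDiffOn ℝ 1 X₁ Ω)
    (hX₂ : ContDiffOn ℝ 1 X₂ Ω) {M : ℝ} (ba₁ : BddC1 Ω M a₁) (ba₂ : BddC1 Ω M a₂)
    (bx : BddC1 Ω M x) (bY : BddC1 Ω M y) (bw : BddC1 Ω M w) (bX₁ : BddC1 Ω M X₁)
    (bX₂ : BddC1 Ω M X₂) (dw : ∀ p ∈ W.W, |w p| ≤ M * W.d p)
    (dX₁ : ∀ p ∈ W.W, |X₁ p| ≤ M * W.d p) (dX₂ : ∀ p ∈ W.W, |X₂ p| ≤ M * W.d p) :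
    IntegrableOn (magDiv a₁ a₂ x y w X₁ X₂) Ω ∧ ∫ p in Ω, magDiv a₁ a₂ x y w X₁ X₂ p = 0 := by
  rcases Ω.eq_empty_or_nonempty with he | ⟨p₀, hp₀⟩
  · simp [he]
  have hM : 0 ≤ M := (abs_nonneg _).trans (bx p₀ hp₀).1
  obtain ⟨S, hS0, hS⟩ := exists_bound_deriv_smoothTransition
  have hη : ∀ n : ℕ, 0 < W.t₀ / (n + 3) := fun n => div_pos W.t₀_pos (by positivity)
  have hη' : ∀ n : ℕ, 2 * (W.t₀ / (n + 3)) < W.t₀ := fun n => by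
    rw [← mul_div_assoc, div_lt_iff₀ (by positivity)]
    have := W.t₀_pos
    nlinarith [Nat.cast_nonneg (α := ℝ) n]
  have hlim : Tendsto (fun n : ℕ => 2 * (W.t₀ / (n + 3))) atTop (𝓝 0) := by
    have : Tendsto (fun n : ℕ => W.t₀ / ((n : ℝ) + 3)) atTop (𝓝 0) :=
      tendsto_const_nhds.div_atTop (tendsto_atTop_add_const_right _ _ tendsto_natCast_atTop_atTop)
    simpa using this.const_mul 2
  set N := 2 * max M (2 * S * M) with hN
  have hMN : M ≤ N := by
    have := le_max_left M (2 * S * M)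
    linarith
  have hcut : ∀ n {f : Plane → ℝ}, ContDiffOn ℝ 1 f Ω → BddC1 Ω M f →
      (∀ p ∈ W.W, |f p| ≤ M * W.d p) →
      BddC1 Ω N (fun p => W.cutoff (W.t₀ / ((n : ℕ) + 3)) p * f p) := fun n f hf bf df => by
    have hb := fun p hp => W.abs_pd_cutoff_mul_le hΩ (hη n) (hη' n) hS hM hp (df p)
    exact (bf.mono (le_max_left _ _)).cutoff_mul (hM.trans (le_max_left _ _))
      ((W.contDiff_cutoff hΩ (hη n) (hη' n)).differentiable one_ne_zero)
      (fun p hp => (hf.contDiffAt (hΩ.mem_nhds hp)).differentiableAt one_ne_zero)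
      (fun p _ => W.abs_cutoff_le_one p) (fun p hp => (hb p hp).1.trans (le_max_right _ _))
      (fun p hp => (hb p hp).2.trans (le_max_right _ _))
  refine SC.integral_magDiv_eq_zero hΩ hfin ha₁ ha₂ hx hy hw hX₁ hX₂ (ba₁.mono hMN) (ba₂.mono hMN)
    (bx.mono hMN) (bY.mono hMN) (fun n => W.cutoff (W.t₀ / (n + 3)))
    (fun n => W.contDiff_cutoff hΩ (hη n) (hη' n))
    (fun n => W.hasCompactSupport_cutoff (hη n) (hη' n))
    (fun n => (W.tsupport_cutoff_subset (hη n) (hη' n)).trans fun p hp => hp.1)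
    (fun p hp => ?_) (fun n => hcut n hw bw dw) (fun n => hcut n hX₁ bX₁ dX₁)
    (fun n => hcut n hX₂ bX₂ dX₂)
  by_cases h : p ∈ W.W
  · filter_upwards [hlim.eventually (eventually_lt_nhds (W.d_mem p h).1)] with n hn
    exact W.cutoff_eventuallyEq_one hΩ (hη n) (hη' n) hp (Or.inr hn)
  · exact Eventually.of_forall fun n =>
      W.cutoff_eventuallyEq_one hΩ (hη n) (hη' n) hp (Or.inl h)

end Collar

lemma exists_bddC1 {Ω : Set Plane} (hΩ : Bornology.IsBounded Ω) {f : Plane → ℝ}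
    (hf : CNearCl 1 Ω f) : ContDiffOn ℝ 1 f Ω ∧ ∃ M, BddC1 Ω M f := by
  obtain ⟨U, hU, hsub, hf⟩ := hf
  have hK : IsCompact (closure Ω) := hΩ.isCompact_closure
  obtain ⟨M₀, h₀⟩ := hK.exists_bound_of_continuousOn (hf.continuousOn.mono hsub)
  obtain ⟨M₁, h₁⟩ := hK.exists_bound_of_continuousOn ((continuousOn_pd1 hU hf).mono hsub)
  obtain ⟨M₂, h₂⟩ := hK.exists_bound_of_continuousOn ((continuousOn_pd2 hU hf).mono hsub)
  refine ⟨hf.mono (subset_closure.trans hsub), max M₀ (max M₁ M₂), fun p hp => ?_⟩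
  have hp := subset_closure hp
  exact ⟨(h₀ p hp).trans (le_max_left _ _),
    (h₁ p hp).trans ((le_max_left _ _).trans (le_max_right _ _)),
    (h₂ p hp).trans ((le_max_right _ _).trans (le_max_right _ _))⟩

lemma CNearCl.clm_comp {E F : Type*} [NormedAddCommGroup E] [NormedSpace ℝ E]
    [NormedAddCommGroup F] [NormedSpace ℝ F] {n : ℕ} {Ω : Set Plane} {f : Plane → E}
    (hf : CNearCl n Ω f) (L : E →L[ℝ] F) : CNearCl n Ω (fun p => L (f p)) := by
  obtain ⟨U, hU, hsub, hf⟩ := hf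
  exact ⟨U, hU, hsub, L.contDiff.comp_contDiffOn hf⟩

lemma CNearCl.differentiableAt {E : Type*} [NormedAddCommGroup E] [NormedSpace ℝ E]
    {n : ℕ} {Ω : Set Plane} {f : Plane → E} (hn : n ≠ 0) (hf : CNearCl n Ω f) {p : Plane}
    (hp : p ∈ closure Ω) : DifferentiableAt ℝ f p := by
  obtain ⟨U, hU, hsub, hf⟩ := hf
  exact (hf.contDiffAt (hU.mem_nhds (hsub hp))).differentiableAt (by exact_mod_cast hn)

lemma CNearCl.of_le {E : Type*} [NormedAddCommGroup E] [NormedSpace ℝ E]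
    {m n : ℕ} {Ω : Set Plane} {f : Plane → E} (hf : CNearCl n Ω f) (hmn : m ≤ n) :
    CNearCl m Ω f := by
  obtain ⟨U, hU, hsub, hf⟩ := hf
  exact ⟨U, hU, hsub, hf.of_le (by exact_mod_cast hmn)⟩

lemma magSq_eq {B : ℝ} {A : Plane → Plane} {u : Plane → ℂ} {p : Plane}
    (hu : DifferentiableAt ℝ u p) :
    magSq B A u p =
      ((pd1 (fun q => (u q).re) p + B * (A p).1 * (u p).im) ^ 2
        + (pd1 (fun q => (u q).im) p - B * (A p).1 * (u p).re) ^ 2)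
      + ((pd2 (fun q => (u q).re) p + B * (A p).2 * (u p).im) ^ 2
        + (pd2 (fun q => (u q).im) p - B * (A p).2 * (u p).re) ^ 2) := by
  have h1 : fderiv ℝ (fun q => (u q).re) p = Complex.reCLM.comp (fderiv ℝ u p) :=
    (Complex.reCLM.hasFDerivAt.comp p hu.hasFDerivAt).fderiv
  have h2 : fderiv ℝ (fun q => (u q).im) p = Complex.imCLM.comp (fderiv ℝ u p) :=
    (Complex.imCLM.hasFDerivAt.comp p hu.hasFDerivAt).fderiv
  simp only [magSq, pd1, pd2, h1, h2, ← Complex.normSq_eq_norm_sq, Complex.normSq_apply]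
  simp
  ring

lemma curl2_const_mul (A : Plane → Plane) (B : ℝ) {p : Plane} (hA : DifferentiableAt ℝ A p) :
    pd1 (fun q => B * (A q).2) p - pd2 (fun q => B * (A q).1) p = B * curl2 A p := by
  have h1 : DifferentiableAt ℝ (fun q => (A q).1) p := hA.fst
  have h2 : DifferentiableAt ℝ (fun q => (A q).2) p := hA.snd
  simp [pd1, pd2, curl2, fderiv_const_mul h1, fderiv_const_mul h2]
  ring

lemma integrableOn_normSq {Ω : Set Plane} (hΩ : Bornology.IsBounded Ω) {u : Plane → ℂ}
    (hu : CNearCl 1 Ω u) : IntegrableOn (fun p => ‖u p‖ ^ 2) Ω := by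
  obtain ⟨U, hU, hsub, hu⟩ := hu
  exact (((hu.continuousOn.mono hsub).norm.pow 2).integrableOn_compact hΩ.isCompact_closure).mono_set
    subset_closure

lemma integrableOn_magSq {Ω : Set Plane} (hΩ : Bornology.IsBounded Ω) {B : ℝ}
    {A : Plane → Plane} {u : Plane → ℂ} (hA : CNearCl 1 Ω A) (hu : CNearCl 1 Ω u) :
    IntegrableOn (magSq B A u) Ω := by
  obtain ⟨U, hU, hsub, hu⟩ := hu
  obtain ⟨V, hV, hsub', hA⟩ := hA
  have c1 := hu.continuousOn.mono hsub
  have c2 := hA.continuousOn.mono hsub'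
  have c3 := (hu.continuousOn_fderiv_of_isOpen hU le_rfl).mono hsub
  have c4 : ∀ v, ContinuousOn (fun p => fderiv ℝ u p v) (closure Ω) := fun v =>
    c3.clm_apply continuousOn_const
  refine (ContinuousOn.integrableOn_compact hΩ.isCompact_closure ?_).mono_set subset_closure
  have e1 : ContinuousOn (fun p => ((B * (A p).1 : ℝ) : ℂ)) (closure Ω) :=
    Complex.continuous_ofReal.comp_continuousOn (continuousOn_const.mul c2.fst)
  have e2 : ContinuousOn (fun p => ((B * (A p).2 : ℝ) : ℂ)) (closure Ω) :=
    Complex.continuous_ofReal.comp_continuousOn (continuousOn_const.mul c2.snd)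
  exact (((continuousOn_const.mul (c4 _)).sub (e1.mul c1)).norm.pow 2).add
    (((continuousOn_const.mul (c4 _)).sub (e2.mul c1)).norm.pow 2)

/-- The pointwise lower bound, up to a term of zero integral. -/
lemma le_add_magDiv {a₁ a₂ x y w X₁ X₂ : Plane → ℝ} {p : Plane} {n₁ n₂ b b' h h' κ β Λ : ℝ}
    (hb : b ^ 2 < 1) (hn : n₁ ^ 2 + n₂ ^ 2 = 1) (hβ : pd1 a₂ p - pd2 a₁ p = β)
    (hw : w p = -b) (hw1 : pd1 w p = -b' * n₁) (hw2 : pd2 w p = -b' * n₂)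
    (hX₁ : X₁ p = h * n₁) (hX₂ : X₂ p = h * n₂) (hX : pd1 X₁ p + pd2 X₂ p = h' - κ * h)
    (hΛ : Λ ≤ profileEnergy κ β h h' b b') :
    Λ * (x p ^ 2 + y p ^ 2) ≤
      (((pd1 x p + a₁ p * y p) ^ 2 + (pd1 y p - a₁ p * x p) ^ 2)
      + ((pd2 x p + a₂ p * y p) ^ 2 + (pd2 y p - a₂ p * x p) ^ 2))
      + magDiv a₁ a₂ x y w X₁ X₂ p := by
  have key := pointwise_square (pd1 x p + a₁ p * y p) (pd2 x p + a₂ p * y p)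
    (pd1 y p - a₁ p * x p) (pd2 y p - a₂ p * x p) (x p) (y p) n₁ n₂ b b' h hb hn
  have h1 := mul_le_mul_of_nonneg_right hΛ (add_nonneg (sq_nonneg (x p)) (sq_nonneg (y p)))
  rw [profileEnergy] at h1
  rw [magDiv, hβ, hw, hw1, hw2, hX₁, hX₂, hX]
  linarith

namespace Collar

variable {Ω : Set Plane} {k : ℝ} (W : Collar Ω k)

lemma energy_bound (hΩ : IsOpen Ω) (hΩb : Bornology.IsBounded Ω) {t : ℝ} (ht : 0 < t)
    (ht' : 2 * t < W.t₀) {h h' b b' : ℝ → ℝ} (hp : IsProfile t h h' b b') {B : ℝ}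
    {A : Plane → Plane} (hA : CNearCl 2 Ω A) {u : Plane → ℂ} (hu : CNearCl 1 Ω u) {Λ : ℝ}
    (hΛ : ∀ p ∈ W.W, Λ ≤ profileEnergy (W.κ p) (B * curl2 A p) (h (W.d p)) (h' (W.d p))
      (b (W.d p)) (b' (W.d p)))
    (hΛ' : ∀ p ∈ Ω, p ∉ W.W → Λ ≤ profileEnergy 0 (B * curl2 A p) 0 0 (b (2 * t)) 0) :
    Λ * ∫ p in Ω, ‖u p‖ ^ 2 ≤ ∫ p in Ω, magSq B A u p := by
  have hA1 := hA.of_le (m := 1) (by norm_num)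
  obtain ⟨sx, Mx, bx⟩ := exists_bddC1 hΩb (hu.clm_comp Complex.reCLM)
  obtain ⟨sy, My, bY⟩ := exists_bddC1 hΩb (hu.clm_comp Complex.imCLM)
  obtain ⟨sa₁, M₁, ba₁⟩ := exists_bddC1 hΩb
    (hA1.clm_comp (B • ContinuousLinearMap.fst ℝ ℝ ℝ))
  obtain ⟨sa₂, M₂, ba₂⟩ := exists_bddC1 hΩb
    (hA1.clm_comp (B • ContinuousLinearMap.snd ℝ ℝ ℝ))
  have h2t : 2 * t ∈ Ioo 0 W.t₀ := ⟨by positivity, ht'⟩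
  have h1t : t ∈ Ioo 0 W.t₀ := ⟨ht, by linarith⟩
  obtain ⟨Mb, hMb, Bb⟩ := exists_bound_of_deriv_far (T := 2 * t) (by positivity) hp.cont_b
    hp.cont_b' hp.deriv_b hp.b_zero hp.b_far
  obtain ⟨Mh, hMh, Bh⟩ := exists_bound_of_deriv_far (T := t) ht.le hp.cont_h
    hp.cont_h' hp.deriv_h hp.h_zero fun s hs => by
      rw [(hp.h_far s hs).1, (hp.h_far t le_rfl).1]; exact ⟨rfl, (hp.h_far s hs).2⟩
  have hfarh : ∀ s, t ≤ s → h s = 0 := fun s hs => (hp.h_far s hs).1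
  have hfarb : ∀ s, 2 * t ≤ s → -b s = -b (2 * t) := fun s hs => by rw [(hp.b_far s hs).1]
  have Bb' : ∀ s, 0 ≤ s → |-b' s| ≤ Mb ∧ |-b s| ≤ Mb ∧ |-b s| ≤ Mb * s := by simpa using Bb
  have db' : ∀ s > 0, HasDerivAt (fun s => -b s) (-b' s) s := fun s hs => (hp.deriv_b s hs).neg
  have sb := contDiffOn_one_of_hasDerivAt db' hp.cont_b'.neg
  have sh := contDiffOn_one_of_hasDerivAt hp.deriv_h hp.cont_h'
  have sw := W.contDiffOn_radial h2t sb hfarb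
  have srh := W.contDiffOn_radial h1t sh hfarh
  have sX₁ := W.contDiffOn_radial_mul h1t sh hfarh W.n₁_smooth
  have sX₂ := W.contDiffOn_radial_mul h1t sh hfarh W.n₂_smooth
  have bw := W.bddC1_radial h2t hMb db' hfarb fun s hs => ⟨(Bb' s hs).1, (Bb' s hs).2.1⟩
  have pdX : ∀ p ∈ W.W, ∀ n : Plane → ℝ, ContDiffOn ℝ 1 n W.W →
      pd1 (fun p => W.radial h 0 p * n p) p
        = h' (W.d p) * W.n₁ p * n p + h (W.d p) * pd1 n p ∧
      pd2 (fun p => W.radial h 0 p * n p) p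
        = h' (W.d p) * W.n₂ p * n p + h (W.d p) * pd2 n p := fun p hpW n hn => by
    have d1 := (srh.contDiffAt (hΩ.mem_nhds (W.subset hpW))).differentiableAt one_ne_zero
    have d2 := (hn.contDiffAt (W.isOpen.mem_nhds hpW)).differentiableAt one_ne_zero
    obtain ⟨e1, e2⟩ := W.pd_radial_of_mem (c := 0) hpW (hp.deriv_h _ (W.d_mem p hpW).1)
    rw [pd1_mul d1 d2, pd2_mul d1 d2, e1, e2, radial_of_mem hpW]
    exact ⟨rfl, rfl⟩
  have pdX0 : ∀ p ∈ Ω, p ∉ W.W → ∀ n : Plane → ℝ,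
      pd1 (fun p => W.radial h 0 p * n p) p = 0 ∧
      pd2 (fun p => W.radial h 0 p * n p) p = 0 := fun p hpΩ hpW n => by
    have : (fun p => W.radial h 0 p * n p) =ᶠ[𝓝 p] fun _ => 0 :=
      (W.radial_eventuallyEq_of_far h1t hfarh hpΩ (Or.inl hpW)).mono fun q hq => by simp [hq]
    rw [pd1_congr this, pd2_congr this]
    simp [pd1, pd2]
  have bX : ∀ n : Plane → ℝ, ContDiffOn ℝ 1 n W.W → BddC1 W.W W.K n →
      (∀ p ∈ W.W, |n p| ≤ 1) →
      BddC1 Ω (Mh * (1 + |W.K|)) (fun p => W.radial h 0 p * n p) := fun n sn bn n1 p hpΩ => by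
    have hK : Mh ≤ Mh * (1 + |W.K|) :=
      le_mul_of_one_le_right hMh (by linarith [abs_nonneg W.K])
    by_cases hpW : p ∈ W.W
    · obtain ⟨e1, e2⟩ := pdX p hpW n sn
      obtain ⟨c1, c2, -⟩ := Bh _ (W.d_mem p hpW).1.le
      obtain ⟨k1, k2⟩ := W.n_abs hpW
      have hgen : ∀ m z, |m| ≤ 1 → |z| ≤ W.K →
          |h' (W.d p) * m * n p + h (W.d p) * z| ≤ Mh * (1 + |W.K|) := fun m z hm hz => by
        refine (abs_add_le _ _).trans ?_
        rw [abs_mul, abs_mul, abs_mul]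
        calc _ ≤ Mh * 1 * 1 + Mh * |W.K| := by
              have := n1 p hpW
              have := hz.trans (le_abs_self _)
              gcongr
          _ = _ := by ring
      rw [e1, e2]
      beta_reduce
      rw [radial_of_mem hpW]
      refine ⟨?_, hgen _ _ k1 (bn p hpW).2.1, hgen _ _ k2 (bn p hpW).2.2⟩
      rw [abs_mul]
      exact ((mul_le_of_le_one_right (abs_nonneg _) (n1 p hpW)).trans c2).trans hK
    · rw [(pdX0 p hpΩ hpW n).1, (pdX0 p hpΩ hpW n).2]
      beta_reduce
      rw [radial_of_notMem hpW]
      simp only [zero_mul, abs_zero, and_self]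
      exact hMh.trans hK
  have n1 : ∀ p ∈ W.W, |W.n₁ p| ≤ 1 := fun p hp => (W.n_abs hp).1
  have n2 : ∀ p ∈ W.W, |W.n₂ p| ≤ 1 := fun p hp => (W.n_abs hp).2
  have dX : ∀ n : Plane → ℝ, (∀ p ∈ W.W, |n p| ≤ 1) →
      ∀ p ∈ W.W, |W.radial h 0 p * n p| ≤ Mh * W.d p := fun n hn p hpW => by
    rw [radial_of_mem hpW, abs_mul]
    exact (mul_le_of_le_one_right (abs_nonneg _) (hn p hpW)).trans
      (Bh _ (W.d_mem p hpW).1.le).2.2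
  obtain ⟨M, hM⟩ : ∃ M, Mx ≤ M ∧ My ≤ M ∧ M₁ ≤ M ∧ M₂ ≤ M ∧ Mb ≤ M ∧ Mh ≤ M ∧
      Mh * (1 + |W.K|) ≤ M :=
    ⟨|Mx| + |My| + |M₁| + |M₂| + Mb + Mh + Mh * (1 + |W.K|), by
      have := mul_nonneg hMh (add_nonneg zero_le_one (abs_nonneg W.K))
      refine ⟨?_, ?_, ?_, ?_, ?_, ?_, ?_⟩ <;>
      linarith [le_abs_self Mx, le_abs_self My, le_abs_self M₁, le_abs_self M₂, abs_nonneg Mx,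
        abs_nonneg My, abs_nonneg M₁, abs_nonneg M₂]⟩
  obtain ⟨m1, m2, m3, m4, m5, m6, m7⟩ := hM
  have hlin : ∀ {N : ℝ} {z : ℝ} {p : Plane}, N ≤ M → p ∈ W.W → |z| ≤ N * W.d p →
      |z| ≤ M * W.d p := fun hN hpW hz =>
    hz.trans (mul_le_mul_of_nonneg_right hN (W.d_mem _ hpW).1.le)
  obtain ⟨iD, zD⟩ := W.integral_magDiv_eq_zero hΩ hΩb.measure_lt_top.ne sa₁ sa₂ sx sy sw sX₁ sX₂
    (ba₁.mono m3) (ba₂.mono m4) (bx.mono m1) (bY.mono m2) (bw.mono m5)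
    ((bX _ W.n₁_smooth W.n₁_bdd n1).mono m7) ((bX _ W.n₂_smooth W.n₂_bdd n2).mono m7)
    (fun p hpW => hlin m5 hpW (by
      rw [radial_of_mem hpW]; exact (Bb' _ (W.d_mem p hpW).1.le).2.2))
    (fun p hpW => hlin m6 hpW (dX _ n1 p hpW)) (fun p hpW => hlin m6 hpW (dX _ n2 p hpW))
  have iu := integrableOn_normSq hΩb hu
  have im := integrableOn_magSq (B := B) hΩb hA1 hu
  rw [← integral_const_mul]
  calc _ ≤ ∫ p in Ω, (magSq B A u p +
        magDiv (fun p => (B • ContinuousLinearMap.fst ℝ ℝ ℝ) (A p))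
          (fun p => (B • ContinuousLinearMap.snd ℝ ℝ ℝ) (A p))
          (fun p => Complex.reCLM (u p)) (fun p => Complex.imCLM (u p))
          (W.radial (fun s => -b s) (-b (2 * t))) (fun p => W.radial h 0 p * W.n₁ p)
          (fun p => W.radial h 0 p * W.n₂ p) p) := by
        refine setIntegral_mono_on (iu.const_mul Λ) (im.add iD) hΩ.measurableSet fun p hpΩ => ?_
        have hcl := subset_closure hpΩ
        rw [magSq_eq (hu.differentiableAt one_ne_zero hcl), ← Complex.normSq_eq_norm_sq,
          Complex.normSq_apply, ← sq, ← sq]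
        have hβ := curl2_const_mul A B (hA.differentiableAt two_ne_zero hcl)
        by_cases hpW : p ∈ W.W
        · have hd := (W.d_mem p hpW).1
          obtain ⟨e1, e2⟩ := W.pd_radial_of_mem (c := -b (2 * t)) hpW (db' _ hd)
          refine le_add_magDiv (x := fun p => Complex.reCLM (u p))
            (y := fun p => Complex.imCLM (u p)) (X₁ := fun p => W.radial h 0 p * W.n₁ p)
            (X₂ := fun p => W.radial h 0 p * W.n₂ p) (hp.sq_lt _ hd.le) (W.n_sq p hpW) hβ (radial_of_mem hpW) e1 e2
            (congrArg (· * W.n₁ p) (radial_of_mem hpW)) (congrArg (· * W.n₂ p) (radial_of_mem hpW)) ?_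
            (hΛ p hpW)
          rw [(pdX p hpW _ W.n₁_smooth).1, (pdX p hpW _ W.n₂_smooth).2]
          linear_combination h' (W.d p) * W.n_sq p hpW + h (W.d p) * W.div_n p hpW
        · obtain ⟨e1, e2⟩ := W.pd_radial_of_far h2t hfarb hpΩ (Or.inl hpW)
          refine le_add_magDiv (x := fun p => Complex.reCLM (u p))
            (y := fun p => Complex.imCLM (u p)) (X₁ := fun p => W.radial h 0 p * W.n₁ p)
            (X₂ := fun p => W.radial h 0 p * W.n₂ p) (n₁ := 1) (n₂ := 0) (h := 0) (h' := 0) (κ := 0) (b := b (2 * t))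
            (b' := 0) (hp.sq_lt _ (by positivity)) (by norm_num) hβ (radial_of_notMem hpW)
            (e1.trans (by simp)) (e2.trans (by simp))
            ((congrArg (· * W.n₁ p) (radial_of_notMem hpW)).trans (by simp))
            ((congrArg (· * W.n₂ p) (radial_of_notMem hpW)).trans (by simp)) ?_ (hΛ' p hpΩ hpW)
          rw [(pdX0 p hpΩ hpW _).1, (pdX0 p hpΩ hpW _).2]
          ring
    _ = ∫ p in Ω, magSq B A u p := by rw [integral_add im iD, zD, add_zero]

end Collar

/-- Normal coordinates `(s, t) ↦ γ(s) + t ν(s)` along the curve `γ`. -/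
def normalMap (γ : ℝ → Plane) (z : ℝ × ℝ) : Plane := γ z.1 + z.2 • nuVec γ z.1

/-- The differential of the normal coordinates at a point where the unit tangent is `T` and the
length element is `c`, as an invertible linear map. -/
def frameEquiv (T : Plane) (hT : esq T = 1) (c : ℝ) (hc : c ≠ 0) : (ℝ × ℝ) ≃L[ℝ] Plane :=
  ContinuousLinearEquiv.equivOfInverse
    ((ContinuousLinearMap.fst ℝ ℝ ℝ).smulRight (c • T)
      + (ContinuousLinearMap.snd ℝ ℝ ℝ).smulRight ((-T.2, T.1) : Plane))
    ((c⁻¹ • (T.1 • ContinuousLinearMap.fst ℝ ℝ ℝ + T.2 • ContinuousLinearMap.snd ℝ ℝ ℝ)).prod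
      (-T.2 • ContinuousLinearMap.fst ℝ ℝ ℝ + T.1 • ContinuousLinearMap.snd ℝ ℝ ℝ))
    (fun z => by
      rw [esq] at hT
      ext
      · simp
        field_simp
        linear_combination c * z.1 * hT
      · simp
        linear_combination z.2 * hT)
    (fun v => by
      rw [esq] at hT
      ext
      · simp
        field_simp
        linear_combination v.1 * hT
      · simp
        field_simp
        linear_combination v.2 * hT)

@[simp] lemma frameEquiv_apply (T : Plane) (hT : esq T = 1) (c : ℝ) (hc : c ≠ 0) (z : ℝ × ℝ) :
    frameEquiv T hT c hc z = z.1 • (c • T) + z.2 • ((-T.2, T.1) : Plane) := rfl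

lemma frameEquiv_symm_apply (T : Plane) (hT : esq T = 1) (c : ℝ) (hc : c ≠ 0) (v : Plane) :
    (frameEquiv T hT c hc).symm v
      = (c⁻¹ * (T.1 * v.1 + T.2 * v.2), -T.2 * v.1 + T.1 * v.2) := rfl

namespace BoundaryParam

variable {Ω : Set Plane} (P : BoundaryParam Ω)

lemma contDiff_deriv : ContDiff ℝ (⊤ : ℕ∞) (deriv P.γ) :=
  (contDiff_infty_iff_deriv.1 P.smooth).2

lemma contDiff_nuVec : ContDiff ℝ (⊤ : ℕ∞) (nuVec P.γ) :=
  (P.contDiff_deriv.snd.neg).prodMk P.contDiff_deriv.fst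

lemma continuous_curvOf : Continuous (curvOf P.γ) := by
  have h : Continuous (deriv (deriv P.γ)) := (contDiff_infty_iff_deriv.1 P.contDiff_deriv).2.continuous
  have h' := P.contDiff_nuVec.continuous
  exact (h.fst.mul h'.fst).add (h.snd.mul h'.snd)

lemma hasDerivAt (s : ℝ) : HasDerivAt P.γ (deriv P.γ s) s :=
  (P.smooth.differentiable (by simp) s).hasDerivAt

lemma hasDerivAt_deriv (s : ℝ) :
    HasDerivAt (deriv P.γ) (curvOf P.γ s • nuVec P.γ s) s := by
  have h := (P.contDiff_deriv.differentiable (by simp) s).hasDerivAt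
  have h0 : (deriv P.γ s).1 * (deriv (deriv P.γ) s).1
      + (deriv P.γ s).2 * (deriv (deriv P.γ) s).2 = 0 := by
    have h1 : HasDerivAt (fun s => (deriv P.γ s).1) (deriv (deriv P.γ) s).1 s :=
      (ContinuousLinearMap.fst ℝ ℝ ℝ).hasFDerivAt.comp_hasDerivAt s h
    have h2 : HasDerivAt (fun s => (deriv P.γ s).2) (deriv (deriv P.γ) s).2 s :=
      (ContinuousLinearMap.snd ℝ ℝ ℝ).hasFDerivAt.comp_hasDerivAt s h
    have h3 := (h1.pow 2).add (h2.pow 2)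
    have h4 : (fun s => (deriv P.γ s).1) ^ 2 + (fun s => (deriv P.γ s).2) ^ 2 = fun _ => 1 :=
      funext fun s => P.unit_speed s
    rw [h4] at h3
    have := h3.unique (hasDerivAt_const s 1)
    norm_num at this
    linarith
  have hu := P.unit_speed s
  rw [esq] at hu
  have e : curvOf P.γ s • nuVec P.γ s = deriv (deriv P.γ) s := by
    ext
    · simp [curvOf, dot2, nuVec]
      linear_combination (-(deriv P.γ s).1) * h0 + (deriv (deriv P.γ) s).1 * hu
    · simp [curvOf, dot2, nuVec]
      linear_combination (-(deriv P.γ s).2) * h0 + (deriv (deriv P.γ) s).2 * hu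
  rwa [e]

lemma hasDerivAt_nuVec (s : ℝ) :
    HasDerivAt (nuVec P.γ) (-curvOf P.γ s • deriv P.γ s) s := by
  have h := P.hasDerivAt_deriv s
  have h1 : HasDerivAt (fun s => (deriv P.γ s).1) (curvOf P.γ s • nuVec P.γ s).1 s :=
    (ContinuousLinearMap.fst ℝ ℝ ℝ).hasFDerivAt.comp_hasDerivAt s h
  have h2 : HasDerivAt (fun s => (deriv P.γ s).2) (curvOf P.γ s • nuVec P.γ s).2 s :=
    (ContinuousLinearMap.snd ℝ ℝ ℝ).hasFDerivAt.comp_hasDerivAt s h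
  have e : -curvOf P.γ s • deriv P.γ s
      = (-(curvOf P.γ s • nuVec P.γ s).2, (curvOf P.γ s • nuVec P.γ s).1) := by
    ext <;> simp [nuVec]
  rw [e]
  exact h2.neg.prodMk h1

lemma periodic_deriv : Function.Periodic (deriv P.γ) P.L := fun s => by
  rw [← deriv_comp_add_const, funext P.periodic]

lemma periodic_nuVec : Function.Periodic (nuVec P.γ) P.L := fun s => by
  simp [nuVec, P.periodic_deriv s]

lemma periodic_curvOf : Function.Periodic (curvOf P.γ) P.L := fun s => by
  rw [curvOf, curvOf, P.periodic_nuVec s, ← deriv_comp_add_const, funext P.periodic_deriv]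

lemma exists_abs_curvOf_le : ∃ K, 0 ≤ K ∧ ∀ s, |curvOf P.γ s| ≤ K := by
  obtain ⟨K, hK⟩ := (isCompact_Icc (a := 0) (b := P.L)).exists_bound_of_continuousOn
    P.continuous_curvOf.continuousOn
  have h : ∀ s, |curvOf P.γ s| ≤ K := fun s => by
    obtain ⟨y, hy, e⟩ := P.periodic_curvOf.exists_mem_Ico₀ P.L_pos s
    rw [e]
    exact hK y (Ico_subset_Icc_self hy)
  exact ⟨K, (abs_nonneg _).trans (h 0), h⟩

lemma curvOf_le_kmaxOf (s : ℝ) : curvOf P.γ s ≤ kmaxOf P.γ := by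
  obtain ⟨K, -, hK⟩ := P.exists_abs_curvOf_le
  exact le_csSup ⟨K, by rintro _ ⟨s, rfl⟩; exact (le_abs_self _).trans (hK s)⟩ ⟨s, rfl⟩

lemma contDiff_normalMap : ContDiff ℝ (⊤ : ℕ∞) (normalMap P.γ) :=
  (P.smooth.comp contDiff_fst).add (contDiff_snd.smul (P.contDiff_nuVec.comp contDiff_fst))

lemma hasFDerivAt_normalMap (z : ℝ × ℝ) (hz : 1 - z.2 * curvOf P.γ z.1 ≠ 0) :
    HasFDerivAt (normalMap P.γ)
      (frameEquiv (deriv P.γ z.1) (P.unit_speed z.1) _ hz : (ℝ × ℝ) →L[ℝ] Plane) z := by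
  have h1 := (P.hasDerivAt z.1).hasFDerivAt.comp z (hasFDerivAt_fst (p := z) (𝕜 := ℝ))
  have h2 := (P.hasDerivAt_nuVec z.1).hasFDerivAt.comp z (hasFDerivAt_fst (p := z) (𝕜 := ℝ))
  have h3 := h1.add ((hasFDerivAt_snd (p := z) (𝕜 := ℝ)).smul h2)
  refine h3.congr_fderiv ?_
  ext <;> simp [nuVec] <;> ring

lemma hasStrictFDerivAt_normalMap (z : ℝ × ℝ) (hz : 1 - z.2 * curvOf P.γ z.1 ≠ 0) :
    HasStrictFDerivAt (normalMap P.γ)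
      (frameEquiv (deriv P.γ z.1) (P.unit_speed z.1) _ hz : (ℝ × ℝ) →L[ℝ] Plane) z :=
  P.contDiff_normalMap.contDiffAt.hasStrictFDerivAt' (P.hasFDerivAt_normalMap z hz) (by simp)

lemma normalMap_zsmul (s t : ℝ) (n : ℤ) :
    normalMap P.γ (s + n • P.L, t) = normalMap P.γ (s, t) := by
  simp only [normalMap, P.periodic.zsmul n s, P.periodic_nuVec.zsmul n s]

lemma exists_eq_add_zsmul {s s' : ℝ} (h : P.γ s = P.γ s') : ∃ n : ℤ, s' = s + n • P.L := by
  obtain ⟨m, hm, -⟩ := existsUnique_add_zsmul_mem_Ico P.L_pos s 0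
  obtain ⟨m', hm', -⟩ := existsUnique_add_zsmul_mem_Ico P.L_pos s' 0
  rw [zero_add] at hm hm'
  have := P.injOn hm hm' (by rw [P.periodic.zsmul, P.periodic.zsmul, h])
  refine ⟨m - m', ?_⟩
  rw [sub_smul]
  linarith

/-- Normal coordinates are injective, up to the period, in a neighbourhood of the curve. -/
lemma exists_injective_normalMap : ∃ t₁ > 0, ∀ s t s' t', |t| < t₁ → |t'| < t₁ →
    normalMap P.γ (s, t) = normalMap P.γ (s', t') → t = t' ∧ ∃ n : ℤ, s' = s + n • P.L := by
  have hL := P.L_pos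
  have hQ : IsCompact (Icc 0 P.L ×ˢ Icc (-(P.L / 2)) (P.L / 2)) := isCompact_Icc.prod isCompact_Icc
  have hev : ∀ q ∈ Icc 0 P.L ×ˢ Icc (-(P.L / 2)) (P.L / 2),
      ∀ᶠ w : (ℝ × ℝ) × (ℝ × ℝ) in 𝓝 (((0 : ℝ), (0 : ℝ)), q),
        normalMap P.γ (w.2.1, w.1.1) = normalMap P.γ (w.2.1 + w.2.2, w.1.2) →
          ((w.2.1, w.1.1) : ℝ × ℝ) = (w.2.1 + w.2.2, w.1.2) := by
    rintro ⟨s, a⟩ ⟨-, ha⟩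
    have c1 : Continuous fun w : (ℝ × ℝ) × (ℝ × ℝ) => ((w.2.1, w.1.1) : ℝ × ℝ) := by fun_prop
    have c2 : Continuous fun w : (ℝ × ℝ) × (ℝ × ℝ) => ((w.2.1 + w.2.2, w.1.2) : ℝ × ℝ) := by
      fun_prop
    have cΦ := P.contDiff_normalMap.continuous
    by_cases h : a = 0
    · subst h
      have hs := (P.hasStrictFDerivAt_normalMap (s, 0) (by simp)).eventually_left_inverse
      have e2 : Tendsto (fun w : (ℝ × ℝ) × (ℝ × ℝ) => ((w.2.1 + w.2.2, w.1.2) : ℝ × ℝ))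
          (𝓝 ((0, 0), (s, 0))) (𝓝 (s, 0)) := by
        simpa using c2.tendsto ((0, 0), (s, 0))
      filter_upwards [(c1.tendsto ((0, 0), (s, 0))).eventually hs, e2.eventually hs] with w h1 h2 he
      rw [← h1, he, h2]
    · have hne : normalMap P.γ (s, 0) ≠ normalMap P.γ (s + a, 0) := fun he => by
        obtain ⟨n, hn⟩ := P.exists_eq_add_zsmul (by simpa [normalMap] using he)
        have hn' : a = n * P.L := by simpa using hn
        have h0 : n ≠ 0 := by rintro rfl; simp at hn'; exact h hn'
        have : (1 : ℝ) ≤ |(n : ℝ)| := by exact_mod_cast Int.one_le_abs h0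
        have : |a| = |(n : ℝ)| * P.L := by rw [hn', abs_mul, abs_of_pos hL]
        have := abs_le.2 ha
        nlinarith
      filter_upwards [((cΦ.comp c1).continuousAt.ne_iff_eventually_ne
        (cΦ.comp c2).continuousAt).1 hne] with w hw he
      exact absurd he hw
  obtain ⟨t₁, ht₁, hb⟩ := Metric.eventually_nhds_iff.1
    (hQ.eventually_forall_of_forall_eventually
    (P := fun z q : ℝ × ℝ => normalMap P.γ (q.1, z.1) = normalMap P.γ (q.1 + q.2, z.2) →
      ((q.1, z.1) : ℝ × ℝ) = (q.1 + q.2, z.2)) hev)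
  refine ⟨t₁, ht₁, fun s t s' t' ht ht' h => ?_⟩
  obtain ⟨m, hm, -⟩ := existsUnique_add_zsmul_mem_Ico P.L_pos s 0
  obtain ⟨m', hm', -⟩ := existsUnique_add_zsmul_mem_Ico P.L_pos (s' - (s + m • P.L)) (-(P.L / 2))
  rw [zero_add] at hm
  have := hb (y := (t, t')) (by simp [Prod.dist_eq, ht, ht'])
    (s + m • P.L, s' - (s + m • P.L) + m' • P.L)
    ⟨Ico_subset_Icc_self hm, hm'.1, by linarith [hm'.2]⟩
  rw [show s + m • P.L + (s' - (s + m • P.L) + m' • P.L) = s' + m' • P.L by ring,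
    P.normalMap_zsmul, P.normalMap_zsmul] at this
  obtain ⟨h1, h2⟩ := Prod.ext_iff.1 (this h)
  dsimp only at h1 h2
  refine ⟨h2, m - m', ?_⟩
  rw [sub_smul]
  linarith

end BoundaryParam

namespace BoundaryParam

variable {Ω : Set Plane} (P : BoundaryParam Ω)

/-- `t₀` is a width for which normal coordinates with `|t| < t₀` are, up to the period of the curve,
a diffeomorphism onto a neighbourhood of the boundary; `K` bounds the curvature. -/
structure IsTubeWidth (K t₀ : ℝ) : Prop where
  K_nonneg : 0 ≤ K
  pos : 0 < t₀
  curv_le : ∀ s, |curvOf P.γ s| ≤ K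
  mul_le : t₀ * K ≤ 1 / 2
  inj : ∀ z w : ℝ × ℝ, |z.2| < t₀ → |w.2| < t₀ → normalMap P.γ z = normalMap P.γ w →
    z.2 = w.2 ∧ ∃ n : ℤ, w.1 = z.1 + n • P.L

lemma exists_isTubeWidth : ∃ K t₀, P.IsTubeWidth K t₀ := by
  obtain ⟨K, hK, hb⟩ := P.exists_abs_curvOf_le
  obtain ⟨t₁, ht₁, hi⟩ := P.exists_injective_normalMap
  have hK1 : 0 < 2 * (K + 1) := by positivity
  refine ⟨K, min t₁ (1 / (2 * (K + 1))), hK, lt_min ht₁ (by positivity), hb, ?_, ?_⟩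
  · refine (mul_le_mul_of_nonneg_right (min_le_right _ _) hK).trans ?_
    rw [div_mul_eq_mul_div, div_le_iff₀ hK1]
    linarith
  · intro z w hz hw h
    exact hi z.1 z.2 w.1 w.2 (hz.trans_le (min_le_left _ _)) (hw.trans_le (min_le_left _ _)) h

namespace IsTubeWidth

variable {P} {K t₀ : ℝ} (H : P.IsTubeWidth K t₀)
include H

lemma half_le (s : ℝ) {t : ℝ} (ht : |t| < t₀) : 1 / 2 ≤ 1 - t * curvOf P.γ s := by
  have : |t * curvOf P.γ s| ≤ t₀ * K := by
    rw [abs_mul]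
    exact mul_le_mul ht.le (H.curv_le s) (abs_nonneg _) H.pos.le
  linarith [(abs_le.1 this).2, H.mul_le]

lemma ne_zero {z : ℝ × ℝ} (hz : |z.2| < t₀) : 1 - z.2 * curvOf P.γ z.1 ≠ 0 := by
  linarith [H.half_le z.1 hz]

lemma isOpen_image {U : Set (ℝ × ℝ)} (hU : IsOpen U) (hU' : ∀ z ∈ U, |z.2| < t₀) :
    IsOpen (normalMap P.γ '' U) := by
  rw [isOpen_iff_mem_nhds]
  rintro _ ⟨z, hz, rfl⟩
  rw [← (P.hasStrictFDerivAt_normalMap z (H.ne_zero (hU' z hz))).map_nhds_eq_of_equiv]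
  exact image_mem_map (hU.mem_nhds hz)

lemma mem_frontier_iff {z : ℝ × ℝ} (hz : |z.2| < t₀) :
    normalMap P.γ z ∈ frontier Ω ↔ z.2 = 0 := by
  rw [← P.range_eq]
  constructor
  · rintro ⟨s, hs⟩
    exact (H.inj z (s, 0) hz (by simpa using H.pos) (by rw [← hs]; simp [normalMap])).1
  · intro h
    exact ⟨z.1, by simp [normalMap, h]⟩

lemma mem_or_notMem_closure (hΩ : IsOpen Ω) {a b : ℝ} (ha : -t₀ ≤ a) (hb : b ≤ t₀)
    (hab : ∀ t ∈ Ioo a b, t ≠ 0) :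
    (∀ z : ℝ × ℝ, z.2 ∈ Ioo a b → normalMap P.γ z ∈ Ω) ∨
      ∀ z : ℝ × ℝ, z.2 ∈ Ioo a b → normalMap P.γ z ∉ Ω := by
  have hc : IsPreconnected (normalMap P.γ '' (univ ×ˢ Ioo a b)) :=
    (isPreconnected_univ.prod isPreconnected_Ioo).image _ P.contDiff_normalMap.continuous.continuousOn
  have hsub : normalMap P.γ '' (univ ×ˢ Ioo a b) ⊆ Ω ∪ (closure Ω)ᶜ := by
    rintro _ ⟨z, ⟨-, hz⟩, rfl⟩
    by_contra hn
    simp only [mem_union, mem_compl_iff, not_or, not_not] at hn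
    refine hab _ hz ((H.mem_frontier_iff (abs_lt.2 ⟨ha.trans_lt hz.1, hz.2.trans_le hb⟩)).1 ?_)
    rw [hΩ.frontier_eq]
    exact ⟨hn.2, hn.1⟩
  by_cases hne : (normalMap P.γ '' (univ ×ˢ Ioo a b) ∩ Ω).Nonempty
  · have := hc.subset_left_of_subset_union hΩ isClosed_closure.isOpen_compl
      (disjoint_compl_right.mono_left subset_closure) hsub hne
    exact Or.inl fun z hz => this ⟨z, ⟨mem_univ _, hz⟩, rfl⟩
  · exact Or.inr fun z hz h => hne ⟨_, ⟨z, ⟨mem_univ _, hz⟩, rfl⟩, h⟩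

lemma mem_of_pos (hΩ : IsOpen Ω) {z : ℝ × ℝ} (hz : z.2 ∈ Ioo 0 t₀) : normalMap P.γ z ∈ Ω := by
  rcases H.mem_or_notMem_closure hΩ (by linarith [H.pos]) le_rfl (fun t ht => ht.1.ne') with h | h
  · exact h z hz
  · obtain ⟨ε, hε, hin⟩ := P.inward 0
    obtain ⟨t, ht⟩ := exists_between (lt_min hε H.pos)
    exact absurd (hin t ⟨ht.1, ht.2.trans_le (min_le_left _ _)⟩)
      (h (0, t) ⟨ht.1, ht.2.trans_le (min_le_right _ _)⟩)

lemma notMem_of_neg (hΩ : IsOpen Ω) (hΩb : Bornology.IsBounded Ω) {z : ℝ × ℝ}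
    (hz : z.2 ∈ Ioo (-t₀) 0) : normalMap P.γ z ∉ Ω := by
  rcases H.mem_or_notMem_closure hΩ le_rfl H.pos.le (fun t ht => ht.2.ne) with h | h
  swap
  · exact h z hz
  exfalso
  have hT : normalMap P.γ '' {z | |z.2| < t₀} ⊆ closure Ω := by
    rintro _ ⟨w, hw, rfl⟩
    change |w.2| < t₀ at hw
    obtain ⟨h1, h2⟩ := abs_lt.1 hw
    rcases lt_trichotomy w.2 0 with h0 | h0 | h0
    · exact subset_closure (h w ⟨h1, h0⟩)
    · exact frontier_subset_closure ((H.mem_frontier_iff hw).2 h0)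
    · exact subset_closure (H.mem_of_pos hΩ ⟨h0, h2⟩)
  have hTo : IsOpen (normalMap P.γ '' {z | |z.2| < t₀}) :=
    H.isOpen_image (isOpen_lt (continuous_snd.abs) continuous_const) fun _ => id
  have hcl : IsOpen (closure Ω) := by
    have : closure Ω = Ω ∪ normalMap P.γ '' {z | |z.2| < t₀} := by
      refine subset_antisymm (fun p hp => ?_) (union_subset subset_closure hT)
      by_cases hpΩ : p ∈ Ω
      · exact Or.inl hpΩ
      · have : p ∈ frontier Ω := by rw [hΩ.frontier_eq]; exact ⟨hp, hpΩ⟩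
        rw [← P.range_eq] at this
        obtain ⟨s, rfl⟩ := this
        exact Or.inr ⟨(s, 0), by simpa using H.pos, by simp [normalMap]⟩
    rw [this]
    exact hΩ.union hTo
  rcases isClopen_iff.1 ⟨isClosed_closure, hcl⟩ with he | he
  · exact (he ▸ frontier_subset_closure (P.range_eq ▸ mem_range_self 0) : P.γ 0 ∈ (∅ : Set Plane))
  · exact noncompact_univ Plane (he ▸ hΩb.isCompact_closure)

/-- The interior part of the tubular neighbourhood. -/
def _root_.SC.BoundaryParam.tube (P : BoundaryParam Ω) (t₀ : ℝ) : Set Plane :=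
  normalMap P.γ '' (univ ×ˢ Ioo 0 t₀)

/-- A choice of normal coordinates on the tubular neighbourhood. -/
def _root_.SC.BoundaryParam.coords (P : BoundaryParam Ω) (t₀ : ℝ) : Plane → ℝ × ℝ :=
  Function.invFunOn (normalMap P.γ) (univ ×ˢ Ioo 0 t₀)

lemma coords_normalMap {z : ℝ × ℝ} (hz : z.2 ∈ Ioo 0 t₀) :
    (P.coords t₀ (normalMap P.γ z)).2 = z.2 ∧
      P.γ (P.coords t₀ (normalMap P.γ z)).1 = P.γ z.1 ∧
      nuVec P.γ (P.coords t₀ (normalMap P.γ z)).1 = nuVec P.γ z.1 ∧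
      curvOf P.γ (P.coords t₀ (normalMap P.γ z)).1 = curvOf P.γ z.1 := by
  have hex : ∃ w ∈ (univ : Set ℝ) ×ˢ Ioo 0 t₀, normalMap P.γ w = normalMap P.γ z :=
    ⟨z, ⟨mem_univ _, hz⟩, rfl⟩
  have habs : ∀ t ∈ Ioo 0 t₀, |t| < t₀ := fun t ht => by rw [abs_of_pos ht.1]; exact ht.2
  obtain ⟨h1, n, hn⟩ := H.inj _ _ (habs _ hz) (habs _ (Function.invFunOn_mem hex).2)
    (Function.invFunOn_eq hex).symm
  refine ⟨h1.symm, ?_, ?_, ?_⟩ <;> rw [coords, hn]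
  exacts [P.periodic.zsmul _ _, P.periodic_nuVec.zsmul _ _, P.periodic_curvOf.zsmul _ _]

lemma isOpen_tube : IsOpen (P.tube t₀) :=
  H.isOpen_image (isOpen_univ.prod isOpen_Ioo) fun z hz => by
    rw [abs_of_pos hz.2.1]
    exact hz.2.2

/-- Normal coordinates are locally a smooth inverse of the normal map. -/
lemma exists_local_coords {z : ℝ × ℝ} (hz : z.2 ∈ Ioo 0 t₀) :
    ∃ g : Plane → ℝ × ℝ, ContDiffAt ℝ 1 g (normalMap P.γ z) ∧
      (∃ hc, HasFDerivAt g
        ((frameEquiv (deriv P.γ z.1) (P.unit_speed z.1) (1 - z.2 * curvOf P.γ z.1) hc).symm :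
          Plane →L[ℝ] ℝ × ℝ) (normalMap P.γ z)) ∧ g (normalMap P.γ z) = z ∧
      ∀ᶠ p in 𝓝 (normalMap P.γ z), (P.coords t₀ p).2 = (g p).2 ∧
        nuVec P.γ (P.coords t₀ p).1 = nuVec P.γ (g p).1 := by
  have hc := H.ne_zero (z := z) (by rw [abs_of_pos hz.1]; exact hz.2)
  have hcd : ContDiffAt ℝ 1 (normalMap P.γ) z := P.contDiff_normalMap.contDiffAt.of_le (by
    exact_mod_cast le_top)
  have hf := P.hasFDerivAt_normalMap z hc
  have hs := hcd.hasStrictFDerivAt' hf one_ne_zero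
  have h1 : hs.localInverse _ _ _ (normalMap P.γ z) = z := hs.localInverse_apply_image
  refine ⟨hs.localInverse _ _ _, hcd.to_localInverse hf one_ne_zero,
    ⟨hc, hs.to_localInverse.hasFDerivAt⟩, h1, ?_⟩
  have hcont : Tendsto (fun p => (hs.localInverse _ _ _ p).2) (𝓝 (normalMap P.γ z)) (𝓝 z.2) := by
    have := hs.localInverse_continuousAt.tendsto
    rw [h1] at this
    exact (continuous_snd.tendsto z).comp this
  filter_upwards [hs.eventually_right_inverse, hcont (isOpen_Ioo.mem_nhds hz)] with p hp hp'
  obtain ⟨e1, -, e2, -⟩ := H.coords_normalMap hp'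
  rw [hp] at e1 e2
  exact ⟨e1, e2⟩

end IsTubeWidth

end BoundaryParam

namespace BoundaryParam.IsTubeWidth

variable {Ω : Set Plane} {P : BoundaryParam Ω} {K t₀ : ℝ} (H : P.IsTubeWidth K t₀)
include H

lemma contDiffAt_coords {z : ℝ × ℝ} (hz : z.2 ∈ Ioo 0 t₀) :
    ContDiffAt ℝ 1 (fun p => (P.coords t₀ p).2) (normalMap P.γ z) ∧
      ContDiffAt ℝ 1 (fun p => nuVec P.γ (P.coords t₀ p).1) (normalMap P.γ z) := by
  obtain ⟨g, hg, -, -, he⟩ := H.exists_local_coords hz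
  have hν : ContDiff ℝ 1 (nuVec P.γ) := P.contDiff_nuVec.of_le (by exact_mod_cast le_top)
  exact ⟨hg.snd.congr_of_eventuallyEq (he.mono fun _ h => h.1),
    (hν.contDiffAt.comp _ hg.fst).congr_of_eventuallyEq (he.mono fun _ h => h.2)⟩

lemma hasFDerivAt_coords {z : ℝ × ℝ} (hz : z.2 ∈ Ioo 0 t₀) (v : Plane) :
    fderiv ℝ (fun p => (P.coords t₀ p).2) (normalMap P.γ z) v
        = (nuVec P.γ z.1).1 * v.1 + (nuVec P.γ z.1).2 * v.2 ∧
      fderiv ℝ (fun p => nuVec P.γ (P.coords t₀ p).1) (normalMap P.γ z) v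
        = (-(curvOf P.γ z.1 / (1 - z.2 * curvOf P.γ z.1))
          * ((deriv P.γ z.1).1 * v.1 + (deriv P.γ z.1).2 * v.2)) • deriv P.γ z.1 := by
  obtain ⟨g, -, ⟨hc, hg⟩, hgz, he⟩ := H.exists_local_coords hz
  have h1 : (fun p => (P.coords t₀ p).2) =ᶠ[𝓝 (normalMap P.γ z)] fun p => (g p).2 :=
    he.mono fun _ h => h.1
  have h2 : (fun p => nuVec P.γ (P.coords t₀ p).1) =ᶠ[𝓝 (normalMap P.γ z)]
      fun p => nuVec P.γ (g p).1 := he.mono fun _ h => h.2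
  have hν := (P.hasDerivAt_nuVec (g (normalMap P.γ z)).1).hasFDerivAt
  have hνg : HasFDerivAt (fun p => nuVec P.γ (g p).1) _ (normalMap P.γ z) :=
    HasFDerivAt.comp (g := nuVec P.γ) (f := fun p => (g p).1) _ hν hg.fst
  rw [h1.fderiv_eq, h2.fderiv_eq, hg.snd.fderiv, hνg.fderiv, hgz]
  constructor
  · simp [frameEquiv_symm_apply, nuVec]
  · simp [frameEquiv_symm_apply, smul_smul]
    congr 1
    ring

lemma pd_coords {z : ℝ × ℝ} (hz : z.2 ∈ Ioo 0 t₀) :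
    pd1 (fun p => (P.coords t₀ p).2) (normalMap P.γ z) = (nuVec P.γ z.1).1 ∧
      pd2 (fun p => (P.coords t₀ p).2) (normalMap P.γ z) = (nuVec P.γ z.1).2 := by
  simp [pd1, pd2, (H.hasFDerivAt_coords hz _).1]

lemma pd_normal {z : ℝ × ℝ} (hz : z.2 ∈ Ioo 0 t₀) :
    let κ := curvOf P.γ z.1 / (1 - z.2 * curvOf P.γ z.1)
    let T := deriv P.γ z.1
    pd1 (fun p => (nuVec P.γ (P.coords t₀ p).1).1) (normalMap P.γ z) = -κ * T.1 * T.1 ∧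
    pd2 (fun p => (nuVec P.γ (P.coords t₀ p).1).1) (normalMap P.γ z) = -κ * T.2 * T.1 ∧
    pd1 (fun p => (nuVec P.γ (P.coords t₀ p).1).2) (normalMap P.γ z) = -κ * T.1 * T.2 ∧
    pd2 (fun p => (nuVec P.γ (P.coords t₀ p).1).2) (normalMap P.γ z) = -κ * T.2 * T.2 := by
  have hd := ((H.contDiffAt_coords hz).2.differentiableAt one_ne_zero).hasFDerivAt
  have h := fun v => (H.hasFDerivAt_coords hz v).2
  simp only [pd1, pd2, hd.fst.fderiv, hd.snd.fderiv]
  refine ⟨?_, ?_, ?_, ?_⟩ <;> simp [h]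

lemma abs_curv_div_le (s : ℝ) {t : ℝ} (ht : t ∈ Ioo 0 t₀) :
    |curvOf P.γ s / (1 - t * curvOf P.γ s)| ≤ 2 * K ∧
      curvOf P.γ s / (1 - t * curvOf P.γ s) ≤ curvOf P.γ s + 2 * K ^ 2 * t := by
  have h := H.half_le s (t := t) (by rw [abs_of_pos ht.1]; exact ht.2)
  have hpos : 0 < 1 - t * curvOf P.γ s := by linarith
  have hk := H.curv_le s
  constructor
  · rw [abs_div, abs_of_pos hpos, div_le_iff₀ hpos]
    nlinarith [H.K_nonneg]
  · rw [div_le_iff₀ hpos]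
    have h1 : curvOf P.γ s ^ 2 ≤ K ^ 2 := sq_le_sq.2 (hk.trans (le_abs_self K))
    have h2 : t * curvOf P.γ s ^ 2 ≤ t * K ^ 2 := mul_le_mul_of_nonneg_left h1 ht.1.le
    nlinarith [mul_nonneg (mul_nonneg (sq_nonneg K) ht.1.le) (sub_nonneg.2 h)]

lemma isCompact_far (hΩ : IsOpen Ω) (hΩb : Bornology.IsBounded Ω) {η : ℝ} (hη : η ∈ Ioo 0 t₀) :
    IsCompact {p ∈ Ω | p ∉ P.tube t₀ ∨ η ≤ (P.coords t₀ p).2} := by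
  have ho : IsOpen (normalMap P.γ '' (univ ×ˢ Ioo (-t₀) η)) :=
    H.isOpen_image (isOpen_univ.prod isOpen_Ioo) fun z hz =>
      abs_lt.2 ⟨hz.2.1, hz.2.2.trans hη.2⟩
  have : {p ∈ Ω | p ∉ P.tube t₀ ∨ η ≤ (P.coords t₀ p).2}
      = closure Ω \ normalMap P.γ '' (univ ×ˢ Ioo (-t₀) η) := by
    ext p
    constructor
    · rintro ⟨hp, h⟩
      refine ⟨subset_closure hp, ?_⟩
      rintro ⟨z, ⟨-, hz⟩, rfl⟩
      have habs : |z.2| < t₀ := abs_lt.2 ⟨hz.1, hz.2.trans hη.2⟩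
      rcases lt_trichotomy z.2 0 with h0 | h0 | h0
      · exact H.notMem_of_neg hΩ hΩb ⟨hz.1, h0⟩ hp
      · have := (H.mem_frontier_iff habs).2 h0
        rw [hΩ.frontier_eq] at this
        exact this.2 hp
      · have hz' : z.2 ∈ Ioo 0 t₀ := ⟨h0, hz.2.trans hη.2⟩
        rw [(H.coords_normalMap hz').1] at h
        exact h.elim (fun h => h ⟨z, ⟨mem_univ _, hz'⟩, rfl⟩) (fun h => h.not_gt hz.2)
    · rintro ⟨hp, h⟩
      have hpΩ : p ∈ Ω := by
        by_contra hn
        have hf : p ∈ frontier Ω := by rw [hΩ.frontier_eq]; exact ⟨hp, hn⟩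
        rw [← P.range_eq] at hf
        obtain ⟨s, rfl⟩ := hf
        exact h ⟨(s, 0), ⟨mem_univ _, by simp [H.pos], hη.1⟩, by simp [normalMap]⟩
      refine ⟨hpΩ, or_iff_not_imp_left.2 fun hW => ?_⟩
      obtain ⟨z, ⟨-, hz⟩, rfl⟩ := not_not.1 hW
      rw [(H.coords_normalMap hz).1]
      by_contra hlt
      exact h ⟨z, ⟨mem_univ _, by linarith [hz.1, H.pos], not_le.1 hlt⟩, rfl⟩
  rw [this]
  exact hΩb.isCompact_closure.diff ho

lemma isOpen_far (hΩ : IsOpen Ω) {η : ℝ} (hη : η ∈ Ioo 0 t₀) :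
    IsOpen {p ∈ Ω | p ∉ P.tube t₀ ∨ η < (P.coords t₀ p).2} := by
  have hc : IsClosed (normalMap P.γ '' (Icc 0 P.L ×ˢ Icc 0 η)) :=
    ((isCompact_Icc.prod isCompact_Icc).image P.contDiff_normalMap.continuous).isClosed
  have : {p ∈ Ω | p ∉ P.tube t₀ ∨ η < (P.coords t₀ p).2}
      = Ω \ normalMap P.γ '' (Icc 0 P.L ×ˢ Icc 0 η) := by
    ext p
    refine and_congr_right fun hp => ⟨?_, fun h => ?_⟩
    · rintro h ⟨z, ⟨-, hz⟩, rfl⟩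
      have hlt := hz.2.trans_lt hη.2
      rcases hz.1.eq_or_lt with h0 | h0
      · have := (H.mem_frontier_iff (by rw [abs_of_nonneg hz.1]; exact hlt)).2 h0.symm
        rw [hΩ.frontier_eq] at this
        exact this.2 hp
      · rw [(H.coords_normalMap ⟨h0, hlt⟩).1] at h
        exact h.elim (fun h => h ⟨z, ⟨mem_univ _, h0, hlt⟩, rfl⟩) (fun h => h.not_ge hz.2)
    · refine or_iff_not_imp_left.2 fun hW => ?_
      obtain ⟨z, ⟨-, hz⟩, rfl⟩ := not_not.1 hW
      rw [(H.coords_normalMap hz).1]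
      by_contra hlt
      obtain ⟨m, hm, -⟩ := existsUnique_add_zsmul_mem_Ico P.L_pos z.1 0
      rw [zero_add] at hm
      exact h ⟨(z.1 + m • P.L, z.2), ⟨Ico_subset_Icc_self hm, hz.1.le, not_lt.1 hlt⟩,
        P.normalMap_zsmul _ _ _⟩
  rw [this]
  exact hΩ.sdiff hc

lemma near (hΩ : IsOpen Ω) {z : ℝ × ℝ} (hz : z.2 ∈ Ioo 0 t₀) :
    P.γ z.1 ∈ frontier Ω ∧ segment ℝ (P.γ z.1) (normalMap P.γ z) ⊆ closure Ω ∧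
      ‖normalMap P.γ z - P.γ z.1‖ ≤ z.2 := by
  have hf : P.γ z.1 ∈ frontier Ω := P.range_eq ▸ mem_range_self _
  refine ⟨hf, ?_, ?_⟩
  · rw [segment_eq_image']
    rintro _ ⟨θ, ⟨h0, h1⟩, rfl⟩
    rcases h0.eq_or_lt with rfl | h0
    · simpa using frontier_subset_closure hf
    · have := H.mem_of_pos hΩ (z := (z.1, θ * z.2))
        ⟨mul_pos h0 hz.1, (mul_le_of_le_one_left hz.1.le h1).trans_lt hz.2⟩
      refine subset_closure ?_
      convert this using 1
      simp [normalMap, smul_smul]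
  · have hu := P.unit_speed z.1
    rw [esq] at hu
    have h1 : ‖nuVec P.γ z.1‖ ≤ 1 := by
      rw [Prod.norm_def]
      refine max_le ?_ ?_ <;> simp only [nuVec, Real.norm_eq_abs, abs_neg] <;>
        refine abs_le_one_iff_mul_self_le_one.2 ?_ <;> nlinarith [sq_nonneg (deriv P.γ z.1).1,
          sq_nonneg (deriv P.γ z.1).2]
    simp only [normalMap, add_sub_cancel_left, norm_smul, Real.norm_eq_abs, abs_of_pos hz.1]
    exact mul_le_of_le_one_right hz.1.le h1

/-- The tubular neighbourhood of the boundary is a collar. -/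
def collar (hΩ : IsOpen Ω) (hΩb : Bornology.IsBounded Ω) : Collar Ω (kmaxOf P.γ) := by
  have hT : ∀ s, |(deriv P.γ s).1| ≤ 1 ∧ |(deriv P.γ s).2| ≤ 1 := fun s => by
    have hu := P.unit_speed s
    rw [esq] at hu
    constructor <;> refine abs_le_one_iff_mul_self_le_one.2 ?_ <;>
      nlinarith [sq_nonneg (deriv P.γ s).1, sq_nonneg (deriv P.γ s).2]
  have hb : ∀ s t x y, t ∈ Ioo 0 t₀ → |x| ≤ 1 → |y| ≤ 1 →
      |-(curvOf P.γ s / (1 - t * curvOf P.γ s)) * x * y| ≤ 1 + 2 * K + 2 * K ^ 2 := by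
    intro s t x y ht hx hy
    rw [abs_mul, abs_mul, abs_neg]
    have h1 := (H.abs_curv_div_le s ht).1
    have h2 := mul_le_of_le_one_right (abs_nonneg (curvOf P.γ s / (1 - t * curvOf P.γ s))) hx
    have h3 := mul_le_of_le_one_right (mul_nonneg (abs_nonneg
      (curvOf P.γ s / (1 - t * curvOf P.γ s))) (abs_nonneg x)) hy
    nlinarith [sq_nonneg K]
  have hK1 : 1 ≤ 1 + 2 * K + 2 * K ^ 2 := by nlinarith [sq_nonneg K, H.K_nonneg]
  exact
  { W := P.tube t₀
    t₀ := t₀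
    K := 1 + 2 * K + 2 * K ^ 2
    d := fun p => (P.coords t₀ p).2
    n₁ := fun p => (nuVec P.γ (P.coords t₀ p).1).1
    n₂ := fun p => (nuVec P.γ (P.coords t₀ p).1).2
    κ := fun p => curvOf P.γ (P.coords t₀ p).1 /
      (1 - (P.coords t₀ p).2 * curvOf P.γ (P.coords t₀ p).1)
    isOpen := H.isOpen_tube
    subset := by rintro _ ⟨z, ⟨-, hz⟩, rfl⟩; exact H.mem_of_pos hΩ hz
    t₀_pos := H.pos
    d_mem := by rintro _ ⟨z, ⟨-, hz⟩, rfl⟩; rw [(H.coords_normalMap hz).1]; exact hz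
    d_smooth := by
      rintro _ ⟨z, ⟨-, hz⟩, rfl⟩
      exact (H.contDiffAt_coords hz).1.contDiffWithinAt
    n₁_smooth := by
      rintro _ ⟨z, ⟨-, hz⟩, rfl⟩
      exact (H.contDiffAt_coords hz).2.fst.contDiffWithinAt
    n₂_smooth := by
      rintro _ ⟨z, ⟨-, hz⟩, rfl⟩
      exact (H.contDiffAt_coords hz).2.snd.contDiffWithinAt
    pd1_d := by
      rintro _ ⟨z, ⟨-, hz⟩, rfl⟩
      rw [(H.pd_coords hz).1, (H.coords_normalMap hz).2.2.1]
    pd2_d := by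
      rintro _ ⟨z, ⟨-, hz⟩, rfl⟩
      rw [(H.pd_coords hz).2, (H.coords_normalMap hz).2.2.1]
    n_sq := fun p _ => by
      have hu := P.unit_speed (P.coords t₀ p).1
      rw [esq] at hu
      simp only [nuVec]
      linarith
    n₁_bdd := by
      rintro _ ⟨z, ⟨-, hz⟩, rfl⟩
      obtain ⟨h1, h2, -, -⟩ := H.pd_normal hz
      rw [h1, h2]
      refine ⟨?_, hb _ _ _ _ hz (hT _).1 (hT _).1, hb _ _ _ _ hz (hT _).2 (hT _).1⟩
      simp only [nuVec, abs_neg]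
      exact (hT _).2.trans hK1
    n₂_bdd := by
      rintro _ ⟨z, ⟨-, hz⟩, rfl⟩
      obtain ⟨-, -, h1, h2⟩ := H.pd_normal hz
      rw [h1, h2]
      refine ⟨?_, hb _ _ _ _ hz (hT _).1 (hT _).2, hb _ _ _ _ hz (hT _).2 (hT _).2⟩
      simp only [nuVec]
      exact (hT _).1.trans hK1
    div_n := by
      rintro _ ⟨z, ⟨-, hz⟩, rfl⟩
      obtain ⟨h1, -, -, h2⟩ := H.pd_normal hz
      have hu := P.unit_speed z.1
      rw [esq] at hu
      rw [h1, h2, (H.coords_normalMap hz).1, (H.coords_normalMap hz).2.2.2]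
      linear_combination -(curvOf P.γ z.1 / (1 - z.2 * curvOf P.γ z.1)) * hu
    κ_le := by
      rintro _ ⟨z, ⟨-, hz⟩, rfl⟩
      rw [(H.coords_normalMap hz).1, (H.coords_normalMap hz).2.2.2]
      have h1 := (H.abs_curv_div_le z.1 hz).2
      have h2 := P.curvOf_le_kmaxOf z.1
      nlinarith [mul_nonneg H.K_nonneg hz.1.le, hz.1]
    κ_abs := by
      rintro _ ⟨z, ⟨-, hz⟩, rfl⟩
      rw [(H.coords_normalMap hz).1, (H.coords_normalMap hz).2.2.2]
      have h1 := (H.abs_curv_div_le z.1 hz).1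
      nlinarith [sq_nonneg K]
    isCompact_far := fun η hη => H.isCompact_far hΩ hΩb hη
    isOpen_far := fun η hη => H.isOpen_far hΩ hη
    near := by
      rintro _ ⟨z, ⟨-, hz⟩, rfl⟩
      rw [(H.coords_normalMap hz).1]
      exact ⟨P.γ z.1, H.near hΩ hz⟩ }

end BoundaryParam.IsTubeWidth

lemma CNearCl.differentiableAt_curl2 {Ω : Set Plane} {A : Plane → Plane} (hA : CNearCl 2 Ω A)
    {p : Plane} (hp : p ∈ closure Ω) : DifferentiableAt ℝ (curl2 A) p := by
  obtain ⟨U, hU, hΩU, h⟩ := hA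
  have hc : ContDiffAt ℝ 2 A p := h.contDiffAt (hU.mem_nhds (hΩU hp))
  have d : ∀ {f : Plane → ℝ}, ContDiffAt ℝ 2 f p → DifferentiableAt ℝ (fderiv ℝ f) p :=
    fun hf => (hf.fderiv_right (m := 1) (by norm_num)).differentiableAt one_ne_zero
  have h1 := (d hc.snd).clm_apply (differentiableAt_const ((1 : ℝ), (0 : ℝ)))
  have h2 := (d hc.fst).clm_apply (differentiableAt_const ((0 : ℝ), (1 : ℝ)))
  exact h1.sub h2

namespace Collar

variable {Ω : Set Plane} {k : ℝ} (W : Collar Ω k)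

lemma abs_curl2_sub_one_le {A : Plane → Plane} {M : ℝ} (hA : CNearCl 2 Ω A) (hM : 0 ≤ M)
    (hfd : ∀ x ∈ closure Ω, ‖fderiv ℝ (curl2 A) x‖ ≤ M) (hfr : ∀ x ∈ frontier Ω, curl2 A x = 1)
    {p : Plane} (hp : p ∈ W.W) : |curl2 A p - 1| ≤ M * W.d p := by
  obtain ⟨q, hq, hseg, hpq⟩ := W.near p hp
  have := (convex_segment q p).norm_image_sub_le_of_norm_fderiv_le (𝕜 := ℝ) (f := curl2 A)
    (fun x hx => hA.differentiableAt_curl2 (hseg hx)) (fun x hx => hfd x (hseg hx))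
    (left_mem_segment ℝ q p) (right_mem_segment ℝ q p)
  rw [hfr q hq, Real.norm_eq_abs] at this
  exact this.trans (mul_le_mul_of_nonneg_left hpq hM)

end Collar

end SC

/-- Uniform lower bound for the magnetic quadratic form for fields
satisfying condition (★): `q_{BA}[u] ≥ (Θ₀B - C₁ k_max B^{1/2} - C B^{1/4}) ‖u‖²`. -/
theorem quadratic_form_lower_bound
    (Ω : Set SC.Plane) (hΩ_open : IsOpen Ω) (hΩ_bdd : Bornology.IsBounded Ω)
    (hΩ_sc : SimplyConnectedSpace ↥Ω) (P : SC.BoundaryParam Ω) (D : SC.DeGennes)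
    (C₀ : ℝ) (hC₀ : 0 < C₀) :
    ∃ C > 0, ∃ B₀ > 0, ∀ B ≥ B₀, ∀ A : SC.Plane → SC.Plane, SC.StarCond Ω C₀ B A →
      ∀ u : SC.Plane → ℂ, SC.CNearCl 1 Ω u →
        (SC.Theta0 * B - D.C1 * SC.kmaxOf P.γ * B ^ ((1 : ℝ) / 2) - C * B ^ ((1 : ℝ) / 4))
            * (∫ x in Ω, ‖u x‖ ^ 2)
          ≤ ∫ x in Ω, SC.magSq B A u x := by
  obtain ⟨K₀, t₀, H⟩ := P.exists_isTubeWidth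
  obtain ⟨W⟩ : Nonempty (SC.Collar Ω (SC.kmaxOf P.γ)) := ⟨H.collar hΩ_open hΩ_bdd⟩
  set k := SC.kmaxOf P.γ with hk
  obtain ⟨K, hK1, hKk, hKW, hKC⟩ : ∃ K : ℝ, 1 ≤ K ∧ |k| ≤ K ∧ W.K ≤ K ∧ C₀ ≤ K :=
    ⟨1 + |k| + |W.K| + C₀, by
      refine ⟨?_, ?_, ?_, ?_⟩ <;>
        linarith [abs_nonneg k, abs_nonneg W.K, le_abs_self W.K]⟩
  have ht : 0 < W.t₀ / 3 := by linarith [W.t₀_pos]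
  obtain ⟨C, hC, r₀, hr₀, hprof⟩ :=
    (SC.DeGennes.isGroundState D).exists_profile K hK1 (W.t₀ / 3) ht
  refine ⟨C, hC, (2 / r₀) ^ (4 : ℝ), by positivity, fun B hB A hA u hu => ?_⟩
  have hBpos : 0 < B := lt_of_lt_of_le (by positivity) hB
  set r := B ^ (-(1 : ℝ) / 4) with hr
  have hrpos : 0 < r := Real.rpow_pos_of_pos hBpos _
  have e4 : r ^ 4 = B⁻¹ := by
    rw [hr, ← Real.rpow_natCast, ← Real.rpow_mul hBpos.le, ← Real.rpow_neg_one]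
    norm_num
  have e2 : B ^ ((1 : ℝ) / 2) = r ^ 2 / r ^ 4 := by
    rw [e4, hr, ← Real.rpow_natCast, ← Real.rpow_mul hBpos.le, ← Real.rpow_neg_one,
      ← Real.rpow_sub hBpos]
    norm_num
  have e1 : B ^ ((1 : ℝ) / 4) = r ^ 3 / r ^ 4 := by
    rw [e4, hr, ← Real.rpow_natCast, ← Real.rpow_mul hBpos.le, ← Real.rpow_neg_one,
      ← Real.rpow_sub hBpos]
    norm_num
  have hrr : r < r₀ := by
    by_contra! hle
    have h1 : (2 / r₀) ^ 4 ≤ B := by exact_mod_cast hB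
    have h2 : r₀ ^ 4 ≤ B⁻¹ := e4 ▸ pow_le_pow_left₀ hr₀.le hle 4
    have h3 : (2 / r₀) ^ 4 * r₀ ^ 4 ≤ B * B⁻¹ := by gcongr
    rw [mul_inv_cancel₀ hBpos.ne', ← mul_pow, div_mul_cancel₀ _ hr₀.ne'] at h3
    norm_num at h3
  obtain ⟨h, h', b, b', hp, hE⟩ := hprof r hrpos hrr k hKk
  obtain ⟨hA2, -, -, -, hβ, hfd, hfr⟩ := hA
  have hB4 : ∀ x, B * x = x / r ^ 4 := fun x => by rw [e4, div_inv_eq_mul, mul_comm]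
  have hΛ : SC.Theta0 * B - D.C1 * k * B ^ ((1 : ℝ) / 2) - C * B ^ ((1 : ℝ) / 4)
      = (SC.Theta0 - r ^ 2 * k * (D.u₀ 0 ^ 2 / 3) - C * r ^ 3) / r ^ 4 := by
    rw [e1, e2, SC.DeGennes.C1, mul_comm SC.Theta0, hB4]
    ring
  have hβK : ∀ p ∈ Ω, |SC.curl2 A p - 1| ≤ K * r := fun p hpΩ =>
    (hβ p (subset_closure hpΩ)).trans (mul_le_mul_of_nonneg_right hKC hrpos.le)
  rw [hΛ]
  refine W.energy_bound hΩ_open hΩ_bdd ht (by linarith [W.t₀_pos]) hp hA2 hu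
    (fun p hpW => ?_) (fun p hpΩ hpW => ?_)
  · have hd := (W.d_mem p hpW).1
    rw [hB4]
    refine hE _ hd.le _ _ (fun _ => ⟨?_, (W.κ_abs p hpW).trans hKW, ?_⟩) (hβK p (W.subset hpW))
    · exact (W.κ_le p hpW).trans (by gcongr)
    · refine (W.abs_curl2_sub_one_le hA2 (by positivity) hfd hfr hpW).trans ?_
      gcongr
  · have := hE (2 * (W.t₀ / 3)) (by positivity) 0 (SC.curl2 A p) (fun hle => by linarith)
      (hβK p hpΩ)
    rwa [(hp.h_far _ (by linarith)).1, (hp.h_far _ (by linarith)).2, (hp.b_far _ le_rfl).2,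
      ← hB4 (SC.curl2 A p)] at this
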